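/- arXiv:2502.04545 — 5 statements merged into one kernel-verified Lean document; each statement's English description precedes it below -/
import Mathlib

section
/- For every integer k ≥ 3, the polynomial Θ_k(X_1,...,X_k) ∈ F_2[X_1,...,X_k] is absolutely irreducible, i.e., its image under the map F_2[X_1,...,X_k] → \bar{F_2}[X_1,...,X_k] induced by the embedding of F_2 into its algebraic closure \bar{F_2} is irreducible. -/
open MvPolynomial

open scoped Classical in
/-- `Θ_k = ∑_{λ ∈ Λ_k} m_λ ∈ F₂[X_1,…,X_k]`, where `Λ_k` is the set of partitions of
`2^(k-1)` with at most `k` parts all of which are powers of `2`, and `m_λ` is the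
monomial symmetric polynomial associated to `λ` (coefficients reduced mod 2). -/
noncomputable def Theta (k : ℕ) : MvPolynomial (Fin k) (ZMod 2) :=
  ∑ μ ∈ Finset.univ.filter
      (fun μ : Nat.Partition (2 ^ (k - 1)) =>
        μ.parts.card ≤ k ∧ ∀ i ∈ μ.parts, ∃ j, i = 2 ^ j),
    MvPolynomial.msymm (Fin k) (ZMod 2) μ

theorem coeff_multiset_prod_X {σ R : Type*} [DecidableEq σ] [CommSemiring R] (s : Multiset σ)
    (m : σ →₀ ℕ) :
    coeff m (s.map (X : σ → MvPolynomial σ R)).prod = if s.toFinsupp = m then 1 else 0 := by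
  have h : (s.map (X : σ → MvPolynomial σ R)).prod = monomial s.toFinsupp 1 := by
    induction s using Multiset.induction with
    | empty => simp
    | cons a s ih =>
      rw [Multiset.map_cons, Multiset.prod_cons, ih, ← Multiset.singleton_add,
        Multiset.toFinsupp_add, Multiset.toFinsupp_singleton, X, monomial_mul, one_mul]
  rw [h, coeff_monomial]

/-- The exponents allowed in the monomials of `Θ_k`. -/
def IsZeroOrTwoPow (a : ℕ) : Prop := a = 0 ∨ ∃ j, a = 2 ^ j

noncomputable instance : DecidablePred IsZeroOrTwoPow := Classical.decPred _

open scoped Classical in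
theorem coeff_Theta (k : ℕ) (m : Fin k →₀ ℕ) :
    coeff m (Theta k) =
      if ∑ i, m i = 2 ^ (k - 1) ∧ ∀ i, IsZeroOrTwoPow (m i) then 1 else 0 := by
  have key : Theta k = ∑ a : Sym (Fin k) (2 ^ (k - 1)),
      if ∀ i, IsZeroOrTwoPow ((a : Multiset (Fin k)).toFinsupp i) then ((a : Multiset (Fin k)).map X).prod else 0 := by
    have hp (a : Sym (Fin k) (2 ^ (k - 1))) :
        ((Nat.Partition.ofSym a).parts.card ≤ k ∧
          ∀ i ∈ (Nat.Partition.ofSym a).parts, ∃ j, i = 2 ^ j) ↔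
        ∀ i, IsZeroOrTwoPow ((a : Multiset (Fin k)).toFinsupp i) := by
      constructor
      · rintro ⟨-, h⟩ i
        by_cases hi : i ∈ (a : Multiset (Fin k))
        · exact Or.inr (h _ (Multiset.mem_map.2 ⟨i, Multiset.mem_dedup.2 hi, rfl⟩))
        · exact Or.inl (by simpa using hi)
      · intro h
        refine ⟨?_, ?_⟩
        · have : Multiset.card (a.1.dedup.map a.1.count) ≤ k := by
            rw [Multiset.card_map]
            exact (Finset.card_le_univ a.1.toFinset).trans_eq (Fintype.card_fin k)
          exact this
        · intro x hx
          obtain ⟨i, hi, rfl⟩ := Multiset.mem_map.1 hx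
          rcases h i with h0 | h0
          · exact absurd h0 (by simpa using hi)
          · simpa using h0
    rw [← Finset.sum_filter]
    simp_rw [← hp]
    rw [Theta, ← Finset.sum_fiberwise_of_maps_to
      (g := fun a : Sym (Fin k) (2 ^ (k - 1)) => Nat.Partition.ofSym a)
      (t := Finset.univ.filter (fun μ : Nat.Partition (2 ^ (k - 1)) =>
        μ.parts.card ≤ k ∧ ∀ i ∈ μ.parts, ∃ j, i = 2 ^ j)) (by intro a ha; simpa using ha)]
    refine Finset.sum_congr rfl fun μ hμ => ?_
    rw [msymm, Finset.filter_filter,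
      ← Finset.sum_subtype_of_mem (p := fun a => Nat.Partition.ofSym a = μ)
        (fun a : Sym (Fin k) (2 ^ (k - 1)) => ((a : Multiset (Fin k)).map X).prod) (by simp)]
    refine Finset.sum_congr ?_ (by simp)
    ext a
    have := a.2
    simp only [Finset.mem_filter, Finset.mem_univ, true_and, Finset.mem_subtype] at hμ ⊢
    simp_all
  rw [key, coeff_sum]
  have hc (a : Sym (Fin k) (2 ^ (k - 1))) :
      coeff m (if ∀ i, IsZeroOrTwoPow ((a : Multiset (Fin k)).toFinsupp i)
        then ((a : Multiset (Fin k)).map (X : _ → MvPolynomial (Fin k) (ZMod 2))).prod else 0) =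
      if (a : Multiset (Fin k)) = m.toMultiset ∧ ∀ i, IsZeroOrTwoPow (m i) then 1 else 0 := by
    by_cases h : (a : Multiset (Fin k)) = m.toMultiset
    · have h' := Multiset.toFinsupp_eq_iff.2 h
      rw [apply_ite (coeff m), coeff_multiset_prod_X, h', if_pos rfl, coeff_zero]
      exact if_congr (by simp only [h, true_and]) rfl rfl
    · have h' : ¬ (a : Multiset (Fin k)).toFinsupp = m := fun h' => h (Multiset.toFinsupp_eq_iff.1 h')
      rw [apply_ite (coeff m), coeff_multiset_prod_X, if_neg h', coeff_zero, ite_self,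
        if_neg fun h'' => h h''.1]
  rw [Finset.sum_congr rfl fun a _ => hc a]
  have hcard : Multiset.card m.toMultiset = ∑ i, m i := by
    rw [Finsupp.card_toMultiset, Finsupp.sum_fintype _ _ (by simp)]
    simp
  by_cases h : ∑ i, m i = 2 ^ (k - 1)
  · refine (Finset.sum_eq_single (Sym.mk m.toMultiset (hcard.trans h)) ?_ ?_).trans ?_
    · intro b _ hb
      rw [if_neg]
      rintro ⟨h1, -⟩
      exact hb (Subtype.ext h1)
    · simp
    · simp [h]
  · rw [if_neg (by tauto)]
    refine Finset.sum_eq_zero fun a _ => if_neg ?_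
    rintro ⟨h1, -⟩
    exact h (by rw [← hcard, ← h1]; exact a.2)

theorem sum_digits_two_add_le (a b : ℕ) :
    (Nat.digits 2 (a + b)).sum ≤ (Nat.digits 2 a).sum + (Nat.digits 2 b).sum := by
  have h1 := sub_one_mul_padicValNat_factorial (p := 2) (a + b)
  have h2 := sub_one_mul_padicValNat_factorial (p := 2) a
  have h3 := sub_one_mul_padicValNat_factorial (p := 2) b
  have h4 := Nat.digit_sum_le 2 (a + b)
  have h5 := Nat.digit_sum_le 2 a
  have h6 := Nat.digit_sum_le 2 b
  have h7 : padicValNat 2 (a.factorial * b.factorial) ≤ padicValNat 2 (a + b).factorial :=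
    padicValNat_dvd_iff_le (Nat.factorial_ne_zero _) |>.1
      (pow_padicValNat_dvd.trans (Nat.factorial_mul_factorial_dvd_factorial_add a b))
  rw [padicValNat.mul (Nat.factorial_ne_zero _) (Nat.factorial_ne_zero _)] at h7
  omega

theorem sum_digits_two_pow (j : ℕ) : (Nat.digits 2 (2 ^ j)).sum = 1 := by
  induction j with
  | zero => simp
  | succ j ih =>
    rw [pow_succ', Nat.digits_base_mul one_lt_two (by positivity)]
    simpa using ih

theorem sum_digits_two_pow_sub_one (n : ℕ) : (Nat.digits 2 (2 ^ n - 1)).sum = n := by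
  induction n with
  | zero => simp
  | succ n ih =>
    have h : 2 ^ (n + 1) - 1 = 1 + 2 * (2 ^ n - 1) := by
      have := Nat.one_le_two_pow (n := n)
      rw [pow_succ']
      omega
    rw [h, Nat.digits_add 2 one_lt_two 1 _ one_lt_two (by simp), List.sum_cons, ih, add_comm]

theorem le_card_of_sum_eq_two_pow_sub_one {ι : Type*} (s : Finset ι) (f : ι → ℕ)
    (hf : ∀ i ∈ s, IsZeroOrTwoPow (f i)) {n : ℕ} (hn : ∑ i ∈ s, f i = 2 ^ n - 1) :
    n ≤ s.card := by
  have hone : ∀ i ∈ s, (Nat.digits 2 (f i)).sum ≤ 1 := by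
    intro i hi
    rcases hf i hi with h | ⟨j, h⟩
    · simp [h]
    · rw [h, sum_digits_two_pow]
  have hle : (Nat.digits 2 (∑ i ∈ s, f i)).sum ≤ ∑ i ∈ s, (Nat.digits 2 (f i)).sum :=
    Finset.le_sum_of_subadditive (fun a => (Nat.digits 2 a).sum) (by simp)
      sum_digits_two_add_le s f
  rw [hn, sum_digits_two_pow_sub_one] at hle
  simpa using hle.trans (Finset.sum_le_card_nsmul s _ 1 hone)

theorem ne_zero_of_sum_add_one_eq {n : ℕ} (m : Fin n → ℕ) (hm : ∀ i, IsZeroOrTwoPow (m i))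
    (hs : ∑ i, m i + 1 = 2 ^ n) (i : Fin n) : m i ≠ 0 := by
  intro h0
  have h := le_card_of_sum_eq_two_pow_sub_one (Finset.univ.erase i) m (fun j _ => hm j) (n := n) (by
    rw [← Finset.add_sum_erase _ _ (Finset.mem_univ i)] at hs
    omega)
  rw [Finset.card_erase_of_mem (Finset.mem_univ i), Finset.card_univ, Fintype.card_fin] at h
  have := i.pos
  omega

theorem ne_one_of_sum_eq {n : ℕ} (m : Fin n → ℕ) (hm : ∀ i, IsZeroOrTwoPow (m i))
    (hs : ∑ i, m i = 2 ^ n) (i : Fin n) : m i ≠ 1 := by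
  intro h0
  have h := le_card_of_sum_eq_two_pow_sub_one (Finset.univ.erase i) m (fun j _ => hm j) (n := n) (by
    rw [← Finset.add_sum_erase _ _ (Finset.mem_univ i)] at hs
    omega)
  rw [Finset.card_erase_of_mem (Finset.mem_univ i), Finset.card_univ, Fintype.card_fin] at h
  have := i.pos
  omega

theorem isZeroOrTwoPow_zero : IsZeroOrTwoPow 0 := Or.inl rfl

theorem isZeroOrTwoPow_one : IsZeroOrTwoPow 1 := Or.inr ⟨0, rfl⟩

theorem isZeroOrTwoPow_two : IsZeroOrTwoPow 2 := Or.inr ⟨1, rfl⟩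

theorem not_isZeroOrTwoPow_three : ¬ IsZeroOrTwoPow 3 := by
  rintro (h | ⟨j, h⟩)
  · omega
  · cases j with
    | zero => omega
    | succ j =>
      rw [pow_succ] at h
      omega

section Field

variable (K : Type*) [Field K] [Algebra (ZMod 2) K]

/-- The polynomial `Θ_k` over an extension `K` of `F₂`. -/
noncomputable def thetaOver (n : ℕ) : MvPolynomial (Fin n) K :=
  map (algebraMap (ZMod 2) K) (Theta n)

theorem coeff_thetaOver {n : ℕ} (m : Fin n →₀ ℕ) :
    coeff m (thetaOver K n) =
      if ∑ i, m i = 2 ^ (n - 1) ∧ ∀ i, IsZeroOrTwoPow (m i) then 1 else 0 := by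
  rw [thetaOver, coeff_map, coeff_Theta]
  split_ifs <;> simp

theorem isSymmetric_thetaOver (n : ℕ) : (thetaOver K n).IsSymmetric := by
  intro e
  rw [thetaOver, ← map_rename, Theta, map_sum]
  simp_rw [rename_msymm]

theorem isZeroOrTwoPow_two_mul (a : ℕ) : IsZeroOrTwoPow (2 * a) ↔ IsZeroOrTwoPow a := by
  constructor
  · rintro (h | ⟨j, h⟩)
    · exact Or.inl (by omega)
    · cases j with
      | zero => omega
      | succ j => exact Or.inr ⟨j, by rw [pow_succ'] at h; omega⟩
  · rintro (h | ⟨j, h⟩)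
    · exact Or.inl (by omega)
    · exact Or.inr ⟨j + 1, by rw [h, pow_succ']⟩

theorem coeff_single_thetaOver {n : ℕ} (i : Fin n) :
    coeff (Finsupp.single i (2 ^ (n - 1))) (thetaOver K n) = 1 := by
  rw [coeff_thetaOver, if_pos]
  refine ⟨?_, fun j => ?_⟩
  · simp [Finsupp.single_apply]
  · rw [Finsupp.single_apply]
    split_ifs
    exacts [Or.inr ⟨_, rfl⟩, Or.inl rfl]

theorem thetaOver_ne_zero {n : ℕ} (hn : n ≠ 0) : thetaOver K n ≠ 0 := by
  intro h
  have := coeff_single_thetaOver K (⟨0, Nat.pos_of_ne_zero hn⟩ : Fin n)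
  simp [h] at this

theorem thetaOver_isHomogeneous (n : ℕ) : (thetaOver K n).IsHomogeneous (2 ^ (n - 1)) := by
  intro m hm
  rw [coeff_thetaOver] at hm
  rw [Finsupp.weight_apply, Finsupp.sum_fintype _ _ (by simp)]
  simp only [Pi.one_apply, smul_eq_mul, mul_one]
  by_contra h
  exact hm (if_neg fun h' => h h'.1)

theorem totalDegree_thetaOver {n : ℕ} (hn : n ≠ 0) : (thetaOver K n).totalDegree = 2 ^ (n - 1) :=
  (thetaOver_isHomogeneous K n).totalDegree (thetaOver_ne_zero K hn)

theorem thetaOver_sq (n : ℕ) : thetaOver K n ^ 2 = expand 2 (thetaOver K n) := by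
  rw [thetaOver, ← map_expand, expand_zmod, map_pow]

theorem coeff_zero_finSuccEquiv_thetaOver {n : ℕ} (hn : n ≠ 0) :
    (finSuccEquiv K n (thetaOver K (n + 1))).coeff 0 = thetaOver K n ^ 2 := by
  rw [thetaOver_sq]
  ext m
  rw [finSuccEquiv_coeff_coeff, coeff_thetaOver]
  have hcond : (∑ i, m.cons 0 i = 2 ^ (n + 1 - 1) ∧ ∀ i, IsZeroOrTwoPow (m.cons 0 i)) ↔
      ∑ i, m i = 2 ^ n ∧ ∀ i, IsZeroOrTwoPow (m i) := by
    simp [Fin.sum_univ_succ, Fin.forall_fin_succ, isZeroOrTwoPow_zero]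
  rw [if_congr hcond rfl rfl]
  by_cases h : ∀ i, 2 ∣ m i
  · obtain ⟨m', rfl⟩ : ∃ m', m = 2 • m' := by
      choose c hc using h
      exact ⟨Finsupp.equivFunOnFinite.symm c, Finsupp.ext fun i => by simp [hc]⟩
    rw [coeff_expand_smul 2 two_ne_zero, coeff_thetaOver]
    refine if_congr ?_ rfl rfl
    obtain ⟨n, rfl⟩ := Nat.exists_eq_succ_of_ne_zero hn
    simp only [Finsupp.smul_apply, smul_eq_mul, ← Finset.mul_sum, isZeroOrTwoPow_two_mul,
      Nat.succ_eq_add_one, add_tsub_cancel_right, pow_succ', mul_right_inj' (two_ne_zero' ℕ)]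
  · obtain ⟨i, hi⟩ := not_forall.1 h
    rw [coeff_expand_of_not_dvd _ hi, if_neg]
    rintro ⟨hs, hp⟩
    refine ne_one_of_sum_eq m hp hs i ?_
    rcases hp i with h0 | ⟨j, h0⟩
    · exact absurd (h0 ▸ dvd_zero 2) hi
    · cases j with
      | zero => simpa using h0
      | succ j => exact absurd (h0 ▸ Dvd.intro_left _ (pow_succ 2 j).symm) hi

/-- The part of `Θ_{n+1}` linear in the first variable. -/
noncomputable def thetaLinear (n : ℕ) : MvPolynomial (Fin n) K :=
  (finSuccEquiv K n (thetaOver K (n + 1))).coeff 1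

theorem coeff_thetaLinear {n : ℕ} (m : Fin n →₀ ℕ) :
    coeff m (thetaLinear K n) =
      if ∑ i, m i + 1 = 2 ^ n ∧ ∀ i, IsZeroOrTwoPow (m i) then 1 else 0 := by
  rw [thetaLinear, finSuccEquiv_coeff_coeff, coeff_thetaOver]
  refine if_congr ?_ rfl rfl
  simp [Fin.sum_univ_succ, Fin.forall_fin_succ, isZeroOrTwoPow_one, add_comm]

theorem thetaLinear_ne_zero (n : ℕ) : thetaLinear K n ≠ 0 := by
  intro h
  have h1 : coeff (Finsupp.equivFunOnFinite.symm fun i : Fin n => 2 ^ (i : ℕ))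
      (thetaLinear K n) = 1 := by
    rw [coeff_thetaLinear, if_pos]
    refine ⟨?_, fun i => Or.inr ⟨i, rfl⟩⟩
    simp only [Finsupp.equivFunOnFinite_symm_apply_apply]
    rw [Fin.sum_univ_eq_sum_range (fun i => 2 ^ i), Nat.geomSum_eq le_rfl]
    have := Nat.one_le_two_pow (n := n)
    simp only [Nat.add_one_sub_one, Nat.div_one]
    omega
  simp [h] at h1

theorem X_dvd_thetaLinear {n : ℕ} (i : Fin n) : X i ∣ thetaLinear K n := by
  rw [X_dvd_iff_modMonomial_eq_zero]
  ext m
  by_cases hi : Finsupp.single i 1 ≤ m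
  · rw [coeff_modMonomial_of_le _ hi, coeff_zero]
  · rw [coeff_modMonomial_of_not_le _ hi, coeff_zero, coeff_thetaLinear, if_neg]
    rintro ⟨hs, hp⟩
    have := ne_zero_of_sum_add_one_eq m hp hs i
    exact hi (Finsupp.single_le_iff.2 (by omega))

theorem degreeOf_thetaLinear_le {n : ℕ} (i : Fin n) :
    degreeOf i (thetaLinear K n) ≤ 2 ^ (n - 1) := by
  rw [degreeOf_le_iff]
  intro m hm
  rw [mem_support_iff, coeff_thetaLinear, ne_eq, ite_eq_right_iff, Classical.not_imp] at hm
  obtain ⟨⟨hs, hp⟩, -⟩ := hm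
  rcases hp i with h | ⟨j, h⟩
  · simp [h]
  · rw [h]
    refine Nat.pow_le_pow_right two_pos ?_
    have hle : m i ≤ ∑ i, m i := Finset.single_le_sum (by simp) (Finset.mem_univ i)
    have hlt : 2 ^ j < 2 ^ n := by omega
    have := (Nat.pow_lt_pow_iff_right one_lt_two).1 hlt
    omega

theorem not_X_dvd_thetaOver {n : ℕ} (i j : Fin n) (hij : i ≠ j) : ¬ X i ∣ thetaOver K n := by
  intro h
  rw [X_dvd_iff_modMonomial_eq_zero] at h
  have h1 := coeff_single_thetaOver K j
  rw [← coeff_modMonomial_of_not_le (s := Finsupp.single i 1), h, coeff_zero] at h1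
  · exact zero_ne_one h1
  · rw [Finsupp.single_le_iff, Finsupp.single_eq_of_ne hij]
    omega

theorem not_thetaOver_dvd_thetaLinear {n : ℕ} (hn : 2 ≤ n) :
    ¬ thetaOver K n ∣ thetaLinear K n := by
  rintro ⟨q, hq⟩
  have hL := thetaLinear_ne_zero K n
  let i : Fin n := ⟨0, by omega⟩
  have hX : X i ∣ thetaOver K n * q := hq ▸ X_dvd_thetaLinear K i
  obtain ⟨r, rfl⟩ := ((X_prime (R := K)).dvd_or_dvd hX).resolve_left
    (not_X_dvd_thetaOver K i ⟨1, by omega⟩ (by simp [i]))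
  have hT := thetaOver_ne_zero K (n := n) (by omega)
  have hr : r ≠ 0 := by
    rintro rfl
    simp_all
  have hdeg := degreeOf_thetaLinear_le K i
  rw [hq, degreeOf_mul_eq hT (mul_ne_zero (X_ne_zero i) hr), degreeOf_mul_eq (X_ne_zero i) hr,
    degreeOf_X_self] at hdeg
  have hle : 2 ^ (n - 1) ≤ degreeOf i (thetaOver K n) := by
    have := monomial_le_degreeOf i (mem_support_iff.2
      ((coeff_single_thetaOver K i).trans_ne one_ne_zero))
    simpa using this
  omega

variable {K}

section Factor

variable {n : ℕ} {f g : MvPolynomial (Fin (n + 1)) K}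

theorem coeff_zero_mul_coeff_zero (hn : n ≠ 0) (h : f * g = thetaOver K (n + 1)) :
    (finSuccEquiv K n f).coeff 0 * (finSuccEquiv K n g).coeff 0 = thetaOver K n ^ 2 := by
  rw [← Polynomial.mul_coeff_zero, ← map_mul, h, coeff_zero_finSuccEquiv_thetaOver K hn]

theorem coeff_one_mul_add (h : f * g = thetaOver K (n + 1)) :
    (finSuccEquiv K n f).coeff 0 * (finSuccEquiv K n g).coeff 1 +
      (finSuccEquiv K n f).coeff 1 * (finSuccEquiv K n g).coeff 0 = thetaLinear K n := by
  rw [thetaLinear, ← h, map_mul, Polynomial.mul_coeff_one]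

theorem dvd_thetaLinear (h : f * g = thetaOver K (n + 1)) {p : MvPolynomial (Fin n) K}
    (hf : p ∣ (finSuccEquiv K n f).coeff 0) (hg : p ∣ (finSuccEquiv K n g).coeff 0) :
    p ∣ thetaLinear K n := by
  rw [← coeff_one_mul_add h]
  exact dvd_add (hf.mul_right _) (hg.mul_left _)

theorem totalDegree_coeff_zero_eq (hn : n ≠ 0) (h : f * g = thetaOver K (n + 1)) :
    ((finSuccEquiv K n f).coeff 0).totalDegree = f.totalDegree := by
  have h0 := coeff_zero_mul_coeff_zero hn h
  have hT := thetaOver_ne_zero K hn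
  have hF : (finSuccEquiv K n f).coeff 0 ≠ 0 := by
    intro hF
    rw [hF, zero_mul] at h0
    exact pow_ne_zero 2 hT h0.symm
  have hG : (finSuccEquiv K n g).coeff 0 ≠ 0 := by
    intro hG
    rw [hG, mul_zero] at h0
    exact pow_ne_zero 2 hT h0.symm
  have hf : f ≠ 0 := by
    rintro rfl
    simp at hF
  have hg : g ≠ 0 := by
    rintro rfl
    simp at hG
  have e1 := congrArg totalDegree h
  have e2 := congrArg totalDegree h0
  rw [totalDegree_mul_of_isDomain hf hg, totalDegree_thetaOver K n.succ_ne_zero] at e1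
  rw [totalDegree_mul_of_isDomain hF hG, sq, totalDegree_mul_of_isDomain hT hT,
    totalDegree_thetaOver K hn] at e2
  have l1 := totalDegree_coeff_finSuccEquiv_add_le f 0 hF
  have l2 := totalDegree_coeff_finSuccEquiv_add_le g 0 hG
  have hpow : 2 ^ n = 2 * 2 ^ (n - 1) := by rw [← pow_succ', Nat.sub_add_cancel (by omega)]
  rw [Nat.succ_sub_one] at e1
  omega

theorem isUnit_of_mul_eq (h : f * g = thetaOver K (n + 1)) (hf : f.totalDegree = 0) :
    IsUnit f := by
  rw [totalDegree_eq_zero_iff_eq_C] at hf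
  rw [hf]
  refine IsUnit.map C (isUnit_iff_ne_zero.2 fun h0 => thetaOver_ne_zero K n.succ_ne_zero ?_)
  rw [← h, hf, h0, C_0, zero_mul]

theorem isUnit_of_isUnit_coeff_zero (hn : n ≠ 0) (h : f * g = thetaOver K (n + 1))
    (hu : IsUnit ((finSuccEquiv K n f).coeff 0)) : IsUnit f :=
  isUnit_of_mul_eq h
    ((totalDegree_coeff_zero_eq hn h).symm.trans (isUnit_iff_totalDegree_of_isReduced.1 hu).2)

end Factor

theorem not_isUnit_thetaOver {n : ℕ} (hn : n ≠ 0) : ¬ IsUnit (thetaOver K n) := by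
  rw [isUnit_iff_totalDegree_of_isReduced, totalDegree_thetaOver K hn]
  simp

theorem irreducible_thetaOver_succ {n : ℕ} (hn : 2 ≤ n) (hirr : Irreducible (thetaOver K n)) :
    Irreducible (thetaOver K (n + 1)) := by
  have hn0 : n ≠ 0 := by omega
  have hp := hirr.prime
  have key {f g : MvPolynomial (Fin (n + 1)) K} (h : f * g = thetaOver K (n + 1))
      (hf : thetaOver K n ∣ (finSuccEquiv K n f).coeff 0) : IsUnit g := by
    have h0 := coeff_zero_mul_coeff_zero hn0 h
    have hg : ¬ thetaOver K n ∣ (finSuccEquiv K n g).coeff 0 := fun hg =>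
      not_thetaOver_dvd_thetaLinear K hn (dvd_thetaLinear h hf hg)
    obtain ⟨c, hc⟩ := hp.pow_dvd_of_dvd_mul_right 2 hg (dvd_of_eq h0.symm)
    refine isUnit_of_isUnit_coeff_zero hn0 ((mul_comm g f).trans h) (IsUnit.of_mul_eq_one_right c ?_)
    refine mul_left_cancel₀ (pow_ne_zero 2 hp.ne_zero) ?_
    rw [← mul_assoc, ← hc, h0, mul_one]
  refine ⟨not_isUnit_thetaOver n.succ_ne_zero, fun f g h => ?_⟩
  have h0 := coeff_zero_mul_coeff_zero hn0 h.symm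
  rcases hp.dvd_or_dvd (h0 ▸ dvd_pow_self _ two_ne_zero) with hf | hg
  · exact Or.inr (key h.symm hf)
  · exact Or.inl (key ((mul_comm g f).trans h.symm) hg)

theorem finsupp_fin_two_ext_iff {m m' : Fin 2 →₀ ℕ} : m = m' ↔ m 0 = m' 0 ∧ m 1 = m' 1 := by
  rw [Finsupp.ext_iff, Fin.forall_fin_two]

theorem thetaOver_two : thetaOver K 2 = X 0 ^ 2 + X 0 * X 1 + X 1 ^ 2 := by
  have h1 : (X 0 * X 1 : MvPolynomial (Fin 2) K) =
      monomial (Finsupp.single 0 1 + Finsupp.single 1 1) 1 := by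
    rw [X, X, monomial_mul, one_mul]
  ext m
  rw [coeff_thetaOver, h1, X_pow_eq_monomial, X_pow_eq_monomial]
  simp only [coeff_add, coeff_monomial, finsupp_fin_two_ext_iff, Fin.sum_univ_two,
    Fin.forall_fin_two]
  simp only [Finsupp.add_apply, Finsupp.single_apply, Fin.isValue, one_ne_zero, zero_ne_one,
    if_true, if_false, add_zero, zero_add]
  generalize m 0 = a
  generalize m 1 = b
  by_cases h : a + b = 2
  · obtain rfl : b = 2 - a := by omega
    have ha : a ≤ 2 := by omega
    interval_cases a <;> simp [isZeroOrTwoPow_zero, isZeroOrTwoPow_one, isZeroOrTwoPow_two]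
  · rw [if_neg (by omega), if_neg (by omega), if_neg (by omega), if_neg (by omega)]
    simp

theorem thetaLinear_two : thetaLinear K 2 = X 0 ^ 2 * X 1 + X 0 * X 1 ^ 2 := by
  have h1 : (X 0 ^ 2 * X 1 : MvPolynomial (Fin 2) K) =
      monomial (Finsupp.single 0 2 + Finsupp.single 1 1) 1 := by
    rw [X_pow_eq_monomial, X, monomial_mul, one_mul]
  have h2 : (X 0 * X 1 ^ 2 : MvPolynomial (Fin 2) K) =
      monomial (Finsupp.single 0 1 + Finsupp.single 1 2) 1 := by
    rw [X_pow_eq_monomial, X, monomial_mul, one_mul]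
  ext m
  rw [coeff_thetaLinear, h1, h2]
  simp only [coeff_add, coeff_monomial, finsupp_fin_two_ext_iff, Fin.sum_univ_two,
    Fin.forall_fin_two]
  simp only [Finsupp.add_apply, Finsupp.single_apply, Fin.isValue, one_ne_zero, zero_ne_one,
    if_true, if_false, add_zero, zero_add]
  generalize m 0 = a
  generalize m 1 = b
  by_cases h : a + b = 3
  · obtain rfl : b = 3 - a := by omega
    have ha : a ≤ 3 := by omega
    interval_cases a <;> simp [isZeroOrTwoPow_zero, isZeroOrTwoPow_one, isZeroOrTwoPow_two, not_isZeroOrTwoPow_three]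
  · rw [if_neg (by omega), if_neg (by omega), if_neg (by omega)]
    simp

theorem isRelPrime_thetaOver_two : IsRelPrime (thetaOver K 2) (thetaLinear K 2) := by
  have : CharP K 2 := charP_of_injective_algebraMap (algebraMap (ZMod 2) K).injective 2
  have h2 : (2 : MvPolynomial (Fin 2) K) = 0 := CharTwo.two_eq_zero
  refine WfDvdMonoid.isRelPrime_of_no_irreducible_factors (fun h => thetaOver_ne_zero K two_ne_zero h.1)
    fun p hp hT hL => ?_
  have h0 : p ∣ X 0 ^ 3 := by
    have e : (X 0 ^ 3 : MvPolynomial (Fin 2) K) = thetaOver K 2 * X 0 + thetaLinear K 2 := by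
      rw [thetaOver_two, thetaLinear_two]
      linear_combination (- X 0 ^ 2 * X 1 - X 0 * X 1 ^ 2) * h2
    exact e ▸ dvd_add (hT.mul_right _) hL
  have hX := (hp.associated_of_dvd X_prime.irreducible (hp.prime.dvd_of_dvd_pow h0)).dvd'
  exact not_X_dvd_thetaOver K 0 1 (by simp) (hX.trans hT)

theorem even_of_coeff_sq_ne_zero {σ : Type*} (p : MvPolynomial σ K) {m : σ →₀ ℕ}
    (hm : coeff m (p ^ 2) ≠ 0) (i : σ) : 2 ∣ m i := by
  have : CharP K 2 := charP_of_injective_algebraMap (algebraMap (ZMod 2) K).injective 2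
  by_contra hi
  rw [← map_frobenius_expand, coeff_map, coeff_expand_of_not_dvd _ hi, map_zero] at hm
  exact hm rfl

section Cubic

variable {f g : MvPolynomial (Fin 3) K}

theorem exists_coeff_zero_eq_C_mul_sq (h : f * g = thetaOver K 3) :
    ∃ (c : K) (d : MvPolynomial (Fin 2) K), c ≠ 0 ∧ (finSuccEquiv K 2 f).coeff 0 = C c * d ^ 2 := by
  have h0 := coeff_zero_mul_coeff_zero two_ne_zero h
  have hrel : IsRelPrime ((finSuccEquiv K 2 f).coeff 0) ((finSuccEquiv K 2 g).coeff 0) := by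
    refine WfDvdMonoid.isRelPrime_of_no_irreducible_factors (fun h' => ?_) fun p hp hf hg => ?_
    · rw [h'.1, zero_mul] at h0
      exact pow_ne_zero 2 (thetaOver_ne_zero K two_ne_zero) h0.symm
    · refine hp.not_isUnit (isRelPrime_thetaOver_two ?_ (dvd_thetaLinear h hf hg))
      exact hp.prime.dvd_of_dvd_pow (h0 ▸ hf.mul_right _)
  let := UniqueFactorizationMonoid.toGCDMonoid (MvPolynomial (Fin 2) K)
  obtain ⟨d, u, hu⟩ := exists_associated_pow_of_mul_eq_pow ((gcd_isUnit_iff_isRelPrime).2 hrel) h0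
  obtain ⟨c, hc, huc⟩ := isUnit_iff_eq_C_of_isReduced.1 u.isUnit
  exact ⟨c, d, hc.ne_zero, by rw [← hu, huc, mul_comm]⟩

theorem two_dvd_totalDegree (h : f * g = thetaOver K 3) : 2 ∣ f.totalDegree := by
  obtain ⟨c, d, hc, hd⟩ := exists_coeff_zero_eq_C_mul_sq h
  rw [← totalDegree_coeff_zero_eq two_ne_zero h, hd]
  rcases eq_or_ne d 0 with rfl | hd0
  · simp
  · rw [sq, totalDegree_mul_of_isDomain (C_ne_zero.2 hc) (mul_ne_zero hd0 hd0), totalDegree_C,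
      totalDegree_mul_of_isDomain hd0 hd0]
    omega

theorem two_dvd_of_coeff_ne_zero_of_apply_zero (h : f * g = thetaOver K 3) {m : Fin 3 →₀ ℕ}
    (hm : coeff m f ≠ 0) (hm0 : m 0 = 0) (j : Fin 3) : 2 ∣ m j := by
  obtain ⟨c, d, hc, hd⟩ := exists_coeff_zero_eq_C_mul_sq h
  rw [← Finsupp.cons_tail m, hm0, ← finSuccEquiv_coeff_coeff, hd, coeff_C_mul] at hm
  refine Fin.cases (by simp [hm0]) (fun j => ?_) j
  simpa [Finsupp.tail_apply] using even_of_coeff_sq_ne_zero d (right_ne_zero_of_mul hm) j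

theorem two_dvd_of_coeff_ne_zero (h : f * g = thetaOver K 3) {m : Fin 3 →₀ ℕ}
    (hm : coeff m f ≠ 0) {i : Fin 3} (hi : m i = 0) (j : Fin 3) : 2 ∣ m j := by
  let e := Equiv.swap 0 i
  have h' : rename e f * rename e g = thetaOver K 3 := by
    rw [← map_mul, h, isSymmetric_thetaOver]
  have hm' : coeff (m.mapDomain e) (rename e f) ≠ 0 := by
    rwa [coeff_rename_mapDomain _ e.injective]
  have happ (l : Fin 3) : m.mapDomain e (e l) = m l := Finsupp.mapDomain_apply e.injective m l
  rw [← happ j]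
  refine two_dvd_of_coeff_ne_zero_of_apply_zero h' hm' ?_ _
  rw [← hi, ← happ i, Equiv.swap_apply_right]

theorem coeff_one_eq_zero (h : f * g = thetaOver K 3) (hf : f.totalDegree ≤ 2) :
    (finSuccEquiv K 2 f).coeff 1 = 0 := by
  ext m
  rw [finSuccEquiv_coeff_coeff, coeff_zero]
  by_contra hm
  have hdeg := (le_totalDegree (mem_support_iff.2 hm)).trans hf
  rw [Finsupp.sum_fintype _ _ (by simp), Fin.sum_univ_succ, Fin.sum_univ_two] at hdeg
  simp only [Finsupp.cons_zero, Finsupp.cons_succ] at hdeg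
  obtain ⟨i, hi⟩ : ∃ i, m i = 0 := by
    by_contra! hne
    have := hne 0
    have := hne 1
    omega
  have := two_dvd_of_coeff_ne_zero h hm (i := i.succ) (by simpa using hi) 0
  simp at this

end Cubic

theorem irreducible_thetaOver_three : Irreducible (thetaOver K 3) := by
  refine ⟨not_isUnit_thetaOver three_ne_zero, fun f g h => ?_⟩
  by_contra! hne
  have h' : g * f = thetaOver K 3 := (mul_comm g f).trans h.symm
  have hf := mt (isUnit_of_mul_eq h.symm) hne.1
  have hg := mt (isUnit_of_mul_eq h') hne.2
  have hT := thetaOver_ne_zero K three_ne_zero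
  have hdeg := congrArg totalDegree h
  rw [totalDegree_mul_of_isDomain (left_ne_zero_of_mul (h ▸ hT))
    (right_ne_zero_of_mul (h ▸ hT)), totalDegree_thetaOver K three_ne_zero] at hdeg
  have hf2 := two_dvd_totalDegree h.symm
  have hg2 := two_dvd_totalDegree h'
  refine thetaLinear_ne_zero K 2 ?_
  rw [← coeff_one_mul_add h.symm, coeff_one_eq_zero h.symm (by omega),
    coeff_one_eq_zero h' (by omega)]
  simp

theorem irreducible_thetaOver {n : ℕ} (hn : 3 ≤ n) : Irreducible (thetaOver K n) := by
  induction n, hn using Nat.le_induction with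
  | base => exact irreducible_thetaOver_three
  | succ n hn ih => exact irreducible_thetaOver_succ (by omega) ih

end Field

/-- For every `k ≥ 3`, the polynomial `Θ_k` is absolutely irreducible, i.e. its image in
`\bar{F}₂[X_1,…,X_k]` is irreducible. -/
theorem theta_absolutely_irreducible (k : ℕ) (hk : 3 ≤ k) :
    Irreducible
      (MvPolynomial.map (algebraMap (ZMod 2) (AlgebraicClosure (ZMod 2))) (Theta k)) := by
  exact irreducible_thetaOver hk
end

section
/- For every integer k ≥ 2, the polynomials Θ_k(X_1,...,X_k) and Δ(X_1,...,X_k) are coprime in F_2[X_1,...,X_k], i.e., they have no nonconstant common factor. -/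
open MvPolynomial

/-- The Moore determinant `Δ(X_1,…,X_k) = det (X_j^{2^{i-1}})_{1 ≤ i,j ≤ k}` over `F₂`. -/
noncomputable def MooreDet (k : ℕ) : MvPolynomial (Fin k) (ZMod 2) :=
  Matrix.det (Matrix.of fun i j : Fin k =>
    (X j : MvPolynomial (Fin k) (ZMod 2)) ^ 2 ^ (i : ℕ))

/-- If the Moore determinant of a family in a domain of characteristic `p` vanishes, then the
family is linearly dependent over the prime field. -/
theorem not_linearIndependent_of_moore_det_eq_zero {p k : ℕ} [Fact p.Prime] {D : Type*}
    [CommRing D] [IsDomain D] [Algebra (ZMod p) D] (x : Fin k → D)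
    (h : Matrix.det (Matrix.of fun i j : Fin k => x j ^ p ^ (i : ℕ)) = 0) :
    ¬ LinearIndependent (ZMod p) x := by
  intro hx
  have : CharP D p := charP_of_injective_algebraMap' (ZMod p) p
  obtain ⟨v, hv, hvM⟩ := Matrix.exists_vecMul_eq_zero_iff.mpr h
  have hp : 1 < p := (Fact.out : p.Prime).one_lt
  let P : Polynomial D := ∑ i : Fin k, Polynomial.monomial (p ^ (i : ℕ)) (v i)
  have hcoeff (i : Fin k) : P.coeff (p ^ (i : ℕ)) = v i := by
    simp [P, Polynomial.finsetSum_coeff, Polynomial.coeff_monomial,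
      Nat.pow_right_inj hp, Fin.val_inj]
  have hP : P = 0 := by
    apply Polynomial.eq_zero_of_natDegree_lt_card_of_eval_eq_zero P
      (f := Fintype.linearCombination (ZMod p) x)
      (linearIndependent_iff_injective_fintypeLinearCombination.mp hx)
    · intro c
      have hroot (j : Fin k) : ∑ i, v i * x j ^ p ^ (i : ℕ) = 0 := by
        simpa [Matrix.vecMul, dotProduct] using congrFun hvM j
      simp only [P, Polynomial.eval_finsetSum, Polynomial.eval_monomial,
        Fintype.linearCombination_apply, sum_pow_char_pow, smul_pow, ZMod.pow_card_pow,
        Finset.mul_sum, mul_smul_comm]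
      rw [Finset.sum_comm]
      simp [← Finset.smul_sum, hroot]
    · rw [Fintype.card_fun, ZMod.card, Fintype.card_fin]
      refine (Polynomial.natDegree_sum_le_of_forall_le (n := p ^ (k - 1)) _ _ fun i _ =>
        (Polynomial.natDegree_monomial_le _).trans
          (Nat.pow_le_pow_right hp.le (by omega))).trans_lt ?_
      obtain ⟨i, -⟩ := Function.ne_iff.mp hv
      exact Nat.pow_lt_pow_right hp (by have := i.2; omega)
  exact hv (funext fun i => by rw [← hcoeff, hP]; simp)

/-- An irreducible factor of the Moore determinant is associated to a nonzero linear form. -/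
theorem exists_associated_sumSMulX_of_dvd_mooreDet {k : ℕ} {q : MvPolynomial (Fin k) (ZMod 2)}
    (hq : Irreducible q) (h : q ∣ MooreDet k) :
    ∃ c : Fin k →₀ ZMod 2, c ≠ 0 ∧ Associated q (sumSMulX c) := by
  have : (Ideal.span {q}).IsPrime :=
    (Ideal.span_singleton_prime hq.ne_zero).mpr hq.prime
  let φ := Ideal.Quotient.mkₐ (ZMod 2) (Ideal.span {q})
  have hdet : Matrix.det (Matrix.of fun i j : Fin k => φ (X j) ^ 2 ^ (i : ℕ)) = 0 := by
    have h0 : φ (MooreDet k) = 0 :=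
      Ideal.Quotient.eq_zero_iff_mem.mpr (Ideal.mem_span_singleton.mpr h)
    rw [MooreDet, AlgHom.map_det] at h0
    rw [← h0]
    congr 1
  have hdep := not_linearIndependent_of_moore_det_eq_zero _ hdet
  rw [linearIndependent_iff] at hdep
  push Not at hdep
  obtain ⟨c, hc, hc0⟩ := hdep
  refine ⟨c, hc0, hq.associated_of_dvd ?_ ?_⟩
  · obtain ⟨i, hi⟩ := Finsupp.ne_iff.mp hc0
    exact irreducible_sumSMulX c (Finsupp.support_nonempty_iff.mpr hc0) fun r hr =>
      isUnit_of_dvd_unit (hr i) (isUnit_iff_ne_zero.mpr hi)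
  · rw [← Ideal.mem_span_singleton, ← Ideal.Quotient.eq_zero_iff_mem, ← hc]
    change φ _ = _
    simp [sumSMulX, Finsupp.linearCombination_apply, Finsupp.sum, map_sum]

open scoped Classical in
/-- The value of `Theta k` at the indicator vector of `T` counts the monomials of degree
`2 ^ (k - 1)` in the variables indexed by `T` whose nonzero exponents are powers of two. -/
theorem eval_indicator_Theta (k : ℕ) (T : Finset (Fin k)) :
    eval (fun i => if i ∈ T then 1 else 0) (Theta k) =
      (Finset.card {s : Sym (Fin k) (2 ^ (k - 1)) |
        (∀ i ∈ s, i ∈ T) ∧ ∀ i ∈ s, ∃ j, (s : Multiset (Fin k)).count i = 2 ^ j} : ZMod 2) := by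
  have hgood (s : Sym (Fin k) (2 ^ (k - 1))) :
      ((Nat.Partition.ofSym s).parts.card ≤ k ∧
        ∀ i ∈ (Nat.Partition.ofSym s).parts, ∃ j, i = 2 ^ j) ↔
      ∀ i ∈ s, ∃ j, (s : Multiset (Fin k)).count i = 2 ^ j := by
    have : (Nat.Partition.ofSym s).parts.card ≤ k := by
        simpa [Nat.Partition.ofSym, Multiset.toFinset] using
        Finset.card_le_univ (Multiset.toFinset s.1)
    rw [and_iff_right this]
    simp [Nat.Partition.ofSym]
  have hval (s : Sym (Fin k) (2 ^ (k - 1))) :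
      eval (fun i => if i ∈ T then (1 : ZMod 2) else 0) (s.1.map X).prod =
        if ∀ i ∈ s, i ∈ T then 1 else 0 := by
    rw [map_multiset_prod, Multiset.map_map]
    split_ifs with hs
    · refine Multiset.prod_eq_one fun y hy => ?_
      obtain ⟨i, hi, rfl⟩ := Multiset.mem_map.mp hy
      simp [hs i hi]
    · push Not at hs
      obtain ⟨i, hi, hiT⟩ := hs
      exact Multiset.prod_eq_zero (Multiset.mem_map.mpr ⟨i, hi, by simp [hiT]⟩)
  simp only [Theta, msymm, map_sum, hval]
  have hfiber (μ : Nat.Partition (2 ^ (k - 1))) :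
      (∑ s : {s : Sym (Fin k) _ // Nat.Partition.ofSym s = μ},
        if ∀ i ∈ s.1, i ∈ T then (1 : ZMod 2) else 0) =
      ∑ s : Sym (Fin k) (2 ^ (k - 1)), if Nat.Partition.ofSym s = μ then
        (if ∀ i ∈ s, i ∈ T then 1 else 0) else 0 := by
    refine .trans ?_ (Finset.sum_filter _ _)
    exact (Finset.sum_subtype (p := fun s => Nat.Partition.ofSym s = μ)
      (Finset.univ.filter fun s => Nat.Partition.ofSym s = μ) (by simp)
      fun s : Sym (Fin k) (2 ^ (k - 1)) => if ∀ i ∈ s, i ∈ T then (1 : ZMod 2) else 0).symm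
  simp only [hfiber]
  rw [Finset.sum_comm]
  simp only [Finset.sum_ite_eq, Finset.mem_filter_univ, hgood]
  simp only [← ite_and]
  rw [Finset.sum_boole]
  simp only [and_comm]

/-- `Theta k` takes the value `1` at each standard basis vector. -/
theorem eval_single_Theta (k : ℕ) (a : Fin k) :
    eval (fun i => if i ∈ ({a} : Finset (Fin k)) then 1 else 0) (Theta k) = 1 := by
  classical
  rw [eval_indicator_Theta]
  have : ({s : Sym (Fin k) (2 ^ (k - 1)) | (∀ i ∈ s, i ∈ ({a} : Finset (Fin k))) ∧
      ∀ i ∈ s, ∃ j, (s : Multiset (Fin k)).count i = 2 ^ j} : Finset _) =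
      {Sym.replicate _ a} := by
    ext s
    simp only [Finset.mem_filter_univ, Finset.mem_singleton]
    constructor
    · exact fun h => Sym.eq_replicate.mpr h.1
    · rintro rfl
      simp [Sym.mem_replicate, Sym.coe_replicate]
  rw [this]
  simp

theorem two_pow_add_two_pow_eq {i j n : ℕ} (h : 2 ^ i + 2 ^ j = 2 ^ (n + 1)) : i = n ∧ j = n := by
  wlog hij : i ≤ j generalizing i j
  · exact (this (by omega) (by omega)).symm
  rcases hij.eq_or_lt with rfl | hij
  · rw [← two_mul, ← pow_succ'] at h
    have := Nat.pow_right_injective le_rfl h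
    omega
  · have h1 : 2 ^ i < 2 ^ j := Nat.pow_lt_pow_right one_lt_two hij
    have h2 : 2 ^ j < 2 ^ (n + 1) := by have := Nat.two_pow_pos i; omega
    have h3 : 2 ^ (n + 1) < 2 ^ (j + 1) := by rw [pow_succ 2 j]; omega
    rw [Nat.pow_lt_pow_iff_right one_lt_two] at h2 h3
    omega

/-- `Theta k` takes the value `1` at each sum of two distinct standard basis vectors: the
monomials that contribute are `X_a ^ 2 ^ (k - 1)`, `X_b ^ 2 ^ (k - 1)` and
`(X_a * X_b) ^ 2 ^ (k - 2)`. -/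
theorem eval_pair_Theta (k : ℕ) (hk : 2 ≤ k) {a b : Fin k} (hab : a ≠ b) :
    eval (fun i => if i ∈ ({a, b} : Finset (Fin k)) then 1 else 0) (Theta k) = 1 := by
  classical
  obtain ⟨n, rfl⟩ := Nat.exists_eq_add_of_le' hk
  rw [eval_indicator_Theta]
  let m : Sym (Fin (n + 2)) (2 ^ (n + 1)) :=
    ⟨Multiset.replicate (2 ^ n) a + Multiset.replicate (2 ^ n) b, by simp [pow_succ, mul_two]⟩
  have hm (i) : (m : Multiset (Fin (n + 2))).count i =
      (if a = i then 2 ^ n else 0) + if b = i then 2 ^ n else 0 := by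
    simp [m, Multiset.count_replicate]
  have hpos : 2 ^ n ≠ 0 := by positivity
  have hset : ({s : Sym (Fin (n + 2)) (2 ^ (n + 1)) |
      (∀ i ∈ s, i ∈ ({a, b} : Finset (Fin (n + 2)))) ∧
      ∀ i ∈ s, ∃ j, (s : Multiset (Fin (n + 2))).count i = 2 ^ j} : Finset _) =
      {Sym.replicate _ a, Sym.replicate _ b, m} := by
    ext s
    simp only [Finset.mem_filter_univ, Finset.mem_insert, Finset.mem_singleton]
    constructor
    · rintro ⟨hs, hj⟩
      by_cases ha : a ∈ s
      · by_cases hb : b ∈ s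
        · right; right
          obtain ⟨i, hi⟩ := hj a ha
          obtain ⟨j, hj⟩ := hj b hb
          have hcard : (s : Multiset (Fin (n + 2))).count a +
              (s : Multiset (Fin (n + 2))).count b = 2 ^ (n + 1) := by
            rw [← Finset.sum_pair (f := fun x => (s : Multiset (Fin (n + 2))).count x) hab,
              Multiset.sum_count_eq_card (by simpa using hs)]
            exact s.2
          obtain ⟨rfl, rfl⟩ := two_pow_add_two_pow_eq (hi ▸ hj ▸ hcard)
          apply Sym.coe_injective
          ext x
          rw [hm]
          by_cases hxa : a = x
          · subst hxa
            simp [hi, hab.symm]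
          · by_cases hxb : b = x
            · subst hxb
              simp [hj, hab]
            · rw [if_neg hxa, if_neg hxb, Multiset.count_eq_zero]
              intro hx
              have := hs x hx
              tauto
        · left
          refine Sym.eq_replicate.mpr fun x hx => ?_
          exact (hs x hx).resolve_right fun h => hb (h ▸ hx)
      · right; left
        refine Sym.eq_replicate.mpr fun x hx => ?_
        exact (hs x hx).resolve_left fun h => ha (h ▸ hx)
    · rintro (rfl | rfl | rfl)
      · simp [Sym.mem_replicate, Sym.coe_replicate]
      · simp [Sym.mem_replicate, Sym.coe_replicate]
      · have hmem (i) (hi : i ∈ m) : i = a ∨ i = b := by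
          simpa [m, hpos, Multiset.mem_replicate] using hi
        refine ⟨fun i hi => by simpa using hmem i hi, fun i hi => ⟨n, ?_⟩⟩
        rw [hm]
        rcases hmem i hi with rfl | rfl <;> simp [hab, hab.symm]
  have hne : Sym.replicate (2 ^ (n + 1)) a ≠ Sym.replicate (2 ^ (n + 1)) b := fun h => by
    simpa [Sym.coe_replicate, Multiset.count_replicate, hab.symm] using
      congrArg (fun s : Sym _ _ => (s : Multiset (Fin (n + 2))).count a) h
  have hma : Sym.replicate (2 ^ (n + 1)) a ≠ m := fun h => by
    simpa [hm, Sym.coe_replicate, Multiset.count_replicate, hab, hpos.symm] using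
      congrArg (fun s : Sym _ _ => (s : Multiset (Fin (n + 2))).count b) h
  have hmb : Sym.replicate (2 ^ (n + 1)) b ≠ m := fun h => by
    simpa [hm, Sym.coe_replicate, Multiset.count_replicate, hab.symm, hpos.symm] using
      congrArg (fun s : Sym _ _ => (s : Multiset (Fin (n + 2))).count a) h
  change ((Finset.card {s : Sym (Fin (n + 2)) (2 ^ (n + 1)) | _} : ℕ) : ZMod 2) = 1
  rw [hset, Finset.card_eq_three.mpr ⟨_, _, _, hne, hma, hmb, rfl⟩]
  rfl

/-- For every `k ≥ 2`, the polynomials `Θ_k` and `Δ(X_1,…,X_k)` are coprime in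
`F₂[X_1,…,X_k]`: they have no nonconstant common factor, i.e. every common divisor
is a unit. -/
theorem theta_moore_coprime (k : ℕ) (hk : 2 ≤ k) :
    IsRelPrime (Theta k) (MooreDet k) := by
  refine WfDvdMonoid.isRelPrime_of_no_irreducible_factors ?_ fun q hq hΘ hΔ => ?_
  · rintro ⟨h, -⟩
    simpa [h] using eval_single_Theta k ⟨0, by omega⟩
  obtain ⟨c, hc, hassoc⟩ := exists_associated_sumSMulX_of_dvd_mooreDet hq hΔ
  have hzero (f : Fin k → ZMod 2) (hf : ∑ i, c i * f i = 0) : eval f (Theta k) = 0 := by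
    obtain ⟨r, hr⟩ := hassoc.symm.dvd.trans hΘ
    have : eval f (sumSMulX c) = 0 := by
      rw [← hf, sumSMulX, Finsupp.linearCombination_apply, Finsupp.sum_fintype _ _ (by simp)]
      simp [smul_eval]
    rw [hr, map_mul, this, zero_mul]
  by_cases h0 : ∃ a, c a = 0
  · obtain ⟨a, ha⟩ := h0
    have := hzero (fun i => if i ∈ ({a} : Finset (Fin k)) then 1 else 0) (by simp [ha])
    rw [eval_single_Theta] at this
    exact one_ne_zero this
  · push Not at h0
    have h1 (i) : c i = 1 := (by decide : ∀ x : ZMod 2, x ≠ 0 → x = 1) _ (h0 i)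
    let a : Fin k := ⟨0, by omega⟩
    let b : Fin k := ⟨1, by omega⟩
    have hab : a ≠ b := by simp [a, b]
    have := hzero (fun i => if i ∈ ({a, b} : Finset (Fin k)) then 1 else 0)
      (by
        simp only [h1, one_mul, Finset.sum_boole, Finset.filter_univ_mem, Finset.card_pair hab]
        rfl)
    rw [eval_pair_Theta k hk hab] at this
    exact one_ne_zero this
end

section
/- Let k ≥ 3 and n be positive integers with n ≥ (log_2(1+√21)/3)·(13k−19) (an inequality of real numbers). Then the multiplicative inverse function f_inv on F_{2^n} is not kth order sum-free; that is, there exists a k-dimensional F_2-affine subspace A of F_{2^n} with ∑_{x∈A} f_inv(x) = 0. -/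
open Finset

section CharacterSums

variable {F : Type*} [Field F] [Fintype F] [CharP F 2]

theorem exists_trace_char (F : Type*) [Field F] [Fintype F] [Algebra (ZMod 2) F] :
    ∃ ψ : AddChar F ℤ, ψ.IsPrimitive ∧ ∀ x, ψ (x ^ 2) = ψ x := by
  have h2 : (-1 : ℤ) ^ 2 = 1 := by norm_num
  refine ⟨(AddChar.zmodChar 2 h2).compAddMonoidHom
    (Algebra.trace (ZMod 2) F).toAddMonoidHom, ?_, ?_⟩
  · refine AddChar.IsPrimitive.of_ne_one ?_
    obtain ⟨x, hx⟩ := Algebra.trace_surjective (ZMod 2) F 1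
    intro h
    have := DFunLike.congr_fun h x
    simp [AddChar.compAddMonoidHom_apply, hx, AddChar.zmodChar_apply, ZMod.val_one] at this
  · intro x
    have := Algebra.trace_eq_of_algEquiv (FiniteField.frobeniusAlgEquivOfAlgebraic (ZMod 2) F) x
    simp only [FiniteField.coe_frobeniusAlgEquivOfAlgebraic, ZMod.card] at this
    simp [AddChar.compAddMonoidHom_apply, this]

omit [Fintype F] in
theorem char_eq_one_or (ψ : AddChar F ℤ) (x : F) : ψ x = 1 ∨ ψ x = -1 := by
  have : ψ x * ψ x = 1 := by
    rw [← AddChar.map_add_eq_mul, CharTwo.add_self_eq_zero, AddChar.map_zero_eq_one]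
  exact mul_self_eq_one_iff.mp this

omit [Fintype F] in
theorem abs_char (ψ : AddChar F ℤ) (x : F) : |ψ x| = 1 := by
  rcases char_eq_one_or ψ x with h | h <;> simp [h]

variable [DecidableEq F]

theorem sum_sq_char_moment {ψ : AddChar F ℤ} (hψ : ψ.IsPrimitive) {ι : Type*} [Fintype ι]
    (f g : ι → F) :
    ∑ a, ∑ b, (∑ i, ψ (f i * a + g i * b)) ^ 2 =
      (Fintype.card F : ℤ) ^ 2 * #{p : ι × ι | f p.1 = f p.2 ∧ g p.1 = g p.2} := by
  have key : ∀ a b, (∑ i, ψ (f i * a + g i * b)) ^ 2 =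
      ∑ i, ∑ j, ψ (a * (f i + f j)) * ψ (b * (g i + g j)) := by
    intro a b
    rw [sq, sum_mul_sum]
    refine sum_congr rfl fun i _ => sum_congr rfl fun j _ => ?_
    rw [← AddChar.map_add_eq_mul, ← AddChar.map_add_eq_mul]
    congr 1; ring
  have step : ∀ i j, ∑ a, ∑ b, ψ (a * (f i + f j)) * ψ (b * (g i + g j)) =
      if f i = f j ∧ g i = g j then (Fintype.card F : ℤ) ^ 2 else 0 := by
    intro i j
    rw [← sum_mul_sum, AddChar.sum_mulShift _ hψ, AddChar.sum_mulShift _ hψ]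
    simp only [CharTwo.add_eq_zero]
    by_cases h1 : f i = f j <;> by_cases h2 : g i = g j <;> simp [h1, h2, sq]
  calc _ = ∑ a, ∑ b, ∑ i, ∑ j, ψ (a * (f i + f j)) * ψ (b * (g i + g j)) := by simp only [key]
    _ = ∑ i, ∑ j, ∑ a, ∑ b, ψ (a * (f i + f j)) * ψ (b * (g i + g j)) := by
      have e1 : ∀ a : F, ∑ b, ∑ i, ∑ j, ψ (a * (f i + f j)) * ψ (b * (g i + g j)) =
          ∑ i, ∑ j, ∑ b, ψ (a * (f i + f j)) * ψ (b * (g i + g j)) := fun a => by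
        rw [sum_comm]; exact sum_congr rfl fun i _ => sum_comm
      simp only [e1]
      rw [sum_comm]; exact sum_congr rfl fun i _ => sum_comm
    _ = _ := by
      simp only [step]
      rw [← Fintype.sum_prod_type', ← sum_filter, sum_const, nsmul_eq_mul, mul_comm]

theorem card_inverse_sum_fiber_le (s t : F) (h : s ≠ 0) :
    #{x : F | x⁻¹ + (s + x)⁻¹ = t} ≤ 4 := by
  by_cases ht : t = 0
  · have : ({x : F | x⁻¹ + (s + x)⁻¹ = t} : Finset F) = ∅ := by
      refine filter_eq_empty_iff.mpr fun x _ hx => h ?_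
      rw [ht, CharTwo.add_eq_zero, inv_inj] at hx
      simpa using hx.symm
    simp [this]
  · let p : Polynomial F := Polynomial.C t * Polynomial.X ^ 2 +
      Polynomial.C (t * s) * Polynomial.X + Polynomial.C s
    have hp : p.natDegree = 2 := Polynomial.natDegree_quadratic ht
    have hp0 : p ≠ 0 := by
      intro h0; rw [h0] at hp; simp at hp
    have hsub : ({x : F | x⁻¹ + (s + x)⁻¹ = t} : Finset F) ⊆ {0, s} ∪ p.roots.toFinset := by
      intro x hx
      simp only [mem_filter, mem_univ, true_and] at hx
      by_cases hx0 : x = 0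
      · simp [hx0]
      by_cases hxs : s + x = 0
      · rw [CharTwo.add_eq_zero] at hxs; simp [hxs]
      refine mem_union_right _ ?_
      rw [Multiset.mem_toFinset, Polynomial.mem_roots hp0]
      simp only [p, Polynomial.IsRoot.def, Polynomial.eval_add, Polynomial.eval_mul,
        Polynomial.eval_C, Polynomial.eval_pow, Polynomial.eval_X]
      field_simp at hx
      have h2 : (2 : F) = 0 := CharTwo.two_eq_zero
      linear_combination -hx + (s + x) * h2
    calc _ ≤ #({0, s} ∪ p.roots.toFinset) := card_le_card hsub
      _ ≤ #{0, s} + #p.roots.toFinset := card_union_le _ _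
      _ ≤ 2 + 2 := by
        gcongr
        · exact card_le_two
        · exact (Multiset.toFinset_card_le _).trans (p.card_roots'.trans hp.le)

theorem card_pairs_same_sums_le :
    #{p : (F × F) × (F × F) | p.1.1 + p.1.2 = p.2.1 + p.2.2 ∧
      p.1.1⁻¹ + p.1.2⁻¹ = p.2.1⁻¹ + p.2.2⁻¹} ≤ 5 * Fintype.card F ^ 2 := by
  set q := Fintype.card F with hq
  rw [card_filter, Fintype.sum_prod_type]
  have hb : ∀ p : F × F, ∑ r : F × F, (if p.1 + p.2 = r.1 + r.2 ∧
      p.1⁻¹ + p.2⁻¹ = r.1⁻¹ + r.2⁻¹ then 1 else 0) ≤ (if p.1 = p.2 then q else 0) + 4 := by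
    intro p
    have hs : ∑ r : F × F, (if p.1 + p.2 = r.1 + r.2 ∧ p.1⁻¹ + p.2⁻¹ = r.1⁻¹ + r.2⁻¹
        then 1 else 0) =
        #{x : F | x⁻¹ + ((p.1 + p.2) + x)⁻¹ = p.1⁻¹ + p.2⁻¹} := by
      rw [← card_filter]
      refine card_bij' (fun r _ => r.1) (fun x _ => (x, (p.1 + p.2) + x)) ?_ ?_ ?_ ?_
      · intro r hr
        simp only [mem_filter, mem_univ, true_and] at hr ⊢
        rw [hr.2, hr.1, add_comm r.1 r.2, add_assoc, CharTwo.add_self_eq_zero, add_zero]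
      · intro x hx
        simp only [mem_filter, mem_univ, true_and] at hx ⊢
        refine ⟨?_, hx.symm⟩
        rw [add_comm x, add_assoc, CharTwo.add_self_eq_zero, add_zero]
      · intro r hr
        simp only [mem_filter, mem_univ, true_and] at hr
        ext
        · rfl
        · simp only [hr.1]
          rw [add_comm r.1 r.2, add_assoc, CharTwo.add_self_eq_zero, add_zero]
      · intro x _; rfl
    rw [hs]
    split_ifs with h
    · exact (card_le_univ _).trans (by omega)
    · rw [zero_add]
      exact card_inverse_sum_fiber_le _ _ (by rwa [Ne, CharTwo.add_eq_zero])
  calc _ ≤ ∑ p : F × F, ((if p.1 = p.2 then q else 0) + 4) := sum_le_sum fun p _ => hb p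
    _ = 5 * q ^ 2 := by
      rw [sum_add_distrib, Fintype.sum_prod_type]
      simp [← hq]
      ring

/-- The fourth moment estimate for Kloosterman sums in characteristic two. -/
theorem kloosterman_pow_four_le {ψ : AddChar F ℤ} (hψ : ψ.IsPrimitive) {a b : F}
    (ha : a ≠ 0) :
    ((Fintype.card F : ℤ) - 1) * (∑ x, ψ (x * a + x⁻¹ * b)) ^ 4 ≤ 5 * (Fintype.card F : ℤ) ^ 4 := by
  set q := Fintype.card F with hq
  set S : F → F → ℤ := fun a b => ∑ x, ψ (x * a + x⁻¹ * b) with hS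
  have hinv : ∀ t : F, t ≠ 0 → S (a * t) (b * t⁻¹) = S a b := by
    intro t ht
    simp only [hS]
    refine Fintype.sum_equiv (Equiv.mulRight₀ t ht) _ _ fun x => ?_
    change ψ (x * (a * t) + x⁻¹ * (b * t⁻¹)) = ψ (x * t * a + (x * t)⁻¹ * b)
    rw [mul_inv]
    congr 1; ring
  have hmom : ∑ a, ∑ b, S a b ^ 4 ≤ 5 * (q : ℤ) ^ 4 := by
    have hsq : ∀ a b, S a b ^ 4 =
        (∑ p : F × F, ψ ((p.1 + p.2) * a + (p.1⁻¹ + p.2⁻¹) * b)) ^ 2 := by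
      intro a b
      rw [show (4 : ℕ) = 2 * 2 from rfl, pow_mul]
      congr 1
      rw [sq, sum_mul_sum, Fintype.sum_prod_type]
      refine sum_congr rfl fun i _ => sum_congr rfl fun j _ => ?_
      rw [← AddChar.map_add_eq_mul]
      congr 1; ring
    simp only [hsq]
    rw [sum_sq_char_moment hψ (fun p : F × F => p.1 + p.2) (fun p => p.1⁻¹ + p.2⁻¹)]
    have := card_pairs_same_sums_le (F := F)
    have h' : ((#{p : (F × F) × (F × F) | p.1.1 + p.1.2 = p.2.1 + p.2.2 ∧
      p.1.1⁻¹ + p.1.2⁻¹ = p.2.1⁻¹ + p.2.2⁻¹} : ℕ) : ℤ) ≤ 5 * (q : ℤ) ^ 2 := by exact_mod_cast this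
    calc _ ≤ (q : ℤ) ^ 2 * (5 * (q : ℤ) ^ 2) := by gcongr
      _ = _ := by ring
  refine le_trans ?_ hmom
  have hinj : Set.InjOn (fun t : F => (a * t, b * t⁻¹)) (univ.erase (0 : F) : Finset F) := by
    intro t _ t' _ h
    exact mul_left_cancel₀ ha (Prod.ext_iff.mp h).1
  rw [← Fintype.sum_prod_type']
  calc ((q : ℤ) - 1) * S a b ^ 4 = ∑ t ∈ univ.erase (0 : F), S (a * t) (b * t⁻¹) ^ 4 := by
        rw [sum_congr rfl (fun t ht => by rw [hinv t (ne_of_mem_erase ht)]), sum_const,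
          card_erase_of_mem (mem_univ _), card_univ, ← hq, nsmul_eq_mul,
          Nat.cast_sub Fintype.card_pos, Nat.cast_one]
    _ = ∑ p ∈ (univ.erase (0 : F)).image (fun t : F => (a * t, b * t⁻¹)), S p.1 p.2 ^ 4 := by
        rw [sum_image hinj]
    _ ≤ _ := sum_le_sum_of_subset_of_nonneg (subset_univ _) fun p _ _ => by positivity

theorem abs_sum_char_inv_le {ψ : AddChar F ℤ} (hψ : ψ.IsPrimitive) (D : F →+ F) (c : F) {g : F}
    (hg : g ≠ 0) {K : ℤ} (hK : ∀ a, a ≠ 0 → |∑ x, ψ (x * a + x⁻¹ * g)| ≤ K) :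
    |∑ w, ψ (g * (c + D w)⁻¹)| ≤ #{w | D w = 0} * K := by
  have hq : (0 : ℤ) < Fintype.card F := by exact_mod_cast Fintype.card_pos
  set T : F → ℤ := fun a => ∑ w, ψ (D w * a) with hT
  have hT0 : ∀ a, 0 ≤ T a := by
    intro a
    have := AddChar.sum_eq_ite ((ψ.mulShift a).compAddMonoidHom D)
    simp only [AddChar.compAddMonoidHom_apply, AddChar.mulShift_apply, mul_comm a] at this
    simp only [hT, this]
    split_ifs <;> positivity
  have hTsum : ∑ a, T a = Fintype.card F * #{w | D w = 0} := by
    simp only [hT]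
    rw [sum_comm]
    simp only [mul_comm (D _), AddChar.sum_mulShift _ hψ]
    simp only [Nat.cast_ite, Nat.cast_zero]
    rw [← sum_filter, sum_const, nsmul_eq_mul, mul_comm]
  set S : F → ℤ := fun a => ∑ x, ψ (x * a + x⁻¹ * g) with hS
  have hS0 : S 0 = 0 := by
    have := AddChar.sum_mulShift g hψ
    rw [if_neg hg, Nat.cast_zero] at this
    rw [← this]
    simp only [hS, mul_zero, zero_add]
    exact Equiv.sum_comp (Equiv.inv F) (fun x => ψ (x * g))
  have hK0 : 0 ≤ K := (abs_nonneg _).trans (hK 1 one_ne_zero)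
  have hSK : ∀ a, |S a| ≤ K := by
    intro a
    by_cases ha : a = 0
    · rw [ha, hS0, abs_zero]; exact hK0
    · exact hK a ha
  have expand : (Fintype.card F : ℤ) * ∑ w, ψ (g * (c + D w)⁻¹) =
      ∑ a, S a * ψ (c * a) * T a := by
    have e1 : ∀ a, S a * ψ (c * a) * T a =
        ∑ w, ∑ y, ψ (y⁻¹ * g) * ψ (a * (y + (c + D w))) := by
      intro a
      simp only [hS, hT]
      rw [sum_mul, sum_mul_sum, sum_comm]
      refine sum_congr rfl fun w _ => sum_congr rfl fun y _ => ?_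
      rw [← AddChar.map_add_eq_mul, ← AddChar.map_add_eq_mul, ← AddChar.map_add_eq_mul]
      congr 1; ring
    simp only [e1]
    rw [sum_comm, mul_sum]
    refine sum_congr rfl fun w _ => ?_
    rw [sum_comm]
    simp only [← mul_sum, AddChar.sum_mulShift _ hψ, CharTwo.add_eq_zero]
    simp [mul_comm]
  have hmul : (Fintype.card F : ℤ) * |∑ w, ψ (g * (c + D w)⁻¹)| ≤
      Fintype.card F * (#{w | D w = 0} * K) := by
    calc _ = |∑ a, S a * ψ (c * a) * T a| := by rw [← expand, abs_mul, abs_of_pos hq]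
      _ ≤ ∑ a, |S a * ψ (c * a) * T a| := abs_sum_le_sum_abs _ _
      _ ≤ ∑ a, K * T a := by
        refine sum_le_sum fun a _ => ?_
        rw [abs_mul, abs_mul, abs_char, mul_one, abs_of_nonneg (hT0 a)]
        exact mul_le_mul_of_nonneg_right (hSK a) (hT0 a)
      _ = _ := by rw [← mul_sum, hTsum]; ring
  exact le_of_mul_le_mul_left hmul hq

omit [CharP F 2] in
theorem card_fiber_le_card_ker (D : F →+ F) (c : F) : #{w | D w = c} ≤ #{w | D w = 0} := by
  by_cases h : c ∈ Set.range D
  · exact (AddMonoidHom.card_fiber_eq_of_mem_range D h ⟨0, map_zero D⟩).le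
  · rw [filter_eq_empty_iff.mpr fun w _ hw => h ⟨w, hw⟩]
    simp

/-- The additive map `x ↦ A x ^ 2 + c * A x`. -/
def sqAddMul (A : F →+ F) (c : F) : F →+ F :=
  AddMonoidHom.mk' (fun x => A x ^ 2 + c * A x) fun x y => by
    rw [map_add, CharTwo.add_sq]; ring

omit [Fintype F] [DecidableEq F] in
theorem sqAddMul_apply (A : F →+ F) (c x : F) : sqAddMul A c x = A x ^ 2 + c * A x := rfl

omit [Fintype F] [DecidableEq F] in
theorem sqAddMul_eq_zero_iff (A : F →+ F) (c x : F) :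
    sqAddMul A c x = 0 ↔ A x = 0 ∨ A x = c := by
  rw [sqAddMul_apply, sq, ← add_mul, mul_eq_zero, CharTwo.add_eq_zero, or_comm]

theorem card_ker_sqAddMul_le (A : F →+ F) (c : F) :
    #{x | sqAddMul A c x = 0} ≤ 2 * #{x | A x = 0} := by
  simp only [sqAddMul_eq_zero_iff, filter_or]
  refine (card_union_le _ _).trans ?_
  have := card_fiber_le_card_ker A c
  omega

theorem card_ker_sqAddMul (A : F →+ F) (v : F) (h : A v ≠ 0) :
    #{x | sqAddMul A (A v) x = 0} = 2 * #{x | A x = 0} := by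
  simp only [sqAddMul_eq_zero_iff, filter_or]
  rw [card_union_of_disjoint,
    AddMonoidHom.card_fiber_eq_of_mem_range A (x := A v) (y := 0) ⟨v, rfl⟩ ⟨0, map_zero A⟩, two_mul]
  exact disjoint_filter.mpr fun x _ h0 hv => h (hv ▸ h0)

set_option maxHeartbeats 1000000 in
/-- Let `N` be the size of the kernel of `A`. If `N ^ 2 * (8 * K + 20)` is less than the size of
the field, where `K` bounds Kloosterman sums, then some `v`, `w` make the character
`γ ↦ ψ (σ γ / e)` trivial on `ker A + ⟨v, w⟩`. -/
theorem exists_char_eq_one {ψ : AddChar F ℤ} (hψ : ψ.IsPrimitive) (A : F →+ F) (κ : F)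
    (σ : F →+ F) (hσ : ∀ x, x ≠ 0 → σ x ≠ 0) {K : ℤ}
    (hK : ∀ a b, a ≠ 0 → b ≠ 0 → |∑ x, ψ (x * a + x⁻¹ * b)| ≤ K)
    (hq : (#{x | A x = 0} : ℤ) ^ 2 * (8 * K + 20) < Fintype.card F) :
    ∃ v w e, e = κ ^ 2 + (A v ^ 2 + A v * A w + A w ^ 2) ∧ e ≠ 0 ∧ A v ≠ 0 ∧ A w ≠ 0 ∧
      A w ≠ A v ∧ ψ (σ v * e⁻¹) = 1 ∧ ψ (σ w * e⁻¹) = 1 ∧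
      ∀ u, A u = 0 → ψ (σ u * e⁻¹) = 1 := by
  by_contra! hcon
  set q : ℤ := (Fintype.card F : ℤ) with hqdef
  set V : Finset F := {x | A x = 0} with hV
  set N : ℤ := (#V : ℤ) with hN
  have hmemV : ∀ u, u ∈ V ↔ A u = 0 := by simp [hV]
  have hK0 : 0 ≤ K := (abs_nonneg _).trans (hK 1 1 one_ne_zero one_ne_zero)
  have hq0 : 0 < q := by rw [hqdef]; exact_mod_cast Fintype.card_pos
  have hNpos : 0 < N := by
    rw [hN]; exact_mod_cast card_pos.mpr ⟨0, (hmemV 0).mpr (map_zero A)⟩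
  let e : F → F → F := fun v w => κ ^ 2 + (A v ^ 2 + A v * A w + A w ^ 2)
  have he_symm : ∀ v w, e v w = e w v := fun v w => by simp only [e]; ring
  have he_add : ∀ v w, e (v + w) w = e v w := fun v w => by
    have h2 : (2 : F) = 0 := CharTwo.two_eq_zero
    simp only [e, map_add]
    linear_combination (A v * A w + A w ^ 2) * h2
  let G : F → F → ℤ := fun v w => ∑ u ∈ V, (ψ (σ u * (e v w)⁻¹) + ψ (σ (u + v) * (e v w)⁻¹) +
    ψ (σ (u + w) * (e v w)⁻¹) + ψ (σ (u + (v + w)) * (e v w)⁻¹))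
  have hψle : ∀ x, ψ x ≤ 1 := fun x => by rcases char_eq_one_or ψ x with h | h <;> simp [h]
  have hGle : ∀ v w, G v w ≤ 4 * N := by
    intro v w
    calc G v w ≤ ∑ u ∈ V, (4 : ℤ) := by
          refine sum_le_sum fun u _ => ?_
          linarith [hψle (σ u * (e v w)⁻¹), hψle (σ (u + v) * (e v w)⁻¹),
            hψle (σ (u + w) * (e v w)⁻¹), hψle (σ (u + (v + w)) * (e v w)⁻¹)]
      _ = 4 * N := by rw [sum_const, nsmul_eq_mul, hN, mul_comm]
  have hGzero : ∀ v w, e v w ≠ 0 → A v ≠ 0 → A w ≠ 0 → A w ≠ A v → G v w = 0 := by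
    intro v w h0 h1 h2 h3
    have hfac : G v w = (∑ u ∈ V, ψ (σ u * (e v w)⁻¹)) *
        ((1 + ψ (σ v * (e v w)⁻¹)) * (1 + ψ (σ w * (e v w)⁻¹))) := by
      simp only [G]
      rw [sum_mul]
      refine sum_congr rfl fun u _ => ?_
      simp only [map_add, add_mul, AddChar.map_add_eq_mul]
      ring
    rw [hfac]
    rcases char_eq_one_or ψ (σ v * (e v w)⁻¹) with hv | hv
    · rcases char_eq_one_or ψ (σ w * (e v w)⁻¹) with hw | hw
      · obtain ⟨u₀, hu₀, hne⟩ := hcon v w (e v w) rfl h0 h1 h2 h3 hv hw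
        have hu₁ : ψ (σ u₀ * (e v w)⁻¹) = -1 := (char_eq_one_or ψ _).resolve_left hne
        have hshift : ∑ u ∈ V, ψ (σ u * (e v w)⁻¹) = ∑ u ∈ V, -ψ (σ u * (e v w)⁻¹) := by
          refine sum_bij' (fun u _ => u + u₀) (fun u _ => u + u₀) ?_ ?_ ?_ ?_ ?_
          · intro u hu
            rw [hmemV] at hu ⊢
            rw [map_add, hu, hu₀, add_zero]
          · intro u hu
            rw [hmemV] at hu ⊢
            rw [map_add, hu, hu₀, add_zero]
          · intro u _; rw [add_assoc, CharTwo.add_self_eq_zero, add_zero]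
          · intro u _; rw [add_assoc, CharTwo.add_self_eq_zero, add_zero]
          · intro u _
            rw [map_add, add_mul, AddChar.map_add_eq_mul, hu₁]; ring
        rw [sum_neg_distrib] at hshift
        rw [show ∑ u ∈ V, ψ (σ u * (e v w)⁻¹) = 0 by linarith, zero_mul]
      · rw [hw]; ring
    · rw [hv]; ring
  have upper : ∑ v, ∑ w, G v w ≤ 20 * N ^ 2 * q := by
    have hpt : ∀ v w, G v w ≤ 4 * N * ((if A v = 0 then 1 else 0) + (if A w = 0 then 1 else 0) +
        (if A w = A v then 1 else 0) +
        (if sqAddMul A (A v) w = κ ^ 2 + A v ^ 2 then 1 else 0)) := by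
      intro v w
      have hle := hGle v w
      by_cases h : e v w ≠ 0 ∧ A v ≠ 0 ∧ A w ≠ 0 ∧ A w ≠ A v
      · rw [hGzero v w h.1 h.2.1 h.2.2.1 h.2.2.2]
        positivity
      · have hone : (1 : ℤ) ≤ (if A v = 0 then 1 else 0) + (if A w = 0 then 1 else 0) +
            (if A w = A v then 1 else 0) +
            (if sqAddMul A (A v) w = κ ^ 2 + A v ^ 2 then 1 else 0) := by
          have : A v = 0 ∨ A w = 0 ∨ A w = A v ∨ sqAddMul A (A v) w = κ ^ 2 + A v ^ 2 := by
            by_contra! hc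
            refine h ⟨fun he => hc.2.2.2 ?_, hc.1, hc.2.1, hc.2.2.1⟩
            rw [← CharTwo.add_eq_zero, sqAddMul_apply, ← he]
            simp only [e]; ring
          rcases this with h | h | h | h <;> simp only [h, if_true] <;> split_ifs <;> norm_num
        nlinarith
    have hrow : ∀ v, ∑ w, G v w ≤ 4 * N * (q * (if A v = 0 then 1 else 0) + 4 * N) := by
      intro v
      refine (sum_le_sum fun w _ => hpt v w).trans ?_
      rw [← mul_sum]
      refine mul_le_mul_of_nonneg_left ?_ (by positivity)
      simp only [sum_add_distrib, sum_const, card_univ, nsmul_eq_mul, sum_boole]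
      have i1 : ((#{w | A w = A v} : ℕ) : ℤ) ≤ N := by
        rw [hN, hV]
        exact_mod_cast card_fiber_le_card_ker A (A v)
      have i2 : ((#{w | sqAddMul A (A v) w = κ ^ 2 + A v ^ 2} : ℕ) : ℤ) ≤ 2 * N := by
        rw [hN, hV]
        exact_mod_cast (card_fiber_le_card_ker _ _).trans (card_ker_sqAddMul_le A (A v))
      change _ + N + _ + _ ≤ _
      linarith
    refine (sum_le_sum fun v _ => hrow v).trans (le_of_eq ?_)
    rw [← mul_sum, sum_add_distrib, ← mul_sum, sum_boole, sum_const, card_univ, nsmul_eq_mul]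
    change 4 * N * (q * N + q * (4 * N)) = _
    ring
  set B : ℤ := 2 * N * K with hB
  have hrow : ∀ v γ, -B ≤ ∑ w, ψ (σ γ * (e v w)⁻¹) := by
    intro v γ
    by_cases hγ : γ = 0
    · have : ∑ w, ψ (σ γ * (e v w)⁻¹) = q := by simp [hγ, hqdef]
      rw [this]
      have : 0 ≤ B := by positivity
      linarith
    · have h1 := abs_sum_char_inv_le hψ (sqAddMul A (A v)) (κ ^ 2 + A v ^ 2) (hσ γ hγ)
        (K := K) (fun a ha => hK a _ ha (hσ γ hγ))
      have h2 : ((#{w | sqAddMul A (A v) w = 0} : ℕ) : ℤ) ≤ 2 * N := by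
        rw [hN, hV]
        exact_mod_cast card_ker_sqAddMul_le A (A v)
      have h3 : ∑ w, ψ (σ γ * (e v w)⁻¹) =
          ∑ w, ψ (σ γ * (κ ^ 2 + A v ^ 2 + sqAddMul A (A v) w)⁻¹) := by
        refine sum_congr rfl fun w _ => ?_
        rw [sqAddMul_apply, show e v w = κ ^ 2 + A v ^ 2 + (A w ^ 2 + A v * A w) by
          simp only [e]; ring]
      rw [h3]
      refine neg_le_of_abs_le (h1.trans ?_)
      rw [hB]
      gcongr
  have split : ∑ v, ∑ w, G v w = ∑ u ∈ V, ((∑ v, ∑ w, ψ (σ u * (e v w)⁻¹)) +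
      3 * ∑ v, ∑ w, ψ (σ (u + v) * (e v w)⁻¹)) := by
    have e0 : ∑ v, ∑ w, G v w = ∑ u ∈ V, ∑ v, ∑ w, (ψ (σ u * (e v w)⁻¹) +
        ψ (σ (u + v) * (e v w)⁻¹) + ψ (σ (u + w) * (e v w)⁻¹) +
        ψ (σ (u + (v + w)) * (e v w)⁻¹)) := by
      simp only [G]
      rw [sum_congr rfl fun v _ => sum_comm]
      exact sum_comm
    rw [e0]
    refine sum_congr rfl fun u _ => ?_
    simp only [sum_add_distrib]
    have s1 : ∑ v, ∑ w, ψ (σ (u + w) * (e v w)⁻¹) = ∑ v, ∑ w, ψ (σ (u + v) * (e v w)⁻¹) := by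
      rw [sum_comm]
      exact sum_congr rfl fun v _ => sum_congr rfl fun w _ => by rw [he_symm]
    have s2 : ∑ v, ∑ w, ψ (σ (u + (v + w)) * (e v w)⁻¹) =
        ∑ v, ∑ w, ψ (σ (u + v) * (e v w)⁻¹) := by
      rw [sum_comm, sum_comm (f := fun v w => ψ (σ (u + v) * (e v w)⁻¹))]
      refine sum_congr rfl fun w _ => ?_
      rw [← Equiv.sum_comp (Equiv.addRight w) (fun v => ψ (σ (u + v) * (e v w)⁻¹))]
      exact sum_congr rfl fun v _ => by simp only [Equiv.coe_addRight, he_add]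
    rw [s1, s2]; ring
  have hdouble : ∀ γ : F → F, -(q * B) ≤ ∑ v, ∑ w, ψ (σ (γ v) * (e v w)⁻¹) := by
    intro γ
    calc -(q * B) = ∑ v : F, -B := by
          rw [sum_const, card_univ, nsmul_eq_mul, hqdef]; ring
      _ ≤ _ := sum_le_sum fun v _ => hrow v (γ v)
  have lower : q ^ 2 - 4 * N * (q * B) ≤ ∑ v, ∑ w, G v w := by
    rw [split]
    calc q ^ 2 - 4 * N * (q * B)
        ≤ ∑ u ∈ V, ((if u = 0 then q ^ 2 else 0) + -(4 * (q * B))) := by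
          rw [sum_add_distrib, sum_const, nsmul_eq_mul, sum_ite_eq', if_pos]
          · change _ ≤ _ + N * _
            linarith
          · exact (hmemV 0).mpr (map_zero A)
      _ ≤ _ := by
          refine sum_le_sum fun u _ => ?_
          have hB0 : 0 ≤ q * B := by positivity
          have hlin : ∀ x y z : ℤ, x ≤ y + q * B → -(q * B) ≤ z →
              x + -(4 * (q * B)) ≤ y + 3 * z := fun x y z _ _ => by linarith
          refine hlin _ _ _ ?_ (hdouble fun v => u + v)
          split_ifs with hu
          · have : ∑ v, ∑ w, ψ (σ u * (e v w)⁻¹) = q ^ 2 := by simp [hu, hqdef, sq]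
            rw [this]
            exact le_add_of_nonneg_right hB0
          · exact neg_le_iff_add_nonneg.mp (hdouble fun _ => u)
  have : q * q ≤ q * (N ^ 2 * (8 * K + 20)) := by
    have := lower.trans upper
    rw [hB] at this
    linarith
  exact absurd (le_of_mul_le_mul_left this hq0) (not_le.mpr hq)

/-- The `2`-polynomial `x ↦ ∑ i ≤ m, a i * x ^ 2 ^ i` as an additive map. -/
def twoPoly (a : ℕ → F) (m : ℕ) : F →+ F :=
  AddMonoidHom.mk' (fun x => ∑ i ∈ range (m + 1), a i * x ^ 2 ^ i) fun x y => by
    simp only [add_pow_char_pow, mul_add, sum_add_distrib]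

/-- The twisted adjoint `x ↦ ∑ i ≤ m, (a i * x) ^ 2 ^ (m - i)` of `twoPoly a m`. -/
def twoPolyDual (a : ℕ → F) (m : ℕ) : F →+ F :=
  AddMonoidHom.mk' (fun x => ∑ i ∈ range (m + 1), (a i * x) ^ 2 ^ (m - i)) fun x y => by
    simp only [mul_add, add_pow_char_pow, sum_add_distrib]

omit [Fintype F] [DecidableEq F] in
theorem twoPoly_apply (a : ℕ → F) (m : ℕ) (x : F) :
    twoPoly a m x = ∑ i ∈ range (m + 1), a i * x ^ 2 ^ i := rfl

omit [Fintype F] [DecidableEq F] in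
theorem twoPolyDual_apply (a : ℕ → F) (m : ℕ) (x : F) :
    twoPolyDual a m x = ∑ i ∈ range (m + 1), (a i * x) ^ 2 ^ (m - i) := rfl

omit [Fintype F] [CharP F 2] [DecidableEq F] in
theorem char_pow_two_pow {ψ : AddChar F ℤ} (hψ : ∀ x, ψ (x ^ 2) = ψ x) (x : F) (i : ℕ) :
    ψ (x ^ 2 ^ i) = ψ x := by
  induction i with
  | zero => simp
  | succ i ih => rw [pow_succ, pow_mul, hψ, ih]

omit [Fintype F] [CharP F 2] [DecidableEq F] in
theorem char_sum_eq_prod (ψ : AddChar F ℤ) {ι : Type*} (s : Finset ι) (f : ι → F) :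
    ψ (∑ i ∈ s, f i) = ∏ i ∈ s, ψ (f i) :=
  map_prod ψ.toMonoidHom (fun i => Multiplicative.ofAdd (f i)) s

omit [Fintype F] [DecidableEq F] in
theorem char_mul_twoPolyDual {ψ : AddChar F ℤ} (hψ : ∀ x, ψ (x ^ 2) = ψ x) (a : ℕ → F) (m : ℕ)
    (x y : F) : ψ (y ^ 2 ^ m * twoPolyDual a m x) = ψ (x * twoPoly a m y) := by
  rw [twoPoly_apply, twoPolyDual_apply, mul_sum, mul_sum, char_sum_eq_prod, char_sum_eq_prod]
  refine prod_congr rfl fun i hi => ?_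
  have him : i ≤ m := Nat.lt_succ_iff.mp (mem_range.mp hi)
  rw [← char_pow_two_pow hψ (x * (a i * y ^ 2 ^ i)) (m - i)]
  congr 1
  have : y ^ 2 ^ m = (y ^ 2 ^ i) ^ 2 ^ (m - i) := by
    rw [← pow_mul, ← pow_add, Nat.add_sub_cancel' him]
  rw [this, ← mul_pow]
  congr 1; ring

theorem card_fiber_eq_sum_char {ψ : AddChar F ℤ} (hψ : ψ.IsPrimitive) (L R : F →+ F) (φ : F ≃ F)
    (h : ∀ x y, ψ (φ y * R x) = ψ (x * L y)) (d : F) :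
    (#{x | R x = d} : ℤ) = ∑ y with L y = 0, ψ (φ y * d) := by
  have hq : (Fintype.card F : ℤ) ≠ 0 := by exact_mod_cast Fintype.card_ne_zero
  refine mul_left_cancel₀ hq ?_
  calc (Fintype.card F : ℤ) * #{x | R x = d} = ∑ x, ∑ z, ψ (z * (R x + d)) := by
        simp only [AddChar.sum_mulShift _ hψ, CharTwo.add_eq_zero]
        simp only [Nat.cast_ite, Nat.cast_zero]
        rw [← sum_filter, sum_const, nsmul_eq_mul, mul_comm]
    _ = ∑ x, ∑ y, ψ (x * L y) * ψ (φ y * d) := by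
        refine sum_congr rfl fun x _ => ?_
        rw [← Equiv.sum_comp φ]
        refine sum_congr rfl fun y _ => ?_
        rw [mul_add, AddChar.map_add_eq_mul, h]
    _ = _ := by
        rw [sum_comm]
        simp only [← sum_mul, AddChar.sum_mulShift _ hψ]
        simp only [Nat.cast_ite, Nat.cast_zero, ite_mul, zero_mul]
        rw [← sum_filter, mul_sum]

open Polynomial in
omit [Fintype F] [CharP F 2] [DecidableEq F] in
theorem sum_inv_roots_eq_zero {d : F} (hd : d ≠ 0) (T : F[X]) (Z : Finset F)
    (hdeg : (C d + X ^ 2 * T).natDegree ≤ #Z) (hZ : ∀ z ∈ Z, (C d + X ^ 2 * T).eval z = 0) :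
    ∑ z ∈ Z, z⁻¹ = 0 := by
  set N : F[X] := C d + X ^ 2 * T with hN
  have h0 : N.eval 0 = d := by simp [hN]
  have hN0 : N ≠ 0 := by
    intro h; rw [h, eval_zero] at h0; exact hd h0.symm
  have hle : Z.val ≤ N.roots := by
    rw [Multiset.le_iff_subset Z.nodup]
    intro z hz
    exact (mem_roots hN0).mpr (hZ z hz)
  have hroots : Z.val = N.roots := Multiset.eq_of_le_of_card_le hle (N.card_roots'.trans hdeg)
  have hs : N.Splits := by
    refine splits_iff_card_roots.mpr (le_antisymm N.card_roots' ?_)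
    rw [← hroots]; exact hdeg
  have hder := hs.eval_derivative_div_eval_of_ne_zero (x := 0) (by rw [h0]; exact hd)
  have hder0 : (derivative N).eval 0 = 0 := by simp [hN]
  rw [hder0, zero_div, ← hroots] at hder
  have : ∑ z ∈ Z, 1 / (0 - z) = 0 := hder.symm
  simpa only [zero_sub, one_div, inv_neg, sum_neg_distrib, neg_eq_zero] using this

open Polynomial in
omit [Fintype F] [DecidableEq F] in
theorem exists_quotient_sqAddMul_twoPolyDual (a : ℕ → F) {t : ℕ} (ht : 1 ≤ t)
    (ha : a (t + 1) = 1) {d : F} (hd : d * a t ^ 2 = 1) :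
    ∃ T : F[X], (C d + X ^ 2 * T).natDegree ≤ 2 ^ (t + 2) - 1 ∧
      ∀ x, x * (C d + X ^ 2 * T).eval x = sqAddMul (twoPolyDual a (t + 1)) d x := by
  have hpow : 4 ≤ 2 ^ (t + 1) := by
    calc 4 = 2 ^ 2 := rfl
      _ ≤ 2 ^ (t + 1) := Nat.pow_le_pow_right (by norm_num) (by omega)
  have hpow' : 2 ^ (t + 2) = 2 * 2 ^ (t + 1) := by ring
  set T : F[X] := ∑ i ∈ range t, C (a i ^ 2 ^ (t + 1 - i)) * X ^ (2 ^ (t + 1 - i) - 3) with hT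
  have hTdeg : T.natDegree ≤ 2 ^ (t + 1) - 3 := by
    refine natDegree_sum_le_of_forall_le _ _ fun i _ => ?_
    refine (natDegree_C_mul_X_pow_le _ _).trans ?_
    have : 2 ^ (t + 1 - i) ≤ 2 ^ (t + 1) := Nat.pow_le_pow_right (by norm_num) (by omega)
    omega
  have hR : ∀ x, twoPolyDual a (t + 1) x = x + a t ^ 2 * x ^ 2 + x ^ 3 * T.eval x := by
    intro x
    rw [twoPolyDual_apply, sum_range_succ, sum_range_succ, ha, hT, eval_finsetSum, mul_sum]
    have : ∀ i ∈ range t, (a i * x) ^ 2 ^ (t + 1 - i) =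
        x ^ 3 * (C (a i ^ 2 ^ (t + 1 - i)) * X ^ (2 ^ (t + 1 - i) - 3)).eval x := by
      intro i hi
      have hlt := mem_range.mp hi
      have h3 : 3 ≤ 2 ^ (t + 1 - i) := by
        calc 3 ≤ 2 ^ 2 := by norm_num
          _ ≤ _ := Nat.pow_le_pow_right (by norm_num) (by omega)
      rw [eval_mul, eval_C, eval_pow, eval_X, mul_pow]
      conv_lhs => rw [← Nat.sub_add_cancel h3, pow_add x]
      rw [Nat.sub_add_cancel h3]
      ring
    rw [sum_congr rfl this]
    simp
    ring
  refine ⟨C (a t ^ 4) * X + X ^ 3 * T ^ 2 + C d * T, ?_, ?_⟩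
  · have d1 : (C (a t ^ 4) * X : F[X]).natDegree ≤ 2 ^ (t + 2) - 3 :=
      (natDegree_C_mul_le _ _).trans (natDegree_X_le.trans (by omega))
    have d2 : (X ^ 3 * T ^ 2).natDegree ≤ 2 ^ (t + 2) - 3 := by
      refine natDegree_mul_le.trans ?_
      have := natDegree_pow_le (p := T) (n := 2)
      rw [natDegree_X_pow]
      omega
    have d3 : (C d * T).natDegree ≤ 2 ^ (t + 2) - 3 :=
      (natDegree_C_mul_le _ _).trans (hTdeg.trans (by omega))
    refine natDegree_add_le_of_degree_le (by simp) (natDegree_mul_le.trans ?_)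
    have := natDegree_add_le_of_degree_le (natDegree_add_le_of_degree_le d1 d2) d3
    rw [natDegree_X_pow]
    omega
  · intro x
    have h2 : (2 : F) = 0 := CharTwo.two_eq_zero
    rw [sqAddMul_apply, hR, CharTwo.add_sq, CharTwo.add_sq]
    simp only [eval_add, eval_mul, eval_pow, eval_C, eval_X]
    linear_combination (-x ^ 2) * hd - x ^ 2 * h2

/-- If the character `γ ↦ ψ (γ ^ 2 ^ t / a t)` is trivial on the root space of the monic
`2`-polynomial with coefficients `a`, then there is a subspace of one dimension more on which the
sum of inverses vanishes. -/
theorem exists_submodule_of_char_eq_one [Algebra (ZMod 2) F] {ψ : AddChar F ℤ}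
    (hψ : ψ.IsPrimitive) (hsq : ∀ x, ψ (x ^ 2) = ψ x) (a : ℕ → F) {t : ℕ} (ht : 1 ≤ t)
    (ha : a (t + 1) = 1) (he : a t ≠ 0) (hcard : #{x | twoPoly a (t + 1) x = 0} = 2 ^ (t + 1))
    (hchar : ∀ γ, twoPoly a (t + 1) γ = 0 → ψ (γ ^ 2 ^ t * (a t)⁻¹) = 1) :
    ∃ E : Submodule (ZMod 2) F, Module.finrank (ZMod 2) E = t + 2 ∧
      ∑ᶠ u : E, (u : F)⁻¹ = 0 := by
  set R := twoPolyDual a (t + 1) with hR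
  set d : F := ((a t)⁻¹) ^ 2 with hd
  have hd0 : d ≠ 0 := pow_ne_zero _ (inv_ne_zero he)
  have hde : d * a t ^ 2 = 1 := by rw [hd, ← mul_pow, inv_mul_cancel₀ he, one_pow]
  have hinj : Function.Injective fun y : F => y ^ 2 ^ (t + 1) := iterateFrobenius_inj F 2 (t + 1)
  let φ : F ≃ F := Equiv.ofBijective _ (Finite.injective_iff_bijective.mp hinj)
  have hφ : ∀ y, φ y = y ^ 2 ^ (t + 1) := fun _ => rfl
  have hadj : ∀ x y, ψ (φ y * R x) = ψ (x * twoPoly a (t + 1) y) := fun x y =>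
    char_mul_twoPolyDual hsq a (t + 1) x y
  have hc0 : #{x | R x = 0} = 2 ^ (t + 1) := by
    have := card_fiber_eq_sum_char hψ _ R φ hadj 0
    simp only [mul_zero, AddChar.map_zero_eq_one, sum_const, hcard] at this
    simp only [nsmul_eq_mul, mul_one] at this
    exact_mod_cast this
  have hcd : #{x | R x = d} = 2 ^ (t + 1) := by
    have h1 := card_fiber_eq_sum_char hψ _ R φ hadj d
    have h2 : ∀ y ∈ ({y | twoPoly a (t + 1) y = 0} : Finset F), ψ (φ y * d) = 1 := by
      intro y hy
      rw [← hchar y (by simpa using hy), ← hsq (y ^ 2 ^ t * (a t)⁻¹), hφ, hd]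
      congr 1; ring
    rw [sum_congr rfl h2, sum_const, hcard] at h1
    simp only [nsmul_eq_mul, mul_one] at h1
    exact_mod_cast h1
  obtain ⟨v, hv⟩ : ∃ v, R v = d := by
    have : 0 < #{x | R x = d} := by rw [hcd]; positivity
    obtain ⟨v, hv⟩ := card_pos.mp this
    exact ⟨v, by simpa using hv⟩
  have hcP : #{x | sqAddMul R d x = 0} = 2 ^ (t + 2) := by
    rw [← hv, card_ker_sqAddMul R v (by rw [hv]; exact hd0), hc0]; ring
  let E : Submodule (ZMod 2) F := LinearMap.ker ((sqAddMul R d).toZModLinearMap 2)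
  have hmem : ∀ x, x ∈ E ↔ sqAddMul R d x = 0 := fun x => LinearMap.mem_ker
  have : Fintype E := Fintype.ofFinite E
  refine ⟨E, ?_, ?_⟩
  · have h1 : Nat.card E = 2 ^ (t + 2) := by
      rw [← hcP, Nat.card_eq_fintype_card]
      exact Fintype.card_of_subtype _ fun x => by simp [hmem]
    have h2 := Module.natCard_eq_pow_finrank (K := ZMod 2) (V := E)
    rw [h1, Nat.card_zmod] at h2
    exact (Nat.pow_right_injective le_rfl h2).symm
  · obtain ⟨T, hT, hTe⟩ := exists_quotient_sqAddMul_twoPolyDual a ht ha hde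
    have hZ := sum_inv_roots_eq_zero hd0 T (({x | sqAddMul R d x = 0} : Finset F).erase 0)
      (by rw [card_erase_of_mem (by simp), hcP]; exact hT) (by
        intro z hz
        simp only [mem_erase, mem_filter, mem_univ, true_and] at hz
        have := hTe z
        rw [← hR, hz.2] at this
        exact (mul_eq_zero.mp this).resolve_left hz.1)
    rw [sum_erase _ inv_zero] at hZ
    rw [← hZ, finsum_eq_sum_of_fintype]
    exact (sum_subtype _ (fun x => by simp [hmem]) fun x : F => x⁻¹).symm

/-- The coefficients of `A ^ 2 + c * A`, where `A` is the `2`-polynomial with coefficients `a`. -/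
def twoPolyStep (a : ℕ → F) (c : F) : ℕ → F
  | 0 => c * a 0
  | i + 1 => a i ^ 2 + c * a (i + 1)

omit [Fintype F] [DecidableEq F] in
theorem twoPoly_twoPolyStep {a : ℕ → F} {m : ℕ} (ha : a (m + 1) = 0) (c : F) :
    twoPoly (twoPolyStep a c) (m + 1) = sqAddMul (twoPoly a m) c := by
  ext x
  rw [sqAddMul_apply, twoPoly_apply, twoPoly_apply]
  have hc : ∑ i ∈ range (m + 1), a i * x ^ 2 ^ i = ∑ i ∈ range (m + 2), a i * x ^ 2 ^ i := by
    rw [sum_range_succ _ (m + 1), ha, zero_mul, add_zero]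
  rw [CharTwo.sum_sq, hc, sum_range_succ', sum_range_succ' _ (m + 1), mul_add, ← add_assoc,
    mul_sum, ← sum_add_distrib]
  congr 1
  · refine sum_congr rfl fun i _ => ?_
    rw [twoPolyStep, mul_pow, ← pow_mul, ← pow_succ]
    ring
  · rw [twoPolyStep]; ring

omit [Fintype F] [CharP F 2] [DecidableEq F] in
theorem twoPolyStep_top {a : ℕ → F} {m : ℕ} (h1 : a m = 1) (h0 : ∀ i, m < i → a i = 0) (c : F) :
    twoPolyStep a c (m + 1) = 1 ∧ ∀ i, m + 1 < i → twoPolyStep a c i = 0 := by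
  refine ⟨by rw [twoPolyStep, h1, h0 _ (Nat.lt_succ_self m)]; ring, fun i hi => ?_⟩
  obtain ⟨i, rfl⟩ := Nat.exists_eq_succ_of_ne_zero (Nat.ne_zero_of_lt hi)
  rw [twoPolyStep, h0 i (by omega), h0 (i + 1) (by omega)]
  ring

theorem exists_twoPoly (j : ℕ) (hj : 2 ^ j ≤ Fintype.card F) :
    ∃ a : ℕ → F, a j = 1 ∧ (∀ i, j < i → a i = 0) ∧ #{x | twoPoly a j x = 0} = 2 ^ j := by
  induction j with
  | zero =>
    refine ⟨fun i => if i = 0 then 1 else 0, by simp, fun i hi => by simp [hi.ne'], ?_⟩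
    simp [twoPoly_apply, filter_eq']
  | succ j ih =>
    have hlt : 2 ^ j < Fintype.card F :=
      (Nat.pow_lt_pow_right (by norm_num) (Nat.lt_succ_self j)).trans_le hj
    obtain ⟨a, h1, h0, hc⟩ := ih hlt.le
    obtain ⟨v, hv⟩ : ∃ v, twoPoly a j v ≠ 0 := by
      by_contra! h
      rw [filter_true_of_mem fun x _ => h x, card_univ] at hc
      omega
    refine ⟨twoPolyStep a (twoPoly a j v), (twoPolyStep_top h1 h0 _).1,
      (twoPolyStep_top h1 h0 _).2, ?_⟩
    rw [twoPoly_twoPolyStep (h0 _ (Nat.lt_succ_self j)), card_ker_sqAddMul _ _ hv, hc]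
    ring

omit [DecidableEq F] in
theorem exists_submodule_of_kloosterman_bound [Algebra (ZMod 2) F] {ψ : AddChar F ℤ}
    (hψ : ψ.IsPrimitive) (hsq : ∀ x, ψ (x ^ 2) = ψ x) (j : ℕ) {K : ℤ}
    (hK : ∀ a b, a ≠ 0 → b ≠ 0 → |∑ x, ψ (x * a + x⁻¹ * b)| ≤ K)
    (hq : ((2 : ℤ) ^ j) ^ 2 * (8 * K + 20) < Fintype.card F) :
    ∃ E : Submodule (ZMod 2) F, Module.finrank (ZMod 2) E = j + 3 ∧
      ∑ᶠ u : E, (u : F)⁻¹ = 0 := by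
  classical
  have hK0 : 0 ≤ K := (abs_nonneg _).trans (hK 1 1 one_ne_zero one_ne_zero)
  have hj : 2 ^ j ≤ Fintype.card F := by
    have h1 : (1 : ℤ) ≤ 2 ^ j := one_le_pow₀ (by norm_num)
    have : (2 : ℤ) ^ j ≤ Fintype.card F := by nlinarith
    exact_mod_cast this
  obtain ⟨a, h1, h0, hc⟩ := exists_twoPoly (F := F) j hj
  set A := twoPoly a j with hA
  obtain ⟨κ, hκ⟩ : ∃ κ, ∀ c, twoPolyStep a c j = κ ^ 2 + c := by
    cases j with
    | zero => exact ⟨0, fun c => by rw [twoPolyStep, h1]; ring⟩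
    | succ i => exact ⟨a i, fun c => by rw [twoPolyStep, h1]; ring⟩
  obtain ⟨v, w, e, he, he0, hv, hw, hwv, hψv, hψw, hψu⟩ := exists_char_eq_one hψ A (κ ^ 2)
    (iterateFrobenius F 2 (j + 1)).toAddMonoidHom
    (fun x hx => by simpa [iterateFrobenius_def] using hx) hK (by rw [hc]; exact_mod_cast hq)
  simp only [RingHom.toAddMonoidHom_eq_coe, AddMonoidHom.coe_coe, iterateFrobenius_def]
    at hψv hψw hψu
  set A₁ := sqAddMul A (A v) with hA₁
  have hw₁ : A₁ w ≠ 0 := by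
    rw [hA₁, Ne, sqAddMul_eq_zero_iff]
    exact not_or.mpr ⟨hw, hwv⟩
  obtain ⟨h1', h0'⟩ := twoPolyStep_top h1 h0 (A v)
  have hA₁' : twoPoly (twoPolyStep a (A v)) (j + 1) = A₁ :=
    twoPoly_twoPolyStep (h0 _ (Nat.lt_succ_self j)) _
  set b := twoPolyStep (twoPolyStep a (A v)) (A₁ w) with hb
  have hb' : twoPoly b (j + 2) = sqAddMul A₁ (A₁ w) := by
    rw [hb, twoPoly_twoPolyStep (h0' _ (Nat.lt_succ_self _)), hA₁']
  have hbe : b (j + 1) = e := by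
    have h2 : (2 : F) = 0 := CharTwo.two_eq_zero
    rw [hb, twoPolyStep, hκ, h1', he, hA₁, sqAddMul_apply]
    linear_combination κ ^ 2 * A v * h2
  have hadd : ∀ x y, ψ (y ^ 2 ^ (j + 1) * e⁻¹) = 1 →
      ψ ((x + y) ^ 2 ^ (j + 1) * e⁻¹) = 1 → ψ (x ^ 2 ^ (j + 1) * e⁻¹) = 1 := by
    intro x y hy hxy
    rwa [add_pow_char_pow, add_mul, AddChar.map_add_eq_mul, hy, mul_one] at hxy
  have hψ₁ : ∀ γ, A₁ γ = 0 → ψ (γ ^ 2 ^ (j + 1) * e⁻¹) = 1 := by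
    intro γ hγ
    rcases (sqAddMul_eq_zero_iff _ _ _).mp hγ with h | h
    · exact hψu γ h
    · exact hadd γ v hψv (hψu _ (by rw [map_add, h, CharTwo.add_self_eq_zero]))
  refine exists_submodule_of_char_eq_one hψ hsq b (t := j + 1) (by omega)
    (twoPolyStep_top h1' h0' _).1 (by rw [hbe]; exact he0) ?_ ?_
  · rw [hb', card_ker_sqAddMul _ _ hw₁, card_ker_sqAddMul _ _ hv, hc]; ring
  · intro γ hγ
    rw [hb'] at hγ
    rw [hbe]
    rcases (sqAddMul_eq_zero_iff _ _ _).mp hγ with h | h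
    · exact hψ₁ γ h
    · exact hadd γ w hψw (hψ₁ _ (by rw [map_add, h, CharTwo.add_self_eq_zero]))

end CharacterSums

theorem lt_logb_two_one_add_sqrt : 12 / 5 < Real.logb 2 (1 + Real.sqrt 21) := by
  have hs : (9 / 2 : ℝ) < Real.sqrt 21 := Real.lt_sqrt_of_sq_lt (by norm_num)
  have h1 : Real.logb 2 ((2 : ℝ) ^ 12) < Real.logb 2 ((1 + Real.sqrt 21) ^ 5) := by
    refine Real.logb_lt_logb (by norm_num) (by positivity) ?_
    calc (2 : ℝ) ^ 12 < (1 + 9 / 2) ^ 5 := by norm_num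
      _ ≤ _ := by gcongr
  rw [Real.logb_pow, Real.logb_pow, Real.logb_self_eq_one (by norm_num)] at h1
  push_cast at h1
  linarith

theorem exists_submodule_sum_inv_eq_zero {F : Type*} [Field F] [Fintype F] [Algebra (ZMod 2) F]
    (j s : ℕ) (hF : Fintype.card F = 2 ^ (8 * j + 17 + s)) :
    ∃ E : Submodule (ZMod 2) F, Module.finrank (ZMod 2) E = j + 3 ∧
      ∑ᶠ u : E, (u : F)⁻¹ = 0 := by
  classical
  have : CharP F 2 := charP_of_injective_algebraMap (algebraMap (ZMod 2) F).injective 2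
  obtain ⟨ψ, hψ, hsq⟩ := exists_trace_char F
  have hF' : (Fintype.card F : ℤ) = 2 ^ (8 * j + 17 + s) := by rw [hF]; push_cast; rfl
  set Y : ℤ := 2 ^ (6 * j + 14 + s) with hY
  have hY14 : 2 ^ 14 ≤ Y := pow_le_pow_right₀ (by norm_num) (by omega)
  refine exists_submodule_of_kloosterman_bound hψ hsq j (K := Y - 3) ?_ ?_
  · intro a b ha _
    by_contra! hlt
    have hmom := kloosterman_pow_four_le hψ (b := b) ha
    set S : ℤ := ∑ x, ψ (x * a + x⁻¹ * b)
    set q : ℤ := (Fintype.card F : ℤ) with hq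
    have hq2 : 2 ≤ q := by
      rw [hF']
      calc (2 : ℤ) = 2 ^ 1 := rfl
        _ ≤ _ := pow_le_pow_right₀ (by norm_num) (by omega)
    have hYq : 32 * q ^ 3 ≤ Y ^ 4 := by
      rw [hF', hY, show (32 : ℤ) = 2 ^ 5 by norm_num, ← pow_mul, ← pow_mul, ← pow_add]
      exact pow_le_pow_right₀ (by norm_num) (by omega)
    have h7 : (7 * Y) ^ 4 ≤ (8 * |S|) ^ 4 := pow_le_pow_left₀ (by positivity) (by linarith) 4
    have hS4 : 16 * q ^ 3 ≤ S ^ 4 := by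
      rw [mul_pow, mul_pow, Even.pow_abs (by decide)] at h7
      have : 0 ≤ q ^ 3 := by positivity
      linarith
    have h16 : (q - 1) * (16 * q ^ 3) ≤ (q - 1) * S ^ 4 :=
      mul_le_mul_of_nonneg_left hS4 (by linarith)
    have hfin : q ^ 3 * (16 * (q - 1)) ≤ q ^ 3 * (5 * q) := by linarith
    have := le_of_mul_le_mul_left hfin (by positivity)
    linarith
  · have hqY : (Fintype.card F : ℤ) = (2 ^ j) ^ 2 * (8 * Y) := by
      rw [hF', hY, show (8 : ℤ) = 2 ^ 3 by norm_num, ← pow_mul, ← pow_add, ← pow_add]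
      congr 1; omega
    rw [hqY]
    exact mul_lt_mul_of_pos_left (by linarith) (by positivity)

/-- If `k ≥ 3` and `n ≥ (log₂(1+√21)/3)·(13k−19)`, then the multiplicative inverse
function `f_inv(x) = x⁻¹` (with `f_inv(0) = 0`) on `F_{2^n}` is not `k`th order sum-free:
there is a `k`-dimensional `F₂`-affine subspace `A = v + E` of `F_{2^n}` with
`∑_{x ∈ A} f_inv(x) = 0`.  (In Lean, `x⁻¹` already satisfies `0⁻¹ = 0`.) -/
theorem inv_not_sum_free_of_large_n (k n : ℕ) (hk : 3 ≤ k) (hn : 1 ≤ n)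
    (h : Real.logb 2 (1 + Real.sqrt 21) / 3 * (13 * (k : ℝ) - 19) ≤ (n : ℝ)) :
    ∃ (E : Submodule (ZMod 2) (GaloisField 2 n)) (v : GaloisField 2 n),
      Module.finrank (ZMod 2) E = k ∧
      ∑ᶠ u : E, (v + (u : GaloisField 2 n))⁻¹ = 0 := by
  have hn' : 8 * k < n + 8 := by
    have hk' : (3 : ℝ) ≤ k := by exact_mod_cast hk
    have hlog := lt_logb_two_one_add_sqrt
    have : (8 : ℝ) * k < n + 8 := by nlinarith
    exact_mod_cast this
  obtain ⟨j, rfl⟩ := Nat.exists_eq_add_of_le' hk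
  obtain ⟨s, rfl⟩ : ∃ s, n = 8 * j + 17 + s := ⟨n - (8 * j + 17), by omega⟩
  have : Fintype (GaloisField 2 (8 * j + 17 + s)) := Fintype.ofFinite _
  obtain ⟨E, hE, hsum⟩ := exists_submodule_sum_inv_eq_zero
    (F := GaloisField 2 (8 * j + 17 + s)) j s
    (by rw [← Nat.card_eq_fintype_card]; exact GaloisField.card 2 _ (by omega))
  exact ⟨E, 0, hE, by simpa only [zero_add] using hsum⟩
end

section
/- Let k ≥ 3 and n be positive integers with n ≥ 10.8k − 15.7 (an inequality of real numbers). Then the multiplicative inverse function f_inv on F_{2^n} is not kth order sum-free; that is, there exists a k-dimensional F_2-affine subspace A of F_{2^n} with ∑_{x∈A} f_inv(x) = 0. -/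
/-- Fourth moment bound for character sums over a multiplicatively closed set. -/
theorem norm_sum_addChar_pow_four_le {R : Type*} [CommRing R] [Fintype R] (T : Finset R)
    (hmul : ∀ s ∈ T, ∀ t ∈ T, s * t ∈ T)
    (hunit : ∀ s ∈ T, ∀ t ∈ T, s ≠ t → IsUnit (s - t))
    (hunit' : ∀ s ∈ T, IsUnit s)
    (henergy : ∀ a ∈ T, ∀ b ∈ T, ∀ c ∈ T, ∀ d ∈ T, a + b = c + d →
      (a = b ∧ c = d) ∨ (a = c ∧ b = d) ∨ (a = d ∧ b = c))
    (χ : AddChar R ℂ) (hχ : χ ≠ 1) :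
    ‖∑ t ∈ T, χ t‖ ^ 4 * (T.card : ℝ) ≤ (Fintype.card R : ℝ) * (3 * (T.card : ℝ) ^ 2) := by
  classical
  set S : AddChar R ℂ → ℂ := fun ψ => ∑ t ∈ T, ψ t with hS
  have hshift : ∀ u ∈ T, S (χ.mulShift u) = S χ := by
    intro u hu
    have hinj : Set.InjOn (fun x => u * x) T := fun x _ y _ hxy => (hunit' u hu).mul_left_cancel hxy
    have himg : T.image (fun x => u * x) = T := by
      apply Finset.eq_of_subset_of_card_le
      · intro x hx
        obtain ⟨y, hy, rfl⟩ := Finset.mem_image.1 hx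
        exact hmul u hu y hy
      · rw [Finset.card_image_of_injOn hinj]
    simp only [hS, AddChar.mulShift_apply]
    conv_rhs => rw [← himg]
    rw [Finset.sum_image hinj]
  have hinj : Set.InjOn (fun u => χ.mulShift u) T := by
    intro s hs t ht hst
    by_contra hne
    apply hχ
    rw [← AddChar.mulShift_unit_eq_one_iff χ (hunit s hs t ht hne)]
    ext x
    have h1 : χ (s * x) = χ (t * x) := by
      have := DFunLike.congr_fun hst x
      simpa using this
    have h2 : χ ((s - t) * x) = 1 := by
      rw [sub_mul, AddChar.map_sub_eq_div, h1]
      exact div_self (χ.val_isUnit _).ne_zero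
    simpa using h2
  have horbit : ‖S χ‖ ^ 4 * (T.card : ℝ) ≤ ∑ ψ, ‖S ψ‖ ^ 4 := by
    calc ‖S χ‖ ^ 4 * (T.card : ℝ) = ∑ u ∈ T, ‖S (χ.mulShift u)‖ ^ 4 := by
          rw [Finset.sum_congr rfl (fun u hu => by rw [hshift u hu])]
          simp [mul_comm]
      _ = ∑ ψ ∈ T.image (fun u => χ.mulShift u), ‖S ψ‖ ^ 4 := by
          rw [Finset.sum_image hinj]
      _ ≤ ∑ ψ, ‖S ψ‖ ^ 4 :=
          Finset.sum_le_sum_of_subset_of_nonneg (Finset.subset_univ _)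
            (fun _ _ _ => by positivity)
  set Q := (T ×ˢ T) ×ˢ (T ×ˢ T) with hQ
  set Q₀ := Q.filter (fun p => p.1.1 + p.1.2 = p.2.1 + p.2.2) with hQ₀
  have hmoment : ∑ ψ, ‖S ψ‖ ^ 4 = (Fintype.card R : ℝ) * Q₀.card := by
    have h1 : ∀ ψ : AddChar R ℂ, ((‖S ψ‖ ^ 4 : ℝ) : ℂ)
        = ∑ p ∈ Q, ψ ((p.1.1 + p.1.2) - (p.2.1 + p.2.2)) := by
      intro ψ
      have h2 : ((‖S ψ‖ ^ 4 : ℝ) : ℂ) =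
          (S ψ * S ψ) * ((starRingEnd ℂ) (S ψ) * (starRingEnd ℂ) (S ψ)) := by
        have := Complex.mul_conj' (S ψ)
        push_cast
        calc (‖S ψ‖ : ℂ) ^ 4 = ((‖S ψ‖ : ℂ) ^ 2) * ((‖S ψ‖ : ℂ) ^ 2) := by ring
          _ = _ := by rw [← this]; ring
      rw [h2]
      simp only [hS, map_sum]
      rw [Finset.sum_mul_sum, Finset.sum_mul_sum, ← Finset.sum_product', ← Finset.sum_product',
        Finset.sum_mul_sum, ← Finset.sum_product']
      refine Finset.sum_congr rfl fun p _ => ?_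
      rw [AddChar.map_sub_eq_div, AddChar.map_add_eq_mul, AddChar.map_add_eq_mul,
        div_eq_mul_inv, mul_inv, ← AddChar.inv_apply_eq_conj, ← AddChar.inv_apply_eq_conj]
    have h3 : ((∑ ψ, ‖S ψ‖ ^ 4 : ℝ) : ℂ) = ((Fintype.card R : ℝ) * Q₀.card : ℝ) := by
      rw [Complex.ofReal_sum, Finset.sum_congr rfl (fun ψ _ => h1 ψ), Finset.sum_comm]
      simp_rw [AddChar.sum_apply_eq_ite, sub_eq_zero]
      rw [← Finset.sum_filter]
      simp [hQ₀, mul_comm]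
    exact_mod_cast h3
  have hcard : Q₀.card ≤ 3 * T.card ^ 2 := by
    have hsub : Q₀ ⊆ ((T ×ˢ T).image (fun p => ((p.1, p.1), (p.2, p.2)))) ∪
        ((T ×ˢ T).image (fun p => ((p.1, p.2), (p.1, p.2))) ∪
        (T ×ˢ T).image (fun p => ((p.1, p.2), (p.2, p.1)))) := by
      rintro ⟨⟨a, b⟩, ⟨c, d⟩⟩ hp
      simp only [hQ₀, hQ, Finset.mem_filter, Finset.mem_product] at hp
      obtain ⟨⟨⟨ha, hb⟩, hc, hd⟩, he⟩ := hp
      simp only [Finset.mem_union, Finset.mem_image, Finset.mem_product, Prod.mk.injEq]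
      rcases henergy a ha b hb c hc d hd he with ⟨rfl, rfl⟩ | ⟨rfl, rfl⟩ | ⟨rfl, rfl⟩
      · exact Or.inl ⟨(a, c), ⟨ha, hc⟩, by simp⟩
      · exact Or.inr (Or.inl ⟨(a, b), ⟨ha, hb⟩, by simp⟩)
      · exact Or.inr (Or.inr ⟨(a, b), ⟨ha, hb⟩, by simp⟩)
    have hb : ∀ f : R × R → (R × R) × (R × R), ((T ×ˢ T).image f).card ≤ T.card ^ 2 := fun f =>
      Finset.card_image_le.trans (by rw [Finset.card_product, sq])
    calc Q₀.card ≤ _ := Finset.card_le_card hsub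
      _ ≤ _ := (Finset.card_union_le _ _).trans
        (add_le_add le_rfl (Finset.card_union_le _ _))
      _ ≤ T.card ^ 2 + (T.card ^ 2 + T.card ^ 2) := add_le_add (hb _) (add_le_add (hb _) (hb _))
      _ = 3 * T.card ^ 2 := by ring
  calc _ ≤ _ := horbit
    _ = _ := hmoment
    _ ≤ _ := by
      gcongr
      exact_mod_cast hcard

/-- The number of points of `T` in the kernel of a surjective homomorphism `φ` onto `B` is close to
`|T| / |B|` as soon as all nontrivial character sums over `T` are small. -/
theorem card_le_of_norm_sum_addChar_le {R B : Type*} [AddCommGroup R] [AddCommGroup B] [Fintype B]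
    [DecidableEq B]
    (T : Finset R) (φ : R →+ B) (hφ : Function.Surjective φ) (C : ℝ)
    (hC : ∀ χ : AddChar R ℂ, χ ≠ 1 → ‖∑ t ∈ T, χ t‖ ≤ C) (hC0 : 0 ≤ C) :
    (T.card : ℝ) ≤ Fintype.card B * ((T.filter (fun t => φ t = 0)).card + C) := by
  classical
  have h1 : ∑ ψ : AddChar B ℂ, ∑ t ∈ T, ψ (φ t)
      = (Fintype.card B : ℂ) * (T.filter (fun t => φ t = 0)).card := by
    rw [Finset.sum_comm]
    simp_rw [AddChar.sum_apply_eq_ite]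
    rw [← Finset.sum_filter]
    simp [mul_comm]
  rw [← Finset.add_sum_erase _ _ (Finset.mem_univ (1 : AddChar B ℂ))] at h1
  have h2 : ‖∑ ψ ∈ Finset.univ.erase (1 : AddChar B ℂ), ∑ t ∈ T, ψ (φ t)‖
      ≤ Fintype.card B * C := by
    calc _ ≤ ∑ ψ ∈ Finset.univ.erase (1 : AddChar B ℂ), C := by
          refine norm_sum_le_of_le _ fun ψ hψ => ?_
          have hne : ψ.compAddMonoidHom φ ≠ 1 := by
            intro h
            apply (Finset.mem_erase.1 hψ).1
            ext b
            obtain ⟨r, rfl⟩ := hφ b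
            simpa using DFunLike.congr_fun h r
          simpa using hC _ hne
      _ = ((Finset.univ.erase (1 : AddChar B ℂ)).card : ℝ) * C := by simp
      _ ≤ _ := by
          gcongr
          rw [← AddChar.card_eq (α := B)]
          exact Finset.card_le_univ _
  have h3 : (T.card : ℂ) = (Fintype.card B : ℂ) * (T.filter (fun t => φ t = 0)).card
      - ∑ ψ ∈ Finset.univ.erase (1 : AddChar B ℂ), ∑ t ∈ T, ψ (φ t) := by
    rw [← h1]; simp
  have h4 : (T.card : ℝ) = ‖(T.card : ℂ)‖ := by simp
  rw [h4, h3]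
  refine (norm_sub_le _ _).trans ?_
  rw [mul_add]
  refine add_le_add ?_ h2
  simp

/-- There are at least `|F| - 2` elements of norm one in `F[ω]`, where `ω ^ 2 = 1 + ω`. -/
theorem card_le_card_quadratic_norm_one_add_two {F : Type*} [Field F] [Fintype F] [CharP F 2]
    [Fintype (QuadraticAlgebra F 1 1)] [DecidableEq F] :
    Fintype.card F ≤
      (Finset.univ.filter (fun r : QuadraticAlgebra F 1 1 => r.norm = 1)).card + 2 := by
  classical
  have h2 : (2 : F) = 0 := CharTwo.two_eq_zero
  set Z := Finset.univ.filter (fun x : F => x ^ 2 + x + 1 = 0) with hZ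
  set Y := Finset.univ.filter (fun x : F => ¬ (x ^ 2 + x + 1 = 0)) with hY
  have hsum : Z.card + Y.card = Fintype.card F := by
    rw [← Finset.card_univ]
    exact Finset.card_filter_add_card_filter_not (s := (Finset.univ : Finset F)) _
  have hZ2 : Z.card ≤ 2 := by
    rcases Z.eq_empty_or_nonempty with h | ⟨x, hx⟩
    · simp [h]
    · have : Z ⊆ {x, x + 1} := by
        intro y hy
        simp only [hZ, Finset.mem_filter, Finset.mem_univ, true_and] at hx hy
        have h0 : (y - x) * (y - (x + 1)) = 0 := by
          linear_combination hy + (-1 : F) * hx + (x ^ 2 + x - x * y - y) * h2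
        simp only [Finset.mem_insert, Finset.mem_singleton]
        rcases mul_eq_zero.1 h0 with h | h
        · exact Or.inl (sub_eq_zero.1 h)
        · exact Or.inr (sub_eq_zero.1 h)
      exact (Finset.card_le_card this).trans Finset.card_le_two
  have hYT : Y.card ≤ (Finset.univ.filter
      (fun r : QuadraticAlgebra F 1 1 => r.norm = 1)).card := by
    refine Finset.card_le_card_of_injOn
      (fun x => ⟨(x ^ 2 + 1) / (x ^ 2 + x + 1), 1 / (x ^ 2 + x + 1)⟩) ?_ ?_
    · intro x hx
      simp only [hY, Finset.coe_filter, Finset.mem_univ, true_and, Set.mem_ofPred_eq] at hx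
      rw [Finset.mem_coe, Finset.mem_filter, QuadraticAlgebra.norm_def]
      refine ⟨Finset.mem_univ _, ?_⟩
      dsimp only
      generalize hD : x ^ 2 + x + 1 = D at hx
      have hD0 : D ≠ 0 := hx
      field_simp
      linear_combination (D + x ^ 2 + x + 1) * hD + (-x - x ^ 3) * h2
    · intro x hx y hy hxy
      simp only [hY, Finset.coe_filter, Finset.mem_univ, true_and, Set.mem_ofPred_eq] at hx hy
      simp only [QuadraticAlgebra.mk.injEq] at hxy
      obtain ⟨h1, h3⟩ := hxy
      have h4 : x ^ 2 + x + 1 = y ^ 2 + y + 1 := by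
        rw [one_div, one_div] at h3
        exact inv_injective h3
      rw [h4, div_left_inj' hy] at h1
      linear_combination h4 - h1
  omega

/-- Two distinct elements of norm one in `F[ω]` differ by a unit, even when `F[ω]` is not a field. -/
theorem isUnit_sub_of_quadratic_norm_one {F : Type*} [Field F] [CharP F 2]
    {s t : QuadraticAlgebra F 1 1} (hs : s.norm = 1) (ht : t.norm = 1) (hst : s ≠ t) :
    IsUnit (s - t) := by
  have h2 : (2 : F) = 0 := CharTwo.two_eq_zero
  rw [QuadraticAlgebra.isUnit_iff_norm_isUnit, isUnit_iff_ne_zero]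
  intro h0
  apply hst
  rw [QuadraticAlgebra.norm_def] at hs ht h0
  obtain ⟨a, b⟩ := s
  obtain ⟨c, d⟩ := t
  simp only [QuadraticAlgebra.re_sub, QuadraticAlgebra.im_sub, one_mul] at hs ht h0
  have hpar : a * d = b * c := by
    linear_combination hs + ht - h0 + (1 - a * c + b * d - b * c) * h2
  have hac : (a - c) ^ 2 = 0 := by
    linear_combination a ^ 2 * ht * (-1) + c ^ 2 * hs + (a * c + a * d + b * c) * hpar + (c ^ 2 + c ^ 2 * b ^ 2 - a * c - a ^ 2 * d ^ 2) * h2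
  have hbd : (b - d) ^ 2 = 0 := by
    linear_combination d ^ 2 * hs - b ^ 2 * ht - (a * d + b * c + b * d) * hpar
      + (d ^ 2 - b * d) * h2
  rw [QuadraticAlgebra.mk.injEq]
  exact ⟨sub_eq_zero.1 (pow_eq_zero_iff two_ne_zero |>.1 hac),
    sub_eq_zero.1 (pow_eq_zero_iff two_ne_zero |>.1 hbd)⟩

/-- The additive quadruples of elements of norm one in `F[ω]` are trivial. -/
theorem quadratic_norm_one_energy {F : Type*} [Field F] [CharP F 2]
    {a b c d : QuadraticAlgebra F 1 1} (ha : a.norm = 1) (hb : b.norm = 1) (hc : c.norm = 1)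
    (hd : d.norm = 1) (h : a + b = c + d) :
    (a = b ∧ c = d) ∨ (a = c ∧ b = d) ∨ (a = d ∧ b = c) := by
  have hchar : ∀ x : QuadraticAlgebra F 1 1, x + x = 0 := by
    intro x
    ext <;> simp [CharTwo.add_self_eq_zero]
  have hsub : ∀ x y : QuadraticAlgebra F 1 1, x - y = x + y := by
    intro x y
    rw [sub_eq_add_neg, neg_eq_of_add_eq_zero_left (hchar y)]
  have hstar : ∀ x : QuadraticAlgebra F 1 1, x.norm = 1 → x * star x = 1 := by
    intro x hx
    rw [← QuadraticAlgebra.algebraMap_norm_eq_mul_star, hx, map_one]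
  by_cases hab : a = b
  · left
    refine ⟨hab, ?_⟩
    rw [hab, hchar, ← hsub] at h
    exact sub_eq_zero.1 h.symm
  · right
    have hs : star a + star b = star c + star d := by rw [← star_add, h, star_add]
    have hu := isUnit_sub_of_quadratic_norm_one ha hb hab
    rw [hsub] at hu
    have hprod : c * d = a * b := by
      refine hu.mul_right_cancel ?_
      linear_combination (a * b * c * d) * hs - b * c * d * hstar a ha - a * c * d * hstar b hb
        + a * b * d * hstar c hc + a * b * c * hstar d hd - a * b * h
    have hz : (c - a) * (c - b) = 0 := by
      linear_combination (-c) * h - hprod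
    by_cases hca : a = c
    · left
      refine ⟨hca, ?_⟩
      rw [hca] at h
      exact add_left_cancel h
    · right
      have hu' := isUnit_sub_of_quadratic_norm_one hc ha (Ne.symm hca)
      have hcb : c = b := sub_eq_zero.1 ((hu'.mul_right_eq_zero).1 hz)
      refine ⟨?_, hcb.symm⟩
      rw [hcb, add_comm b d] at h
      exact add_right_cancel h

theorem lt_of_le_mul_fourth_root_bound {q M P C : ℝ} (hM : 1 ≤ M) (hq : 64 * M ^ 5 ≤ q)
    (hP : q ≤ P + 2) (hC0 : 0 ≤ C) (hC : C ^ 4 ≤ 3 * q ^ 2 * P) : M * (3 + C) < P := by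
  have hM5 : 1 ≤ M ^ 5 := one_le_pow₀ hM
  have hq64 : 64 ≤ q := by linarith
  have hP62 : 62 ≤ P := by linarith
  by_contra! hcon
  have h1 : P ^ 4 ≤ (M * (3 + C)) ^ 4 := by gcongr
  have h2 : (3 + C) ^ 4 ≤ 8 * (81 + C ^ 4) := by
    nlinarith [sq_nonneg (C - 3), sq_nonneg (C ^ 2 - 9), sq_nonneg (C ^ 2 - 3 * C),
      mul_nonneg hC0 hC0, sq_nonneg (C + 3), sq_nonneg ((C - 3) * (C + 3)), sq_nonneg ((C - 3)*(C-3))]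
  have h3 : M ^ 4 ≤ q / 64 := by
    have : M ^ 4 ≤ M ^ 5 := pow_le_pow_right₀ hM (by norm_num)
    linarith
  have h4 : P ^ 4 ≤ q / 64 * (8 * (81 + 3 * q ^ 2 * P)) := by
    calc P ^ 4 ≤ (M * (3 + C)) ^ 4 := h1
      _ = M ^ 4 * (3 + C) ^ 4 := by ring
      _ ≤ q / 64 * (8 * (81 + 3 * q ^ 2 * P)) := by
        gcongr
        linarith
  have h5 : q ≤ 32 / 31 * P := by linarith
  have h6 : q ^ 3 ≤ (32 / 31 * P) ^ 3 := by gcongr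
  have h7 : q ^ 3 * P ≤ (32 / 31 * P) ^ 3 * P := by gcongr
  have h8 : (62 : ℝ) ^ 3 * P ≤ P ^ 3 * P := by gcongr
  nlinarith

/-- A subspace of small codimension contains the coordinates of a nontrivial point of the conic
`z ^ 2 + z * d + d ^ 2 = δ ^ 2`. -/
theorem exists_mem_submodule_quadratic_form_eq {F : Type*} [Field F] [Fintype F] [CharP F 2]
    [Module (ZMod 2) F] (W : Submodule (ZMod 2) F) (δ : F) (hδ : δ ≠ 0)
    (hcard : 64 * (Nat.card (F ⧸ W)) ^ 10 ≤ Fintype.card F) :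
    ∃ z ∈ W, ∃ d ∈ W, z ^ 2 + z * d + d ^ 2 = δ ^ 2 ∧ z ≠ 0 ∧ d ≠ 0 ∧ z ≠ d := by
  classical
  by_contra! hcon
  have : Fintype (QuadraticAlgebra F 1 1) := Fintype.ofEquiv _ (QuadraticAlgebra.equivProd (1 : F) 1).symm
  have hR : Fintype.card (QuadraticAlgebra F 1 1) = Fintype.card F ^ 2 := by
    rw [Fintype.card_congr (QuadraticAlgebra.equivProd (1 : F) 1), Fintype.card_prod, sq]
  have : Fintype (F ⧸ W) := Fintype.ofFinite _
  let T : Finset (QuadraticAlgebra F 1 1) := Finset.univ.filter (fun r => r.norm = 1)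
  have hT : ∀ t, t ∈ T ↔ t.norm = 1 := fun t => by simp [T]
  let φ : QuadraticAlgebra F 1 1 →+ (F ⧸ W) × (F ⧸ W) :=
    { toFun := fun r => (W.mkQ (δ * r.re), W.mkQ (δ * r.im))
      map_zero' := by simp
      map_add' := fun r s => by simp [mul_add] }
  have hφ : Function.Surjective φ := by
    rintro ⟨x, y⟩
    obtain ⟨x, rfl⟩ := W.mkQ_surjective x
    obtain ⟨y, rfl⟩ := W.mkQ_surjective y
    exact ⟨⟨δ⁻¹ * x, δ⁻¹ * y⟩, by simp [φ, hδ]⟩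
  have hmoment := norm_sum_addChar_pow_four_le T
    (fun s hs t ht => by rw [hT] at *; rw [map_mul, hs, ht, one_mul])
    (fun s hs t ht => isUnit_sub_of_quadratic_norm_one ((hT _).1 hs) ((hT _).1 ht))
    (fun s hs => by
      rw [QuadraticAlgebra.isUnit_iff_norm_isUnit, (hT _).1 hs]; exact isUnit_one)
    (fun a ha b hb c hc d hd => quadratic_norm_one_energy ((hT _).1 ha) ((hT _).1 hb)
      ((hT _).1 hc) ((hT _).1 hd))
  have hTcard : Fintype.card F ≤ T.card + 2 := card_le_card_quadratic_norm_one_add_two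
  set q : ℝ := ((Fintype.card F : ℕ) : ℝ) with hq
  set P : ℝ := ((T.card : ℕ) : ℝ) with hP
  set M : ℝ := ((Fintype.card ((F ⧸ W) × (F ⧸ W)) : ℕ) : ℝ) with hMdef
  have hM : M = (Nat.card (F ⧸ W) : ℝ) ^ 2 := by
    rw [hMdef, Fintype.card_prod, Nat.card_eq_fintype_card]; push_cast; ring
  have hM1 : 1 ≤ M := by
    rw [hMdef]
    exact_mod_cast Fintype.card_pos
  have hqM : 64 * M ^ 5 ≤ q := by
    rw [hM, ← pow_mul, hq]
    exact_mod_cast hcard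
  have hqP : q ≤ P + 2 := by rw [hq, hP]; exact_mod_cast hTcard
  have hPpos : 0 < P := by
    have : 1 ≤ M ^ 5 := one_le_pow₀ hM1
    linarith
  obtain ⟨C, hC0, hC4⟩ : ∃ C : ℝ, 0 ≤ C ∧ C ^ 4 = 3 * q ^ 2 * P := by
    refine ⟨√(√(3 * q ^ 2 * P)), Real.sqrt_nonneg _, ?_⟩
    rw [show 4 = 2 * 2 from rfl, pow_mul, Real.sq_sqrt (Real.sqrt_nonneg _),
      Real.sq_sqrt (by positivity)]
  have hbound : ∀ χ : AddChar (QuadraticAlgebra F 1 1) ℂ, χ ≠ 1 → ‖∑ t ∈ T, χ t‖ ≤ C := by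
    intro χ hχ
    have h1 := hmoment χ hχ
    rw [hR] at h1
    push_cast at h1
    have h3 : ‖∑ t ∈ T, χ t‖ ^ 4 ≤ C ^ 4 := by
      rw [hC4]
      refine le_of_mul_le_mul_right ?_ hPpos
      calc _ ≤ _ := h1
        _ = _ := by ring
    exact le_of_pow_le_pow_left₀ (by norm_num) hC0 h3
  have hkey := card_le_of_norm_sum_addChar_le T φ hφ C hbound hC0
  have hfilter : (T.filter (fun t => φ t = 0)).card ≤ 3 := by
    have hsub : T.filter (fun t => φ t = 0) ⊆ {⟨0, 1⟩, ⟨1, 0⟩, ⟨1, 1⟩} := by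
      rintro ⟨e, f⟩ ht
      rw [Finset.mem_filter, hT, QuadraticAlgebra.norm_def] at ht
      obtain ⟨hn, hk⟩ := ht
      simp only [φ, AddMonoidHom.coe_mk, ZeroHom.coe_mk, Prod.mk_eq_zero, Submodule.mkQ_apply,
        Submodule.Quotient.mk_eq_zero] at hk
      simp only [one_mul] at hn
      have h2 : (2 : F) = 0 := CharTwo.two_eq_zero
      have hsq : ∀ x : F, x ^ 2 = 1 → x = 1 := by
        intro x hx
        have : (x - 1) ^ 2 = 0 := by linear_combination hx + (1 - x) * h2
        exact sub_eq_zero.1 (pow_eq_zero_iff two_ne_zero |>.1 this)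
      have hc := hcon (δ * e) hk.1 (δ * f) hk.2
        (by linear_combination δ ^ 2 * hn + δ ^ 2 * f ^ 2 * h2)
      have hor : e = 0 ∨ f = 0 ∨ e = f := by
        by_contra! hne
        exact hne.2.2 (mul_left_cancel₀ hδ
          (hc (mul_ne_zero hδ hne.1) (mul_ne_zero hδ hne.2.1)))
      simp only [Finset.mem_insert, Finset.mem_singleton, QuadraticAlgebra.mk.injEq]
      rcases hor with rfl | rfl | rfl
      · exact Or.inl ⟨rfl, hsq _ (by linear_combination hn + f ^ 2 * h2)⟩
      · exact Or.inr (Or.inl ⟨hsq _ (by linear_combination hn), rfl⟩)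
      · have := hsq e (by linear_combination hn)
        exact Or.inr (Or.inr ⟨this, this⟩)
    exact (Finset.card_le_card hsub).trans Finset.card_le_three
  have hlt := lt_of_le_mul_fourth_root_bound hM1 hqM hqP hC0 hC4.le
  have hle : P ≤ M * (3 + C) := by
    refine hkey.trans ?_
    have : ((T.filter (fun t => φ t = 0)).card : ℝ) ≤ 3 := by exact_mod_cast hfilter
    gcongr
  linarith

/-- `L` is the `𝔽₂`-linear map of the monic linearized polynomial
`a 0 * X + a 1 * X ^ 2 + ⋯ + a m * X ^ 2 ^ m`, and all roots of that polynomial lie in `F`. -/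
structure IsSplitLinearized {F : Type*} [Field F] [Algebra (ZMod 2) F] (L : F →ₗ[ZMod 2] F)
    (m : ℕ) (a : ℕ → F) : Prop where
  apply_eq : ∀ x, L x = ∑ i ∈ Finset.range (m + 1), a i * x ^ 2 ^ i
  leading_coeff : a m = 1
  finrank_ker : Module.finrank (ZMod 2) (LinearMap.ker L) = m

section

variable {F : Type*} [Field F] [Algebra (ZMod 2) F]

theorem IsSplitLinearized.id :
    IsSplitLinearized (LinearMap.id : F →ₗ[ZMod 2] F) 0 (fun _ => 1) where
  apply_eq x := by simp
  leading_coeff := rfl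
  finrank_ker := by rw [LinearMap.ker_id, finrank_bot]

variable [Finite F]

/-- Adjoining the coset on which `L` takes the value `c` to the kernel of `L`. -/
theorem IsSplitLinearized.exists_extend [CharP F 2] {L : F →ₗ[ZMod 2] F} {m : ℕ} {a : ℕ → F}
    (h : IsSplitLinearized L m a) {c : F} (hc : c ∈ LinearMap.range L) (hc0 : c ≠ 0) :
    ∃ (L' : F →ₗ[ZMod 2] F) (a' : ℕ → F), IsSplitLinearized L' (m + 1) a' ∧
      a' 0 = c * a 0 ∧ (∀ i < m, a' (i + 1) = a i ^ 2 + c * a (i + 1)) ∧ ∀ x, L' x = L x ^ 2 + c * L x := by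
  obtain ⟨x₀, rfl⟩ := hc
  set c := L x₀ with hcdef
  let L' : F →ₗ[ZMod 2] F := AddMonoidHom.toZModLinearMap 2
    { toFun := fun x => L x ^ 2 + c * L x
      map_zero' := by simp
      map_add' := fun x y => by rw [map_add, CharTwo.add_sq]; ring }
  have hL' : ∀ x, L' x = L x ^ 2 + c * L x := fun x => rfl
  refine ⟨L', fun i => (if i = 0 then 0 else a (i - 1) ^ 2) + (if i ≤ m then c * a i else 0),
    ⟨?_, ?_, ?_⟩, by simp, ?_, hL'⟩
  · intro x
    rw [hL', h.apply_eq x, CharTwo.sum_sq]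
    simp_rw [add_mul]
    rw [Finset.sum_add_distrib]
    congr 1
    · conv_rhs => rw [Finset.sum_range_succ']
      simp only [Nat.add_eq_zero_iff, one_ne_zero, and_false, if_false, if_true, zero_mul,
        add_zero, Nat.add_sub_cancel]
      exact Finset.sum_congr rfl fun i _ => by ring
    · conv_rhs => rw [Finset.sum_range_succ]
      rw [Finset.mul_sum]
      simp only [Nat.not_succ_le_self, if_false, zero_mul, add_zero]
      refine Finset.sum_congr rfl fun i hi => ?_
      rw [if_pos (Nat.lt_succ_iff.1 (Finset.mem_range.1 hi))]
      ring
  · simp [h.leading_coeff]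
  · have hle : LinearMap.ker L ≤ LinearMap.ker L' := by
      intro x hx
      rw [LinearMap.mem_ker] at hx ⊢
      rw [hL', hx]
      simp
    have hx₀ : x₀ ∈ LinearMap.ker L' := by
      rw [LinearMap.mem_ker, hL', ← hcdef, sq]
      exact CharTwo.add_self_eq_zero _
    set f := L.domRestrict (LinearMap.ker L') with hf
    have hrange : LinearMap.range f = Submodule.span (ZMod 2) {c} := by
      apply le_antisymm
      · rintro _ ⟨⟨x, hx⟩, rfl⟩
        rw [LinearMap.mem_ker, hL'] at hx
        have h0 : L x * (L x + c) = 0 := by linear_combination hx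
        rw [hf, LinearMap.domRestrict_apply]
        rcases mul_eq_zero.1 h0 with h1 | h1
        · rw [h1]; exact Submodule.zero_mem _
        · rw [CharTwo.add_eq_zero.1 h1]; exact Submodule.mem_span_singleton_self c
      · rw [Submodule.span_singleton_le_iff_mem]
        exact ⟨⟨x₀, hx₀⟩, rfl⟩
    have hker : Module.finrank (ZMod 2) (LinearMap.ker f) = m := by
      have h1 : LinearMap.ker f = (LinearMap.ker L).comap (LinearMap.ker L').subtype := by
        ext x
        simp [hf]
      rw [h1, (Submodule.comapSubtypeEquivOfLe hle).finrank_eq, h.finrank_ker]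
    have hrn := LinearMap.finrank_range_add_finrank_ker f
    rw [hrange, finrank_span_singleton hc0, hker] at hrn
    omega
  · intro i hi
    simp only [Nat.add_eq_zero_iff, one_ne_zero, and_false, if_false, Nat.add_sub_cancel]
    rw [if_pos (by omega)]

theorem IsSplitLinearized.card_range {L : F →ₗ[ZMod 2] F} {m : ℕ} {a : ℕ → F}
    (h : IsSplitLinearized L m a) :
    Nat.card (LinearMap.range L) * 2 ^ m = Nat.card F := by
  have hrn := LinearMap.finrank_range_add_finrank_ker L
  rw [h.finrank_ker] at hrn
  rw [Module.natCard_eq_pow_finrank (K := ZMod 2) (V := LinearMap.range L),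
    Module.natCard_eq_pow_finrank (K := ZMod 2) (V := F), ← hrn, pow_add, Nat.card_zmod]

theorem exists_isSplitLinearized_coeff_ne_zero [CharP F 2] (m : ℕ)
    (hm : 2 ^ (m + 2) ≤ Nat.card F) :
    ∃ (L : F →ₗ[ZMod 2] F) (a : ℕ → F), IsSplitLinearized L (m + 1) a ∧ a m ≠ 0 := by
  induction m with
  | zero =>
    obtain ⟨L, a, h, h0, -⟩ := IsSplitLinearized.id.exists_extend (F := F) (c := 1)
      ⟨1, rfl⟩ one_ne_zero
    exact ⟨L, a, h, by simp [h0]⟩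
  | succ m ih =>
    obtain ⟨L, a, h, ha⟩ := ih (le_trans (Nat.pow_le_pow_right two_pos (by omega)) hm)
    have hcard : 4 ≤ Nat.card (LinearMap.range L) := by
      have h1 := h.card_range
      rw [← h1] at hm
      refine Nat.le_of_mul_le_mul_right (c := 2 ^ (m + 1)) ?_ (by positivity)
      calc _ = 2 ^ (m + 1 + 2) := by ring
        _ ≤ _ := hm
    obtain ⟨c, hc, hc0, hc1⟩ : ∃ c ∈ LinearMap.range L, c ≠ 0 ∧ c ≠ a m ^ 2 := by
      by_contra! hcon
      have hsub : (LinearMap.range L : Set F) ⊆ {0, a m ^ 2} := by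
        intro c hc
        by_cases hc0 : c = 0
        · exact Or.inl hc0
        · exact Or.inr (hcon c hc hc0)
      have h1 := Set.ncard_le_ncard hsub
      have h2 : (LinearMap.range L : Set F).ncard = Nat.card (LinearMap.range L) := rfl
      have h3 := Set.ncard_insert_le (0 : F) {a m ^ 2}
      rw [Set.ncard_singleton] at h3
      omega
    obtain ⟨L', a', h', -, ha', -⟩ := h.exists_extend hc hc0
    refine ⟨L', a', h', ?_⟩
    rw [ha' m (by omega), h.leading_coeff, mul_one]
    intro h0
    exact hc1 (CharTwo.add_eq_zero.1 h0).symm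

end

theorem trace_pow_two_pow {F : Type*} [Field F] [Algebra (ZMod 2) F] [Finite F] (x : F) (j : ℕ) :
    Algebra.trace (ZMod 2) F (x ^ 2 ^ j) = Algebra.trace (ZMod 2) F x := by
  induction j with
  | zero => simp
  | succ j ih =>
    rw [pow_succ, pow_mul, ← ih]
    have h := Algebra.trace_eq_of_algEquiv (FiniteField.frobeniusAlgEquivOfAlgebraic (ZMod 2) F)
      (x ^ 2 ^ j)
    simpa using h

/-- If a polynomial with nonzero constant coefficient and zero linear coefficient vanishes on a set
of nonzero elements as large as its degree, then the inverses of these elements sum to zero. -/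
theorem sum_inv_eq_zero_of_roots {F : Type*} [Field F] (p : Polynomial F) (s : Finset F)
    (h0 : p.coeff 0 ≠ 0) (h1 : p.coeff 1 = 0) (hs : ∀ x ∈ s, p.eval x = 0)
    (hdeg : p.natDegree ≤ s.card) : ∑ x ∈ s, x⁻¹ = 0 := by
  have hp : p ≠ 0 := by rintro rfl; simp at h0
  have hle : s.val ≤ p.roots := by
    rw [Multiset.le_iff_subset s.nodup]
    intro x hx
    rw [Polynomial.mem_roots hp]
    exact hs x hx
  have hroots : s.val = p.roots :=
    Multiset.eq_of_le_of_card_le hle ((Polynomial.card_roots' p).trans hdeg)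
  have hsplits : p.Splits := by
    rw [Polynomial.splits_iff_card_roots]
    refine le_antisymm (Polynomial.card_roots' p) ?_
    rw [← hroots]
    exact hdeg
  have heval : p.eval 0 ≠ 0 := by rwa [← Polynomial.coeff_zero_eq_eval_zero]
  have hd := hsplits.eval_derivative_div_eval_of_ne_zero heval
  rw [← Polynomial.coeff_zero_eq_eval_zero, Polynomial.coeff_derivative, zero_add, h1, zero_mul,
    zero_div, ← hroots] at hd
  have h2 : ∑ x ∈ s, 1 / (0 - x) = 0 := hd.symm
  simpa [inv_neg, Finset.sum_neg_distrib] using h2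

open Polynomial in
/-- The orthogonal complement of the range of a split linearized map with vanishing
second-highest coefficient has vanishing sum of inverses. -/
theorem IsSplitLinearized.exists_sum_inv_eq_zero {F : Type*} [Field F] [Algebra (ZMod 2) F]
    [Fintype F] [CharP F 2] {L : F →ₗ[ZMod 2] F} {m : ℕ} {a : ℕ → F}
    (h : IsSplitLinearized L (m + 1) a) (ha : a m = 0) :
    ∃ E : Submodule (ZMod 2) F, Module.finrank (ZMod 2) E = m + 1 ∧
      ∑ᶠ u : E, (u : F)⁻¹ = 0 := by
  classical
  set E := (Algebra.traceForm (ZMod 2) F).orthogonal (LinearMap.range L) with hE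
  have hnd := traceForm_nondegenerate (ZMod 2) F
  have hfin : Module.finrank (ZMod 2) E = m + 1 := by
    rw [hE, LinearMap.BilinForm.finrank_orthogonal hnd,
      ← LinearMap.finrank_range_add_finrank_ker L, h.finrank_ker]
    omega
  refine ⟨E, hfin, ?_⟩
  set b : ℕ → F := fun j => a (m + 1 - j) ^ 2 ^ j with hb
  have hb0 : b 0 = 1 := by simp [hb, h.leading_coeff]
  have hb1 : b 1 = 0 := by simp [hb, ha]
  have hvanish : ∀ y ∈ E, ∑ j ∈ Finset.range (m + 2), b j * y ^ 2 ^ j = 0 := by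
    intro y hy
    have horth : ∀ x, Algebra.trace (ZMod 2) F (L x * y) = 0 := fun x =>
      hy (L x) ⟨x, rfl⟩
    refine hnd.1 _ fun w => ?_
    obtain ⟨x, rfl⟩ := (bijective_iterateFrobenius F 2 (m + 1)).2 w
    rw [Algebra.traceForm_apply, iterateFrobenius_def, ← horth x, h.apply_eq, Finset.sum_mul,
      Finset.sum_mul, map_sum, map_sum, ← Finset.sum_range_reflect]
    refine Finset.sum_congr rfl fun j hj => ?_
    have hj' : j ≤ m + 1 := Nat.lt_succ_iff.1 (Finset.mem_range.1 hj)
    rw [← trace_pow_two_pow (a j * x ^ 2 ^ j * y) (m + 1 - j)]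
    congr 1
    have e1 : m + 2 - 1 - j = m + 1 - j := rfl
    have e2 : m + 1 - (m + 1 - j) = j := by omega
    have e3 : (x ^ 2 ^ j) ^ 2 ^ (m + 1 - j) = x ^ 2 ^ (m + 1) := by
      rw [← pow_mul, ← pow_add]
      congr 2
      omega
    simp only [hb, e1, e2, mul_pow, e3]
    ring
  set p : F[X] := ∑ j ∈ Finset.range (m + 2), C (b j) * X ^ (2 ^ j - 1) with hp
  set s : Finset F := Finset.univ.filter (fun x => x ∈ E ∧ x ≠ 0) with hs
  have hcardE : Nat.card E = 2 ^ (m + 1) := by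
    rw [Module.natCard_eq_pow_finrank (K := ZMod 2), hfin, Nat.card_zmod]
  have hs_eq : s = (Finset.univ.filter (fun x => x ∈ E)).erase 0 := by
    ext x
    simp [hs, and_comm]
  have hcardE' : (Finset.univ.filter (fun x => x ∈ E)).card = 2 ^ (m + 1) := by
    rw [← hcardE, Nat.card_eq_fintype_card, Fintype.card_subtype]
  have hcard : s.card = 2 ^ (m + 1) - 1 := by
    rw [hs_eq, Finset.card_erase_of_mem (by simp), hcardE']
  have hcoeff : ∀ i, p.coeff i = ∑ j ∈ Finset.range (m + 2), if i = 2 ^ j - 1 then b j else 0 := by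
    intro i
    simp only [hp, finsetSum_coeff, coeff_C_mul_X_pow]
  have hsum : ∑ x ∈ s, x⁻¹ = 0 := by
    apply sum_inv_eq_zero_of_roots p s
    · rw [hcoeff, Finset.sum_eq_single 0]
      · simp [hb0]
      · intro j _ hj
        rw [if_neg]
        have := Nat.one_lt_two_pow hj
        omega
      · simp
    · rw [hcoeff]
      refine Finset.sum_eq_zero fun j _ => ?_
      split_ifs with h1
      · rcases j with _ | _ | j
        · simp at h1
        · exact hb1
        · have : 2 ^ (j + 1 + 1) = 4 * 2 ^ j := by ring
          have := Nat.one_le_two_pow (n := j)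
          omega
      · rfl
    · intro x hx
      simp only [hs, Finset.mem_filter, Finset.mem_univ, true_and] at hx
      have h1 := hvanish x hx.1
      have h2 : x * p.eval x = 0 := by
        rw [← h1, hp, eval_finsetSum, Finset.mul_sum]
        refine Finset.sum_congr rfl fun j _ => ?_
        rw [eval_mul, eval_C, eval_pow, eval_X]
        have e : x ^ 2 ^ j = x ^ (2 ^ j - 1) * x := by
          rw [← pow_succ, Nat.sub_add_cancel Nat.one_le_two_pow]
        rw [e]
        ring
      exact (mul_eq_zero.1 h2).resolve_left hx.2
    · rw [hcard, hp]
      refine natDegree_sum_le_of_forall_le _ _ fun j hj => ?_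
      refine (natDegree_C_mul_X_pow_le _ _).trans ?_
      have : 2 ^ j ≤ 2 ^ (m + 1) := Nat.pow_le_pow_right two_pos
        (Nat.lt_succ_iff.1 (Finset.mem_range.1 hj))
      omega
  rw [finsum_eq_sum_of_fintype]
  rw [hs_eq] at hsum
  have h3 := Finset.sum_erase (Finset.univ.filter (fun x => x ∈ E)) (f := fun x : F => x⁻¹)
    (a := 0) inv_zero
  rw [h3] at hsum
  rw [← hsum]
  exact (Finset.sum_subtype _ (by simp) _).symm

/-- If `F` is large compared to `2 ^ m`, there is a split linearized map over `F` whose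
second-highest coefficient vanishes. -/
theorem exists_isSplitLinearized_coeff_eq_zero {F : Type*} [Field F] [Algebra (ZMod 2) F]
    [Fintype F] [CharP F 2] (m : ℕ) (hm : 64 * (2 ^ (m + 1)) ^ 10 ≤ Nat.card F) :
    ∃ (L : F →ₗ[ZMod 2] F) (a : ℕ → F), IsSplitLinearized L (m + 3) a ∧ a (m + 2) = 0 := by
  obtain ⟨L, a, h, ha⟩ := exists_isSplitLinearized_coeff_ne_zero (F := F) m (by
    refine le_trans ?_ hm
    calc 2 ^ (m + 2) = 2 * 2 ^ (m + 1) := by ring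
      _ ≤ 64 * (2 ^ (m + 1)) ^ 10 :=
        Nat.mul_le_mul (by norm_num) (Nat.le_self_pow (by norm_num) _))
  have hquot : Nat.card (F ⧸ LinearMap.range L) = 2 ^ (m + 1) := by
    have h1 := Submodule.finrank_quotient_add_finrank (LinearMap.range L)
    rw [← LinearMap.finrank_range_add_finrank_ker L, h.finrank_ker] at h1
    rw [Module.natCard_eq_pow_finrank (K := ZMod 2), Nat.card_zmod]
    congr 1
    omega
  obtain ⟨z, hz, d, hd, hzd, hz0, hd0, hne⟩ := exists_mem_submodule_quadratic_form_eq
    (LinearMap.range L) (a m ^ 2) (pow_ne_zero _ ha)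
    (by rw [hquot, ← Nat.card_eq_fintype_card]; exact hm)
  obtain ⟨L₁, a₁, h₁, -, ha₁, hL₁⟩ := h.exists_extend hd hd0
  obtain ⟨x, rfl⟩ := hz
  have hc : L₁ x ≠ 0 := by
    rw [hL₁]
    intro h0
    have h1 : L x * (L x + d) = 0 := by linear_combination h0
    rcases mul_eq_zero.1 h1 with h2 | h2
    · exact hz0 h2
    · exact hne (CharTwo.add_eq_zero.1 h2)
  obtain ⟨L₂, a₂, h₂, -, ha₂, -⟩ := h₁.exists_extend ⟨x, rfl⟩ hc
  refine ⟨L₂, a₂, h₂, ?_⟩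
  rw [ha₂ (m + 1) (by omega), ha₁ m (by omega), h₁.leading_coeff, h.leading_coeff, hL₁]
  linear_combination hzd + (a m ^ 4 + a m ^ 2 * d) * (CharTwo.two_eq_zero (R := F))

/-- If `k ≥ 3` and `n ≥ 10.8·k − 15.7`, then the multiplicative inverse function
`f_inv(x) = x⁻¹` (with `f_inv(0) = 0`) on `F_{2^n}` is not `k`th order sum-free:
there is a `k`-dimensional `F₂`-affine subspace `A = v + E` of `F_{2^n}` with
`∑_{x ∈ A} f_inv(x) = 0`. -/
theorem inv_not_sum_free_of_large_n' (k n : ℕ) (hk : 3 ≤ k) (hn : 1 ≤ n)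
    (h : 10.8 * (k : ℝ) - 15.7 ≤ (n : ℝ)) :
    ∃ (E : Submodule (ZMod 2) (GaloisField 2 n)) (v : GaloisField 2 n),
      Module.finrank (ZMod 2) E = k ∧
      ∑ᶠ u : E, (v + (u : GaloisField 2 n))⁻¹ = 0 := by
  obtain ⟨m, rfl⟩ := Nat.exists_eq_add_of_le' hk
  have hmn : 6 + (m + 1) * 10 ≤ n := by
    have h1 : (6 + (m + 1) * 10 : ℝ) ≤ n := by
      push_cast at h
      have : (0 : ℝ) ≤ m := Nat.cast_nonneg m
      linarith
    exact_mod_cast h1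
  have : Fintype (GaloisField 2 n) := Fintype.ofFinite _
  obtain ⟨L, a, hL, ha⟩ := exists_isSplitLinearized_coeff_eq_zero (F := GaloisField 2 n) m (by
    rw [GaloisField.card 2 n (by omega), ← pow_mul]
    calc 64 * 2 ^ ((m + 1) * 10) = 2 ^ (6 + (m + 1) * 10) := by rw [pow_add]; norm_num
      _ ≤ 2 ^ n := Nat.pow_le_pow_right two_pos hmn)
  obtain ⟨E, hE, hsum⟩ := hL.exists_sum_inv_eq_zero ha
  exact ⟨E, 0, hE, by simpa using hsum⟩
end

section
/- For every integer n ≥ 20, the multiplicative inverse function f_inv on F_{2^n} is not 5th order sum-free; that is, there exists a 5-dimensional F_2-affine subspace A of F_{2^n} with ∑_{x∈A} f_inv(x) = 0. -/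
open Polynomial Module

/-- The additive polynomial map `x ↦ a x⁸ + b x⁴ + c x² + d x` in characteristic two. -/
def octicMap {F : Type*} [Field F] [CharP F 2] [Algebra (ZMod 2) F] (a b c d : F) :
    F →ₗ[ZMod 2] F :=
  AddMonoidHom.toZModLinearMap 2
    { toFun := fun x => a * x ^ 8 + b * x ^ 4 + c * x ^ 2 + d * x
      map_zero' := by simp
      map_add' := fun x y => by grind }

section

variable {F : Type*} [Field F] [CharP F 2] [Algebra (ZMod 2) F]

theorem octicMap_apply (a b c d x : F) :
    octicMap a b c d x = a * x ^ 8 + b * x ^ 4 + c * x ^ 2 + d * x := rfl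

omit [CharP F 2] [Algebra (ZMod 2) F] in
theorem card_le_eight_of_octic (a b c d e : F) (h : b ≠ 0 ∨ d ≠ 0) (s : Finset F)
    (hs : ∀ x ∈ s, a * x ^ 8 + b * x ^ 4 + c * x ^ 2 + d * x + e = 0) : s.card ≤ 8 := by
  set p : F[X] := C a * X ^ 8 + C b * X ^ 4 + C c * X ^ 2 + C d * X + C e with hp
  have hp0 : p ≠ 0 := by
    intro h0
    have h4 : p.coeff 4 = b := by simp [hp]
    have h1 : p.coeff 1 = d := by simp [hp, coeff_C]
    rw [h0, coeff_zero] at h4 h1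
    rcases h with h | h
    · exact h h4.symm
    · exact h h1.symm
  have hdeg : p.natDegree ≤ 8 := by rw [hp]; compute_degree
  refine le_trans (card_le_degree_of_subset_roots (p := p) ?_) hdeg
  intro x hx
  rw [mem_roots hp0, IsRoot.def]
  simpa [hp] using hs x hx

theorem finrank_ker_octicMap_le [Finite F] (a b c d : F) (h : b ≠ 0 ∨ d ≠ 0) :
    finrank (ZMod 2) (LinearMap.ker (octicMap a b c d)) ≤ 3 := by
  classical
  have := Fintype.ofFinite F
  have h8 := card_le_eight_of_octic a b c d 0 h
    (Finset.univ.filter (· ∈ LinearMap.ker (octicMap a b c d)))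
    (by intro x hx; simpa [octicMap_apply] using hx)
  have hc := card_eq_pow_finrank (K := ZMod 2) (V := LinearMap.ker (octicMap a b c d))
  rw [Fintype.card_subtype, ZMod.card] at hc
  rw [hc] at h8
  exact (Nat.pow_le_pow_iff_right (by norm_num : 1 < 2)).1 h8

omit [CharP F 2] in
theorem trace_sq [Finite F] (x : F) :
    Algebra.trace (ZMod 2) F (x ^ 2) = Algebra.trace (ZMod 2) F x := by
  have := Algebra.trace_eq_of_algEquiv (FiniteField.frobeniusAlgEquivOfAlgebraic (ZMod 2) F) x
  simpa [FiniteField.frobeniusAlgEquivOfAlgebraic] using this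

omit [CharP F 2] in
theorem mem_orthogonal_traceForm {B : Submodule (ZMod 2) F} {x : F} :
    x ∈ (Algebra.traceForm (ZMod 2) F).orthogonal B ↔
      ∀ b ∈ B, Algebra.trace (ZMod 2) F (b * x) = 0 := by
  simp [LinearMap.BilinForm.mem_orthogonal_iff, 
    Algebra.traceForm_apply]

theorem range_octicMap_eq_orthogonal [Finite F] (a d : F)
    (h : finrank (ZMod 2) (LinearMap.ker (octicMap 1 1 (d ^ 2) a)) = 3) :
    LinearMap.range (octicMap a d 1 1) = (Algebra.traceForm (ZMod 2) F).orthogonal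
        (LinearMap.ker (octicMap 1 1 (d ^ 2) a)) ∧
      finrank (ZMod 2) (LinearMap.ker (octicMap a d 1 1)) = 3 := by
  have hle : LinearMap.range (octicMap a d 1 1) ≤ (Algebra.traceForm (ZMod 2) F).orthogonal
        (LinearMap.ker (octicMap 1 1 (d ^ 2) a)) := by
    rintro _ ⟨z, rfl⟩
    rw [mem_orthogonal_traceForm]
    intro b hb
    rw [LinearMap.mem_ker, octicMap_apply] at hb
    have e1 := trace_sq (b * d * z ^ 4)
    have e2 := trace_sq (b * z ^ 2)
    have e3 := trace_sq ((b * z ^ 2) ^ 2)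
    have e4 := trace_sq (b * z)
    have e5 := trace_sq ((b * z) ^ 2)
    have e6 := trace_sq (((b * z) ^ 2) ^ 2)
    calc Algebra.trace (ZMod 2) F (b * octicMap a d 1 1 z)
        = Algebra.trace (ZMod 2) F (b * a * z ^ 8) + Algebra.trace (ZMod 2) F (b * d * z ^ 4)
          + Algebra.trace (ZMod 2) F (b * z ^ 2) + Algebra.trace (ZMod 2) F (b * z) := by
            rw [← map_add, ← map_add, ← map_add, octicMap_apply]; congr 1; ring
      _ = Algebra.trace (ZMod 2) F (b * a * z ^ 8 + (b * d * z ^ 4) ^ 2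
          + ((b * z ^ 2) ^ 2) ^ 2 + (((b * z) ^ 2) ^ 2) ^ 2) := by
            rw [map_add, map_add, map_add, e1, e3, e2, e6, e5, e4]
      _ = Algebra.trace (ZMod 2) F (z ^ 8 * (1 * b ^ 8 + 1 * b ^ 4 + d ^ 2 * b ^ 2 + a * b)) := by
            congr 1; ring
      _ = 0 := by rw [hb, mul_zero, map_zero]
  have h1 := LinearMap.finrank_range_add_finrank_ker (octicMap a d 1 1)
  have h2 := finrank_ker_octicMap_le a d 1 1 (Or.inr one_ne_zero)
  have h3 := LinearMap.BilinForm.finrank_orthogonal (traceForm_nondegenerate (ZMod 2) F)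
    (LinearMap.ker (octicMap 1 1 (d ^ 2) a))
  have h4 := Submodule.finrank_mono hle
  have h5 := Submodule.finrank_le (LinearMap.ker (octicMap 1 1 (d ^ 2) a))
  exact ⟨Submodule.eq_of_le_of_finrank_eq hle (by omega), by omega⟩

theorem Submodule.finrank_comap_of_le_range {K V W : Type*} [Field K] [AddCommGroup V]
    [AddCommGroup W] [Module K V] [Module K W] [FiniteDimensional K V]
    (f : V →ₗ[K] W) {Q : Submodule K W} (hQ : Q ≤ LinearMap.range f) :
    finrank K (Q.comap f) = finrank K Q + finrank K (LinearMap.ker f) := by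
  have h := LinearMap.finrank_range_add_finrank_ker (f.domRestrict (Q.comap f))
  rw [LinearMap.range_domRestrict, Submodule.map_comap_eq_of_le hQ] at h
  rw [← h]
  congr 1
  rw [LinearMap.ker_domRestrict]
  exact (Submodule.comapSubtypeEquivOfLe (LinearMap.ker_le_comap f (p := Q))).finrank_eq

theorem ZMod.two_eq_zero_or_one (c : ZMod 2) : c = 0 ∨ c = 1 := by
  revert c; decide

theorem mem_span_pair_iff {x y w : F} : w ∈ Submodule.span (ZMod 2) {x, y} ↔
    w * (w + x) * (w + y) * (w + x + y) = 0 := by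
  have hn : ∀ u v : F, u + v = 0 ↔ u = v := fun u v => CharTwo.add_eq_zero
  rw [Submodule.mem_span_pair]
  constructor
  · rintro ⟨a, b, rfl⟩
    rcases ZMod.two_eq_zero_or_one a with rfl | rfl <;>
      rcases ZMod.two_eq_zero_or_one b with rfl | rfl <;>
      simp only [zero_smul, one_smul] <;> grind
  · intro h
    simp only [mul_eq_zero, hn, add_assoc] at h
    rcases h with ((h | h) | h) | h
    · exact ⟨0, 0, by simp [h]⟩
    · exact ⟨1, 0, by simp [h]⟩
    · exact ⟨0, 1, by simp [h]⟩
    · exact ⟨1, 1, by simp [h]⟩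

theorem exists_finrank_five_sum_inv_eq_zero [Finite F] (a d x y : F)
    (h : finrank (ZMod 2) (LinearMap.ker (octicMap 1 1 (d ^ 2) a)) = 3)
    (hx : x ∈ (Algebra.traceForm (ZMod 2) F).orthogonal
        (LinearMap.ker (octicMap 1 1 (d ^ 2) a)))
    (hy : y ∈ (Algebra.traceForm (ZMod 2) F).orthogonal
        (LinearMap.ker (octicMap 1 1 (d ^ 2) a)))
    (hx0 : x ≠ 0) (hy0 : y ≠ 0) (hxy : x + y ≠ 0)
    (hS : x ^ 2 + x * y + y ^ 2 = x * y * (x + y)) :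
    ∃ E : Submodule (ZMod 2) F, finrank (ZMod 2) E = 5 ∧ ∑ᶠ u : E, (0 + (u : F))⁻¹ = 0 := by
  classical
  have := Fintype.ofFinite F
  obtain ⟨hr, hk⟩ := range_octicMap_eq_orthogonal a d h
  set Q := Submodule.span (ZMod 2) {x, y} with hQ
  have hQle : Q ≤ LinearMap.range (octicMap a d 1 1) := by
    rw [hr, hQ, Submodule.span_le]
    rintro w (rfl | rfl)
    · exact hx
    · exact hy
  have hQ2 : finrank (ZMod 2) Q = 2 := by
    have hli : LinearIndependent (ZMod 2) ![x, y] := by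
      rw [LinearIndependent.pair_iff]
      intro s t hst
      rcases ZMod.two_eq_zero_or_one s with rfl | rfl <;>
        rcases ZMod.two_eq_zero_or_one t with rfl | rfl <;> simp_all
    have := finrank_span_eq_card hli
    rw [Matrix.range_cons_cons_empty] at this
    simpa using this
  have hE : finrank (ZMod 2) (Q.comap (octicMap a d 1 1)) = 5 := by
    rw [Submodule.finrank_comap_of_le_range _ hQle, hQ2, hk]
  refine ⟨Q.comap (octicMap a d 1 1), hE, ?_⟩
  have hcard : Fintype.card (Q.comap (octicMap a d 1 1)) = 32 := by
    rw [card_eq_pow_finrank (K := ZMod 2), hE, ZMod.card]; norm_num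
  rw [Fintype.card_subtype] at hcard
  set s := (Finset.univ.filter (· ∈ Q.comap (octicMap a d 1 1))).erase 0 with hs
  have hs31 : s.card = 31 := by
    rw [hs, Finset.card_erase_of_mem (by simp), hcard]
  set r : F[X] := C a * X ^ 7 + C d * X ^ 3 + X + 1 with hrdef
  set g := x * y * (x + y) with hg
  have hg0 : g ≠ 0 := mul_ne_zero (mul_ne_zero hx0 hy0) hxy
  set H : F[X] := r * (X ^ 3 * r ^ 3 + C g * X * r + C g) with hH
  have hroot : ∀ z ∈ s, H.eval z = 0 := by
    intro z hz
    simp only [hs, Finset.mem_erase, Finset.mem_filter, Finset.mem_univ, true_and,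
      Submodule.mem_comap, hQ, mem_span_pair_iff, octicMap_apply] at hz
    obtain ⟨hz0, hz⟩ := hz
    have hre : a * z ^ 8 + d * z ^ 4 + 1 * z ^ 2 + 1 * z = z * r.eval z := by
      simp [hrdef]; ring
    rw [hre] at hz
    have : z * H.eval z = 0 := by
      rw [← hz, hH]
      simp only [eval_mul, eval_add, eval_pow, eval_X, eval_C]
      generalize r.eval z = ρ
      grind
    exact (mul_eq_zero.1 this).resolve_left hz0
  have hH0 : H.eval 0 = g := by simp [hH, hrdef]
  have hH1 : (derivative H).eval 0 = 0 := by
    simp [hH, hrdef, derivative_pow]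
    exact CharTwo.add_self_eq_zero g
  have hne : H ≠ 0 := by rintro h0; rw [h0, eval_zero] at hH0; exact hg0 hH0.symm
  have hdeg : H.natDegree ≤ s.card := by
    have hr7 : r.natDegree ≤ 7 := by rw [hrdef]; compute_degree
    rw [hs31, hH]
    refine natDegree_mul_le_of_le hr7 (n := 24) ?_
    refine natDegree_add_le_of_degree_le (natDegree_add_le_of_degree_le ?_ ?_) (by simp)
    · exact natDegree_mul_le_of_le (m := 3) (by simp) (n := 21)
        (natDegree_pow_le_of_le 3 hr7)
    · exact (natDegree_mul_le_of_le (m := 1) (natDegree_C_mul_le g X |>.trans natDegree_X_le) hr7).trans (by norm_num)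
  have hroots := roots_eq_of_natDegree_le_card_of_ne_zero hroot hdeg hne
  have hsplit : H.Splits := by
    rw [splits_iff_card_roots]
    refine le_antisymm (card_roots' H) ?_
    rw [hroots]; exact hdeg
  have key := hsplit.eval_derivative_div_eval_of_ne_zero (x := 0) (by rw [hH0]; exact hg0)
  rw [hH1, zero_div, hroots] at key
  have key' : ∑ z ∈ s, z⁻¹ = 0 := by
    change 0 = ∑ z ∈ s, 1 / (0 - z) at key
    rw [key]
    refine Finset.sum_congr rfl fun z _ => ?_
    rw [zero_sub, CharTwo.neg_eq, one_div]
  rw [finsum_eq_sum_of_fintype]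
  simp only [zero_add]
  rw [← key', hs, Finset.sum_erase _ inv_zero]
  exact (Finset.sum_subtype _ (by simp) fun z : F => z⁻¹).symm

end

open Finset in
theorem card_filter_map_eq_le {α β : Type*} [DecidableEq α] [DecidableEq β] (M : Finset α)
    (f : α → β) (g : α → α)
    (h : ∀ m ∈ M, ∀ m' ∈ M, f m = f m' → m' = m ∨ m' = g m) :
    #{p ∈ M ×ˢ M | f p.1 = f p.2} ≤ 2 * #M := by
  have hsub : {p ∈ M ×ˢ M | f p.1 = f p.2} ⊆
      M.image (fun m => (m, m)) ∪ M.image (fun m => (m, g m)) := by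
    rintro ⟨m, m'⟩ hp
    simp only [mem_filter, mem_product] at hp
    rcases h m hp.1.1 m' hp.1.2 hp.2 with h' | h'
    · exact mem_union_left _ (mem_image.2 ⟨m, hp.1.1, by rw [h']⟩)
    · exact mem_union_right _ (mem_image.2 ⟨m, hp.1.1, by rw [h']⟩)
  refine (card_le_card hsub).trans ((card_union_le _ _).trans ?_)
  rw [two_mul]
  exact Nat.add_le_add card_image_le card_image_le

section

variable (F : Type*) [Field F] [Algebra (ZMod 2) F]

open Classical in
/-- The quadratic additive character `x ↦ (-1) ^ Tr x` of a finite field of characteristic two. -/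
noncomputable def traceSign : AddChar F ℤ where
  toFun x := if Algebra.trace (ZMod 2) F x = 0 then 1 else -1
  map_zero_eq_one' := by simp
  map_add_eq_mul' x y := by
    rw [map_add]
    rcases ZMod.two_eq_zero_or_one (Algebra.trace (ZMod 2) F x) with h | h <;>
      rcases ZMod.two_eq_zero_or_one (Algebra.trace (ZMod 2) F y) with h' | h' <;>
      rw [h, h'] <;> decide

variable {F}

theorem traceSign_eq_neg_one {x : F} (h : Algebra.trace (ZMod 2) F x ≠ 0) :
    traceSign F x = -1 := if_neg h

theorem sum_traceSign_mul_eq_zero [DecidableEq F] (B : Submodule (ZMod 2) F) (s : Finset F)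
    (hs : ∀ u, u ∈ s ↔ u ∈ B) {x : F}
    (hx : x ∉ (Algebra.traceForm (ZMod 2) F).orthogonal B) :
    ∑ u ∈ s, traceSign F (u * x) = 0 := by
  rw [mem_orthogonal_traceForm] at hx
  push Not at hx
  obtain ⟨b, hb, hbx⟩ := hx
  have : ∑ u ∈ s, traceSign F (u * x) = ∑ u ∈ s, -traceSign F (u * x) := by
    refine Finset.sum_equiv (Equiv.addRight b) ?_ ?_
    · intro u
      simp [hs, B.add_mem_iff_left hb]
    · intro u _
      simp [add_mul, AddChar.map_add_eq_mul, traceSign_eq_neg_one hbx]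
  rw [Finset.sum_neg_distrib] at this
  linarith

theorem sum_traceSign_mul [Fintype F] [DecidableEq F] (x : F) :
    ∑ u, traceSign F (u * x) = if x = 0 then (Fintype.card F : ℤ) else 0 := by
  split_ifs with h
  · simp [h]
  · refine sum_traceSign_mul_eq_zero ⊤ Finset.univ (by simp) fun hx => h ?_
    have hbot := Submodule.finrank_eq_zero.1 <|
      (LinearMap.BilinForm.finrank_orthogonal (traceForm_nondegenerate (ZMod 2) F) ⊤).trans
        (by rw [finrank_top, Nat.sub_self])
    rw [hbot] at hx
    simpa using hx

theorem sum_sq_sum_traceSign [CharP F 2] [Fintype F] [DecidableEq F] {ι : Type*}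
    (M : Finset ι) (f : ι → F) :
    ∑ u, (∑ m ∈ M, traceSign F (u * f m)) ^ 2 =
      Fintype.card F * (Finset.card {p ∈ M ×ˢ M | f p.1 = f p.2} : ℤ) := by
  have h : ∀ u, (∑ m ∈ M, traceSign F (u * f m)) ^ 2 =
      ∑ p ∈ M ×ˢ M, traceSign F (u * (f p.1 + f p.2)) := by
    intro u
    rw [sq, Finset.sum_mul_sum, ← Finset.sum_product']
    simp only [mul_add, AddChar.map_add_eq_mul]
  simp_rw [h]
  rw [Finset.sum_comm]
  simp_rw [sum_traceSign_mul, CharTwo.add_eq_zero]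
  rw [← Finset.sum_filter, Finset.sum_const, nsmul_eq_mul, mul_comm]

theorem sum_sq_sum_traceSign_two [CharP F 2] [Fintype F] [DecidableEq F] {ι : Type*}
    (M : Finset ι) (f g : ι → F) :
    ∑ p : F × F, (∑ m ∈ M, traceSign F (p.1 * f m + p.2 * g m)) ^ 2 =
      Fintype.card F ^ 2 * (Finset.card {p ∈ M ×ˢ M | f p.1 = f p.2 ∧ g p.1 = g p.2} : ℤ) := by
  have h : ∀ p : F × F, (∑ m ∈ M, traceSign F (p.1 * f m + p.2 * g m)) ^ 2 =
      ∑ k ∈ M ×ˢ M, traceSign F (p.1 * (f k.1 + f k.2)) * traceSign F (p.2 * (g k.1 + g k.2)) := by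
    intro p
    rw [sq, Finset.sum_mul_sum, ← Finset.sum_product']
    refine Finset.sum_congr rfl fun k _ => ?_
    simp only [mul_add, AddChar.map_add_eq_mul]
    ring
  simp_rw [h]
  rw [Finset.sum_comm]
  simp_rw [Fintype.sum_prod_type, ← Finset.mul_sum, ← Finset.sum_mul, sum_traceSign_mul,
    CharTwo.add_eq_zero, ite_zero_mul_ite_zero]
  rw [← Finset.sum_filter, Finset.sum_const, nsmul_eq_mul, mul_comm, sq]

end

section

variable (F : Type*) [Field F] [CharP F 2] [Algebra (ZMod 2) F] [Fintype F]

open Classical in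
/-- The pairs `(a, e)` for which `x⁸ + x⁴ + e x² + a x` vanishes on a three-dimensional space. -/
noncomputable def splitOctics : Finset (F × F) :=
  {ω | finrank (ZMod 2) (LinearMap.ker (octicMap 1 1 ω.2 ω.1)) = 3}

variable {F}

open Classical in
/-- The roots of `x⁸ + x⁴ + e x² + a x`, where `ω = (a, e)`. -/
noncomputable def octicRoots (ω : F × F) : Finset F :=
  {x | x ∈ LinearMap.ker (octicMap 1 1 ω.2 ω.1)}

theorem mem_octicRoots {ω : F × F} {x : F} :
    x ∈ octicRoots ω ↔ x ^ 8 + x ^ 4 + ω.2 * x ^ 2 + ω.1 * x = 0 := by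
  simp [octicRoots, octicMap_apply]

theorem card_octicRoots_le (ω : F × F) : (octicRoots ω).card ≤ 8 :=
  card_le_eight_of_octic 1 1 ω.2 ω.1 0 (Or.inl one_ne_zero) _
    fun x hx => by simpa using mem_octicRoots.1 hx

theorem exists_mem_splitOctics {s t : F} (hs : s ^ 2 + s ≠ 0)
    (ht : t ^ 4 + (1 + (s ^ 2 + s)) * t ^ 2 + (s ^ 2 + s) * t ≠ 0)
    (he : t ^ 4 + (1 + (s ^ 2 + s)) * t ^ 2 + (s ^ 2 + s) * t + (1 + (s ^ 2 + s) ^ 2) ≠ 0) :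
    ∃ ω ∈ splitOctics F, ∃ c ≠ 0,
      c ∈ octicRoots ω ∧ c * s ∈ octicRoots ω ∧ c * t ∈ octicRoots ω := by
  obtain ⟨σ, hσ⟩ : ∃ σ, σ = s ^ 2 + s := ⟨_, rfl⟩
  obtain ⟨τ, hτ⟩ : ∃ τ, τ = t ^ 4 + (1 + σ) * t ^ 2 + σ * t := ⟨_, rfl⟩
  rw [← hσ] at hs ht he
  rw [← hτ] at ht he
  obtain ⟨r, hr⟩ := FiniteField.isSquare_of_char_two (ringChar.eq F 2)
    (τ + (1 + σ ^ 2))⁻¹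
  obtain ⟨c, hc⟩ := FiniteField.isSquare_of_char_two (ringChar.eq F 2) r
  have hc4 : c ^ 4 * (τ + (1 + σ ^ 2)) = 1 := by
    have : c ^ 4 = (τ + (1 + σ ^ 2))⁻¹ := by rw [hr, hc]; ring
    rw [this, inv_mul_cancel₀ he]
  have hc0 : c ≠ 0 := by rintro rfl; simp at hc4
  set ω : F × F := (c ^ 7 * (τ * σ), c ^ 6 * (σ ^ 2 + τ * (1 + σ))) with hω
  have key : ∀ x, x ^ 8 + (τ + (1 + σ ^ 2)) * x ^ 4 + (σ ^ 2 + τ * (1 + σ)) * x ^ 2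
      + τ * σ * x = 0 → c * x ∈ octicRoots ω := by
    intro x hx
    rw [mem_octicRoots, hω]
    linear_combination c ^ 8 * hx - c ^ 4 * x ^ 4 * hc4
  have h2 : (2 : F) = 0 := CharTwo.two_eq_zero
  have m1 : c ∈ octicRoots ω := by
    have := key 1 (by linear_combination (1 + σ ^ 2 + τ + τ * σ) * h2)
    rwa [mul_one] at this
  have m2 : c * s ∈ octicRoots ω := by
    apply key; subst hσ; grind
  have m3 : c * t ∈ octicRoots ω := by
    apply key; subst hτ; grind
  refine ⟨ω, ?_, c, hc0, m1, m2, m3⟩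
  rw [splitOctics, Finset.mem_filter]
  refine ⟨Finset.mem_univ _, le_antisymm
    (finrank_ker_octicMap_le _ _ _ _ (Or.inl one_ne_zero)) ?_⟩
  have hli : LinearIndependent (ZMod 2) ![c, c * s, c * t] := by
    rw [Fintype.linearIndependent_iff]
    intro g hg
    simp only [Fin.sum_univ_three, Matrix.cons_val] at hg
    have : g 0 = 0 ∧ g 1 = 0 ∧ g 2 = 0 := by
      rcases ZMod.two_eq_zero_or_one (g 0) with h0 | h0 <;>
        rcases ZMod.two_eq_zero_or_one (g 1) with h1 | h1 <;>
        rcases ZMod.two_eq_zero_or_one (g 2) with h2 | h2 <;>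
        rw [h0, h1, h2] at hg ⊢ <;>
        simp only [zero_smul, one_smul, zero_add, add_zero] at hg <;>
        first
        | exact ⟨rfl, rfl, rfl⟩
        | (exfalso; grind)
    intro i
    fin_cases i
    exacts [this.1, this.2.1, this.2.2]
  have h3 := finrank_span_eq_card hli
  rw [Fintype.card_fin] at h3
  refine h3.ge.trans ?_
  refine Submodule.finrank_mono (Submodule.span_le.2 ?_)
  have hmem : ∀ x, x ∈ octicRoots ω → x ∈ LinearMap.ker (octicMap 1 1 ω.2 ω.1) := by
    intro x hx
    simpa [octicRoots] using hx
  rintro _ ⟨i, rfl⟩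
  fin_cases i
  exacts [hmem _ m1, hmem _ m2, hmem _ m3]

open Finset in
theorem card_splitOctics_ge (hq : 16 ≤ Fintype.card F) :
    (Fintype.card F - 2) * (Fintype.card F - 16) ≤ #(splitOctics F) * 512 := by
  classical
  set S : Finset F := {s | s ^ 2 + s ≠ 0} with hS
  set P : F → Finset F := fun s =>
    {t | t ^ 4 + (1 + (s ^ 2 + s)) * t ^ 2 + (s ^ 2 + s) * t ≠ 0 ∧
      t ^ 4 + (1 + (s ^ 2 + s)) * t ^ 2 + (s ^ 2 + s) * t + (1 + (s ^ 2 + s) ^ 2) ≠ 0} with hP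
  have hScard : Fintype.card F - 2 ≤ #S := by
    have hsub : univ ⊆ S ∪ {0, 1} := by
      intro s _
      by_cases h : s ^ 2 + s = 0
      · have : s * (s + 1) = 0 := by linear_combination h
        rw [mul_eq_zero, CharTwo.add_eq_zero] at this
        exact mem_union_right _ (by simpa using this)
      · exact mem_union_left _ (by simpa [hS] using h)
    have h1 := (card_le_card hsub).trans (card_union_le _ _)
    have h2 : #({0, 1} : Finset F) ≤ 2 := card_le_two
    rw [card_univ] at h1
    omega
  have hPcard : ∀ s ∈ S, Fintype.card F - 16 ≤ #(P s) := by
    intro s _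
    set A : F → Finset F := fun e =>
      {t | t ^ 4 + (1 + (s ^ 2 + s)) * t ^ 2 + (s ^ 2 + s) * t + e = 0} with hA
    have hAcard : ∀ e, #(A e) ≤ 8 := fun e =>
      card_le_eight_of_octic 0 1 _ _ e (Or.inl one_ne_zero) _
        fun t ht => by simpa [hA] using ht
    have hsub : univ ⊆ P s ∪ (A 0 ∪ A (1 + (s ^ 2 + s) ^ 2)) := by
      intro t _
      simp only [hP, hA, mem_union, mem_filter, mem_univ, true_and, add_zero]
      tauto
    have h1 := (card_le_card hsub).trans (card_union_le _ _)
    have h2 := card_union_le (A 0) (A (1 + (s ^ 2 + s) ^ 2))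
    have h3 := hAcard 0
    have h4 := hAcard (1 + (s ^ 2 + s) ^ 2)
    rw [card_univ] at h1
    omega
  have hsub : S.sigma P ⊆ (splitOctics F).biUnion fun ω =>
      (octicRoots ω ×ˢ octicRoots ω ×ˢ octicRoots ω).image
        fun k => (⟨k.2.1 / k.1, k.2.2 / k.1⟩ : Σ _ : F, F) := by
    rintro ⟨s, t⟩ hst
    simp only [hS, hP, mem_sigma, mem_filter, mem_univ, true_and] at hst
    obtain ⟨ω, hω, c, hc, m1, m2, m3⟩ := exists_mem_splitOctics hst.1 hst.2.1 hst.2.2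
    refine mem_biUnion.2 ⟨ω, hω, mem_image.2 ⟨(c, c * s, c * t), ?_, ?_⟩⟩
    · simp [m1, m2, m3]
    · simp [hc]
  calc (Fintype.card F - 2) * (Fintype.card F - 16) ≤ #S * (Fintype.card F - 16) :=
        Nat.mul_le_mul_right _ hScard
    _ ≤ #(S.sigma P) := by rw [card_sigma]; exact card_nsmul_le_sum _ _ _ hPcard
    _ ≤ _ := card_le_card hsub
    _ ≤ #(splitOctics F) * 512 := by
        refine card_biUnion_le_card_mul _ _ _ fun ω _ => card_image_le.trans ?_
        have := card_octicRoots_le ω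
        rw [card_product, card_product]
        calc _ ≤ 8 * (8 * 8) := by gcongr
          _ = 512 := rfl

end

section

variable {F : Type*} [Field F] [CharP F 2] [Algebra (ZMod 2) F]

section

variable (F) [Fintype F]

open Classical in
/-- The elements of `F` outside the subfield with four elements. -/
noncomputable def outsideF4 : Finset F := {m | m ^ 4 + m ≠ 0}

end

omit [Algebra (ZMod 2) F] in
theorem ne_of_pow_four_add_ne_zero {m : F} (h : m ^ 4 + m ≠ 0) :
    m ≠ 0 ∧ m + 1 ≠ 0 ∧ m ^ 2 + m + 1 ≠ 0 := by
  have h2 : (2 : F) = 0 := CharTwo.two_eq_zero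
  refine ⟨?_, ?_, ?_⟩ <;> intro h' <;> apply h
  · simp [h']
  · linear_combination (m ^ 3 - m ^ 2 + m) * h'
  · linear_combination (m ^ 2 - m) * h' + m * h2

variable [Fintype F]

omit [CharP F 2] [Algebra (ZMod 2) F] in
theorem mem_outsideF4 {m : F} : m ∈ outsideF4 F ↔ m ^ 4 + m ≠ 0 := by
  simp [outsideF4]

open Finset in
omit [CharP F 2] [Algebra (ZMod 2) F] in
theorem card_outsideF4_ge : Fintype.card F ≤ #(outsideF4 F) + 8 := by
  classical
  have hsub : univ ⊆ outsideF4 F ∪ ({m | m ^ 4 + m = 0} : Finset F) := by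
    intro m _
    simp only [mem_union, mem_outsideF4, mem_filter, mem_univ, true_and]
    tauto
  have h1 := (card_le_card hsub).trans (card_union_le _ _)
  have h2 := card_le_eight_of_octic 0 1 0 1 0 (Or.inl one_ne_zero)
    ({m | m ^ 4 + m = 0} : Finset F) fun m hm => by simpa using hm
  rw [card_univ] at h1
  omega

/-- The exponential sum `∑ (-1) ^ Tr (u (m + 1 + 1 / m) + v (m + 1 / (m + 1)))` over the
elements `m` of `F` outside the subfield with four elements. -/
noncomputable def pairSum (u v : F) : ℤ :=
  ∑ m ∈ outsideF4 F, traceSign F (u * (m + 1 + m⁻¹) + v * (m + (m + 1)⁻¹))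

open Finset in
theorem sum_sq_pairSum_left :
    ∑ u : F, pairSum u 0 ^ 2 ≤ Fintype.card F * (2 * #(outsideF4 F)) := by
  classical
  simp only [pairSum, zero_mul, add_zero]
  rw [sum_sq_sum_traceSign]
  gcongr
  exact_mod_cast card_filter_map_eq_le _ (fun m : F => m + 1 + m⁻¹) (fun m => m⁻¹) (by
    intro m hm m' hm' h
    obtain ⟨h0, h1, -⟩ := ne_of_pow_four_add_ne_zero (mem_outsideF4.1 hm)
    obtain ⟨h0', h1', -⟩ := ne_of_pow_four_add_ne_zero (mem_outsideF4.1 hm')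
    grind)

open Finset in
theorem sum_sq_pairSum_right :
    ∑ v : F, pairSum 0 v ^ 2 ≤ Fintype.card F * (2 * #(outsideF4 F)) := by
  classical
  simp only [pairSum, zero_mul, zero_add]
  rw [sum_sq_sum_traceSign]
  gcongr
  exact_mod_cast card_filter_map_eq_le _ (fun m : F => m + (m + 1)⁻¹)
    (fun m => 1 + (m + 1)⁻¹) (by
    intro m hm m' hm' h
    obtain ⟨h0, h1, -⟩ := ne_of_pow_four_add_ne_zero (mem_outsideF4.1 hm)
    obtain ⟨h0', h1', -⟩ := ne_of_pow_four_add_ne_zero (mem_outsideF4.1 hm')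
    grind)

open Finset in
theorem sum_sq_pairSum_diag :
    ∑ u : F, pairSum u u ^ 2 ≤ Fintype.card F * (2 * #(outsideF4 F)) := by
  classical
  simp only [pairSum, ← mul_add]
  rw [sum_sq_sum_traceSign]
  gcongr
  exact_mod_cast card_filter_map_eq_le _ (fun m : F => m + 1 + m⁻¹ + (m + (m + 1)⁻¹))
    (fun m => m + 1) (by
    intro m hm m' hm' h
    obtain ⟨h0, h1, -⟩ := ne_of_pow_four_add_ne_zero (mem_outsideF4.1 hm)
    obtain ⟨h0', h1', -⟩ := ne_of_pow_four_add_ne_zero (mem_outsideF4.1 hm')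
    grind)

open Finset in
theorem sum_sq_pairSum :
    ∑ p : F × F, pairSum p.1 p.2 ^ 2 ≤ Fintype.card F ^ 2 * #(outsideF4 F) := by
  classical
  simp only [pairSum]
  rw [sum_sq_sum_traceSign_two]
  gcongr
  refine card_le_card_of_injOn Prod.fst (fun p hp => ?_) fun p hp p' hp' h => ?_
  · simp only [coe_filter, mem_product, Set.mem_ofPred_eq] at hp
    exact hp.1.1
  · have hfst : ∀ p : F × F, p.1 ∈ outsideF4 F → p.2 ∈ outsideF4 F →
        p.1 + 1 + p.1⁻¹ = p.2 + 1 + p.2⁻¹ → p.1 + (p.1 + 1)⁻¹ = p.2 + (p.2 + 1)⁻¹ →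
        p.2 = p.1 := by
      rintro ⟨m, m'⟩ hm hm' hx hy
      obtain ⟨h0, h1, h2⟩ := ne_of_pow_four_add_ne_zero (mem_outsideF4.1 hm)
      obtain ⟨h0', h1', -⟩ := ne_of_pow_four_add_ne_zero (mem_outsideF4.1 hm')
      dsimp only at *
      grind
    simp only [coe_filter, mem_product, Set.mem_ofPred_eq] at hp hp'
    refine Prod.ext h ?_
    rw [hfst p hp.1.1 hp.1.2 hp.2.1 hp.2.2, hfst p' hp'.1.1 hp'.1.2 hp'.2.1 hp'.2.2, h]

open Finset in
theorem card_splitOctics_filter_le [DecidableEq F] (u v : F) (huv : (u, v) ≠ 0) :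
    #{ω ∈ splitOctics F | u ∈ octicRoots ω ∧ v ∈ octicRoots ω} ≤
      if v = 0 ∨ u = 0 ∨ u = v then Fintype.card F else 1 := by
  classical
  split_ifs with h
  · rw [← card_univ]
    refine card_le_card_of_injOn Prod.snd (fun _ _ => mem_coe.2 (mem_univ _)) ?_
    rintro ⟨a, e⟩ hω ⟨a', e'⟩ hω' he
    simp only [coe_filter, Set.mem_ofPred_eq, mem_octicRoots] at hω hω' he
    subst he
    have hw : ∀ w : F, w ≠ 0 → w ^ 8 + w ^ 4 + e * w ^ 2 + a * w = 0 →
        w ^ 8 + w ^ 4 + e * w ^ 2 + a' * w = 0 → a = a' := by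
      intro w hw h h'
      exact mul_right_cancel₀ hw (by linear_combination h - h')
    have : u ≠ 0 ∨ v ≠ 0 := by
      by_contra! hc
      exact huv (Prod.ext hc.1 hc.2)
    rw [Prod.mk.injEq]
    refine ⟨?_, rfl⟩
    rcases this with hu | hv
    · exact hw u hu hω.2.1 hω'.2.1
    · exact hw v hv hω.2.2 hω'.2.2
  · push Not at h
    obtain ⟨hv, hu, hne⟩ := h
    rw [card_le_one]
    rintro ⟨a, e⟩ hω ⟨a', e'⟩ hω'
    simp only [mem_filter, mem_octicRoots] at hω hω'
    have h1 : (e - e') * u + (a - a') = 0 := mul_right_cancel₀ hu (by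
      linear_combination hω.2.1 - hω'.2.1)
    have h2 : (e - e') * v + (a - a') = 0 := mul_right_cancel₀ hv (by
      linear_combination hω.2.2 - hω'.2.2)
    have h3 : e - e' = 0 := mul_right_cancel₀ (sub_ne_zero.2 hne) (by
      linear_combination h1 - h2)
    rw [h3, zero_mul, zero_add] at h1
    rw [sub_eq_zero.1 h3, sub_eq_zero.1 h1]

open Finset in
theorem sum_pairSum_eq_zero (ω : F × F)
    (h : ∀ m ∈ outsideF4 F, ¬ (m + 1 + m⁻¹ ∈ (Algebra.traceForm (ZMod 2) F).orthogonal
        (LinearMap.ker (octicMap 1 1 ω.2 ω.1)) ∧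
      m + (m + 1)⁻¹ ∈ (Algebra.traceForm (ZMod 2) F).orthogonal
        (LinearMap.ker (octicMap 1 1 ω.2 ω.1)))) :
    ∑ p ∈ octicRoots ω ×ˢ octicRoots ω, pairSum p.1 p.2 = 0 := by
  classical
  have hmem : ∀ u, u ∈ octicRoots ω ↔ u ∈ LinearMap.ker (octicMap 1 1 ω.2 ω.1) := by
    intro u; simp [octicRoots]
  simp only [pairSum]
  rw [sum_comm]
  refine sum_eq_zero fun m hm => ?_
  simp only [AddChar.map_add_eq_mul (traceSign F) (_ * _)]
  rw [sum_product]
  dsimp only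
  rw [← sum_mul_sum]
  rcases not_and_or.1 (h m hm) with hx | hx
  · rw [sum_traceSign_mul_eq_zero _ _ hmem hx, zero_mul]
  · rw [sum_traceSign_mul_eq_zero _ _ hmem hx, mul_zero]

open Finset in
theorem sq_card_outsideF4_le [DecidableEq F] (ω : F × F)
    (h : ∑ p ∈ octicRoots ω ×ˢ octicRoots ω, pairSum p.1 p.2 = 0) :
    (#(outsideF4 F) : ℤ) ^ 2 ≤
      63 * ∑ p ∈ (octicRoots ω ×ˢ octicRoots ω).erase 0, pairSum p.1 p.2 ^ 2 := by
  have h0 : (0 : F × F) ∈ octicRoots ω ×ˢ octicRoots ω := by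
    simp [mem_octicRoots]
  have hT : pairSum (0 : F × F).1 (0 : F × F).2 = #(outsideF4 F) := by
    simp [pairSum]
  rw [← add_sum_erase _ _ h0, hT] at h
  have hcard : #((octicRoots ω ×ˢ octicRoots ω).erase 0) ≤ 63 := by
    rw [card_erase_of_mem h0, card_product]
    have := Nat.mul_le_mul (card_octicRoots_le ω) (card_octicRoots_le ω)
    omega
  calc (#(outsideF4 F) : ℤ) ^ 2
      = (∑ p ∈ (octicRoots ω ×ˢ octicRoots ω).erase 0, pairSum p.1 p.2) ^ 2 := by
        rw [eq_neg_of_add_eq_zero_left h, neg_sq]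
    _ ≤ #((octicRoots ω ×ˢ octicRoots ω).erase 0) *
          ∑ p ∈ (octicRoots ω ×ˢ octicRoots ω).erase 0, pairSum p.1 p.2 ^ 2 :=
        sq_sum_le_card_mul_sum_sq
    _ ≤ _ := mul_le_mul_of_nonneg_right (by exact_mod_cast hcard)
        (sum_nonneg fun _ _ => sq_nonneg _)

open Finset in
theorem sum_splitOctics_sum_sq_pairSum_le [DecidableEq F] :
    ∑ ω ∈ splitOctics F, ∑ p ∈ (octicRoots ω ×ˢ octicRoots ω).erase 0, pairSum p.1 p.2 ^ 2 ≤
      7 * (Fintype.card F : ℤ) ^ 2 * #(outsideF4 F) := by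
  set q : ℤ := (Fintype.card F : ℤ) with hq
  have hq0 : 0 ≤ q := by positivity
  have hle : ∀ p : F × F, (if p ≠ 0 then (#{ω ∈ splitOctics F |
      p.1 ∈ octicRoots ω ∧ p.2 ∈ octicRoots ω} : ℤ) * pairSum p.1 p.2 ^ 2 else 0) ≤
      pairSum p.1 p.2 ^ 2 + q * ((if p.2 = 0 then pairSum p.1 p.2 ^ 2 else 0) +
        (if p.1 = 0 then pairSum p.1 p.2 ^ 2 else 0) +
        (if p.1 = p.2 then pairSum p.1 p.2 ^ 2 else 0)) := by
    intro p
    have hT := sq_nonneg (pairSum p.1 p.2)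
    have hqT := mul_nonneg hq0 hT
    by_cases hp : p = 0
    · rw [if_neg (not_not.2 hp)]
      split_ifs <;> nlinarith
    · rw [if_pos hp]
      have hN : (#{ω ∈ splitOctics F | p.1 ∈ octicRoots ω ∧ p.2 ∈ octicRoots ω} : ℤ) ≤
          if p.2 = 0 ∨ p.1 = 0 ∨ p.1 = p.2 then q else 1 := by
        rw [hq]
        exact_mod_cast card_splitOctics_filter_le p.1 p.2 hp
      refine (mul_le_mul_of_nonneg_right hN hT).trans ?_
      generalize pairSum p.1 p.2 ^ 2 = T at *
      split_ifs <;> first | nlinarith | tauto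
  have hswap : ∑ ω ∈ splitOctics F, ∑ p ∈ (octicRoots ω ×ˢ octicRoots ω).erase 0,
      pairSum p.1 p.2 ^ 2 = ∑ p : F × F, if p ≠ 0 then (#{ω ∈ splitOctics F |
        p.1 ∈ octicRoots ω ∧ p.2 ∈ octicRoots ω} : ℤ) * pairSum p.1 p.2 ^ 2 else 0 := by
    have : ∀ ω ∈ splitOctics F, ∑ p ∈ (octicRoots ω ×ˢ octicRoots ω).erase 0,
        pairSum p.1 p.2 ^ 2 = ∑ p : F × F, if p ≠ 0 ∧ p.1 ∈ octicRoots ω ∧ p.2 ∈ octicRoots ω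
          then pairSum p.1 p.2 ^ 2 else 0 := by
      intro ω _
      rw [← sum_filter]
      refine sum_congr ?_ fun _ _ => rfl
      ext p
      simp
    rw [sum_congr rfl this, sum_comm]
    refine sum_congr rfl fun p _ => ?_
    by_cases hp : p = 0
    · simp [hp]
    · simp only [hp, ne_eq, not_false_eq_true, true_and, if_true]
      rw [← sum_filter, sum_const, nsmul_eq_mul]
  rw [hswap]
  refine (sum_le_sum fun p _ => hle p).trans ?_
  rw [sum_add_distrib, ← mul_sum, sum_add_distrib, sum_add_distrib]
  have e1 : ∑ p : F × F, (if p.2 = 0 then pairSum p.1 p.2 ^ 2 else 0) =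
      ∑ u : F, pairSum u 0 ^ 2 := by
    rw [Fintype.sum_prod_type]; simp
  have e2 : ∑ p : F × F, (if p.1 = 0 then pairSum p.1 p.2 ^ 2 else 0) =
      ∑ v : F, pairSum 0 v ^ 2 := by
    rw [Fintype.sum_prod_type_right]; simp
  have e3 : ∑ p : F × F, (if p.1 = p.2 then pairSum p.1 p.2 ^ 2 else 0) =
      ∑ u : F, pairSum u u ^ 2 := by
    rw [Fintype.sum_prod_type]; simp
  rw [e1, e2, e3]
  have b0 := sum_sq_pairSum (F := F)
  have b1 := sum_sq_pairSum_left (F := F)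
  have b2 := sum_sq_pairSum_right (F := F)
  have b3 := sum_sq_pairSum_diag (F := F)
  have := mul_le_mul_of_nonneg_left (add_le_add (add_le_add b1 b2) b3) hq0
  rw [← hq] at b0 this
  linarith

open Finset in
theorem exists_mem_splitOctics_mem_orthogonal (hq : 2 ^ 20 ≤ Fintype.card F) :
    ∃ ω ∈ splitOctics F, ∃ m ∈ outsideF4 F,
      m + 1 + m⁻¹ ∈ (Algebra.traceForm (ZMod 2) F).orthogonal
        (LinearMap.ker (octicMap 1 1 ω.2 ω.1)) ∧
      m + (m + 1)⁻¹ ∈ (Algebra.traceForm (ZMod 2) F).orthogonal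
        (LinearMap.ker (octicMap 1 1 ω.2 ω.1)) := by
  classical
  by_contra! hcon
  have h1 : (#(splitOctics F) : ℤ) * #(outsideF4 F) ^ 2 ≤
      63 * (7 * (Fintype.card F : ℤ) ^ 2 * #(outsideF4 F)) := by
    rw [← nsmul_eq_mul, ← sum_const]
    refine (sum_le_sum fun ω hω => sq_card_outsideF4_le ω (sum_pairSum_eq_zero ω
      fun m hm hc => hcon ω hω m hm hc.1 hc.2)).trans ?_
    rw [← mul_sum]
    exact mul_le_mul_of_nonneg_left sum_splitOctics_sum_sq_pairSum_le (by norm_num)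
  have h2 := card_splitOctics_ge (F := F) (by omega)
  have h3 := card_outsideF4_ge (F := F)
  generalize Fintype.card F = q at *
  obtain ⟨k, rfl⟩ := Nat.exists_eq_add_of_le hq
  have h2' : ((2 : ℤ) ^ 20 + k - 2) * (2 ^ 20 + k - 16) ≤ #(splitOctics F) * 512 := by
    zify [show 2 ≤ 2 ^ 20 + k by omega, show 16 ≤ 2 ^ 20 + k by omega] at h2
    exact h2
  have h3' : (2 : ℤ) ^ 20 + k - 8 ≤ #(outsideF4 F) := by zify at h3; linarith
  push_cast at h1
  generalize (#(outsideF4 F) : ℤ) = M at *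
  generalize (#(splitOctics F) : ℤ) = W at *
  have hk : (0 : ℤ) ≤ k := by positivity
  generalize (k : ℤ) = K at *
  have hM : 0 < M := by linarith
  have h4 : W * M ≤ 441 * (2 ^ 20 + K) ^ 2 := le_of_mul_le_mul_right (by linarith) hM
  have h5 : ((2 : ℤ) ^ 20 + K - 2) * (2 ^ 20 + K - 16) * (2 ^ 20 + K - 8) ≤
      W * 512 * M := mul_le_mul h2' h3' (by linarith) (by nlinarith)
  nlinarith [mul_nonneg hk hk, mul_nonneg hk (mul_nonneg hk hk)]

theorem exists_finrank_five_sum_inv_eq_zero_of_card_ge (hq : 2 ^ 20 ≤ Fintype.card F) :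
    ∃ E : Submodule (ZMod 2) F, finrank (ZMod 2) E = 5 ∧ ∑ᶠ u : E, (0 + (u : F))⁻¹ = 0 := by
  obtain ⟨⟨a, e⟩, hω, m, hm, hx, hy⟩ := exists_mem_splitOctics_mem_orthogonal hq
  obtain ⟨h0, h1, h2⟩ := ne_of_pow_four_add_ne_zero (mem_outsideF4.1 hm)
  obtain ⟨d, hd⟩ := FiniteField.isSquare_of_char_two (ringChar.eq F 2) e
  rw [← sq] at hd
  subst hd
  have hx' : m + 1 + m⁻¹ = (m ^ 2 + m + 1) / m := by field_simp
  have hy' : m + (m + 1)⁻¹ = (m ^ 2 + m + 1) / (m + 1) := by field_simp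
  have hxy : (m ^ 2 + m + 1) / m + (m ^ 2 + m + 1) / (m + 1) =
      (m ^ 2 + m + 1) / (m * (m + 1)) := by grind
  rw [hx'] at hx
  rw [hy'] at hy
  refine exists_finrank_five_sum_inv_eq_zero a d _ _ (by simpa [splitOctics] using hω) hx hy
    (div_ne_zero h2 h0) (div_ne_zero h2 h1) ?_ ?_
  · rw [hxy]
    exact div_ne_zero h2 (mul_ne_zero h0 h1)
  · grind

end

/-- For every `n ≥ 20`, the multiplicative inverse function `f_inv(x) = x⁻¹`
(with `f_inv(0) = 0`) on `F_{2^n}` is not `5`th order sum-free: there is a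
`5`-dimensional `F₂`-affine subspace `A = v + E` of `F_{2^n}` with
`∑_{x ∈ A} f_inv(x) = 0`. -/
theorem inv_not_fifth_order_sum_free_of_twenty_le (n : ℕ) (hn : 20 ≤ n) :
    ∃ (E : Submodule (ZMod 2) (GaloisField 2 n)) (v : GaloisField 2 n),
      Module.finrank (ZMod 2) E = 5 ∧
      ∑ᶠ u : E, (v + (u : GaloisField 2 n))⁻¹ = 0 := by
  have := Fintype.ofFinite (GaloisField 2 n)
  have hcard : 2 ^ 20 ≤ Fintype.card (GaloisField 2 n) := by
    rw [← Nat.card_eq_fintype_card, GaloisField.card 2 n (by omega)]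
    exact Nat.pow_le_pow_right (by norm_num) hn
  obtain ⟨E, hE, hsum⟩ := exists_finrank_five_sum_inv_eq_zero_of_card_ge hcard
  exact ⟨E, 0, hE, hsum⟩
end
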